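/- Let f(Z), g(Z) ∈ ℤ[Z] satisfy the nondegeneracy condition and let K be an imaginary quadratic field. Then for every ε > 0 there is a constant C (depending only on f, g, K, ε) such that for all real T ≥ 1 and x ≥ 2, one has Σ_{t ∈ F(T), Δ(t) ≠ 0} π_{E(t)}(K; x) ≤ C (T x^{4/3+ε} + T² x^{5/6}). -/

import Mathlib

open Polynomial Finset

attribute [local instance 10] Classical.propDecidable

noncomputable section

/-- The discriminant polynomial `Δ = -16(4f³+27g²)`. -/
def Dpoly (f g : Polynomial ℤ) : Polynomial ℤ := -16 * (4 * f ^ 3 + 27 * g ^ 2)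

/-- Nondegeneracy: `Δ ≠ 0` as a polynomial and the `j`-invariant
`j = -1728(4f)³/Δ` is not a constant rational function, i.e. `-1728(4f)³`
is not a rational multiple of `Δ`. -/
def Nondeg (f g : Polynomial ℤ) : Prop :=
  Dpoly f g ≠ 0 ∧
    ¬∃ c : ℚ, (-1728 : Polynomial ℚ) * (4 * f.map (Int.castRingHom ℚ)) ^ 3 =
      Polynomial.C c * (Dpoly f g).map (Int.castRingHom ℚ)

/-- The set `F(T) = {u/v ∈ ℚ : gcd(u,v) = 1, 1 ≤ u, v ≤ T}`. -/
def FT (T : ℝ) : Finset ℚ :=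
  ((Finset.Icc (1 : ℤ) ⌊T⌋ ×ˢ Finset.Icc (1 : ℤ) ⌊T⌋).filter
      fun w => Int.gcd w.1 w.2 = 1).image fun w => (w.1 : ℚ) / (w.2 : ℚ)

/-- Reduction of a rational number `t` modulo `p`, as `num·den⁻¹` in `ZMod p`. -/
def redQ (p : ℕ) (t : ℚ) : ZMod p := (t.num : ZMod p) * (t.den : ZMod p)⁻¹

/-- The number of `𝔽_p`-points of the curve `Y² = X³ + AX + B`
(affine points together with the point at infinity). -/
def numPoints (p : ℕ) (A B : ZMod p) : ℕ :=
  1 + Nat.card {P : ZMod p × ZMod p // P.2 ^ 2 = P.1 ^ 3 + A * P.1 + B}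

/-- The Frobenius trace `p + 1 - #E(𝔽_p)` of `Y² = X³ + AX + B` over `𝔽_p`. -/
def frobTrace (p : ℕ) (A B : ZMod p) : ℤ := (p : ℤ) + 1 - numPoints p A B

/-- `a_p(E(t))`: the Frobenius trace of the reduction modulo `p` of the curve
`E(t) : Y² = X³ + f(t)X + g(t)`. -/
def apE (f g : Polynomial ℤ) (p : ℕ) (t : ℚ) : ℤ :=
  frobTrace p ((f.map (Int.castRingHom (ZMod p))).eval (redQ p t))
    ((g.map (Int.castRingHom (ZMod p))).eval (redQ p t))

/-- Good reduction of `E(t)` at `p`: the denominator of `t` is coprime to `p`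
and `Δ(t) ≢ 0 (mod p)`. -/
def goodRed (f g : Polynomial ℤ) (p : ℕ) (t : ℚ) : Prop :=
  ¬(p ∣ t.den) ∧ ((Dpoly f g).map (Int.castRingHom (ZMod p))).eval (redQ p t) ≠ 0

/-- `π_{E(t)}(𝔄; x)`: the number of primes `p ≤ x` of good reduction for `E(t)`
with `a_p(E(t)) = a_p`. -/
def piSeq (f g : Polynomial ℤ) (a : ℕ → ℤ) (t : ℚ) (x : ℝ) : ℕ :=
  ((Finset.Icc 1 ⌊x⌋₊).filter fun p =>
      p.Prime ∧ goodRed f g p t ∧ apE f g p t = a p).card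

/-- `π_{E(t)}(K; x)` for `K = ℚ(√d)`: the number of primes `p ≤ x` of good
reduction for `E(t)` with `a_p(E(t)) ≠ 0` and `a_p(E(t))² - 4p = d·m²`. -/
def piK (f g : Polynomial ℤ) (d : ℤ) (t : ℚ) (x : ℝ) : ℕ :=
  ((Finset.Icc 1 ⌊x⌋₊).filter fun p =>
      p.Prime ∧ goodRed f g p t ∧ apE f g p t ≠ 0 ∧
        ∃ m : ℤ, 0 < m ∧ (apE f g p t) ^ 2 - 4 * (p : ℤ) = d * m ^ 2).card

/-- The Frobenius angle `ψ_p(E(t)) ∈ [0, π]`, with `cos ψ_p = a_p/(2√p)`. -/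
def psiE (f g : Polynomial ℤ) (p : ℕ) (t : ℚ) : ℝ :=
  Real.arccos ((apE f g p t : ℝ) / (2 * Real.sqrt p))

/-- `π_{E(t)}(α, β; x)`: the number of primes `p ≤ x` of good reduction for
`E(t)` with `ψ_p(E(t)) ∈ [α, β]`. -/
def piAngle (f g : Polynomial ℤ) (α β : ℝ) (t : ℚ) (x : ℝ) : ℕ :=
  ((Finset.Icc 1 ⌊x⌋₊).filter fun p =>
      p.Prime ∧ goodRed f g p t ∧ psiE f g p t ∈ Set.Icc α β).card

/-- The Sato–Tate density `μ_ST(α, β) = (2/π) ∫_α^β sin²θ dθ`. -/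
def muST (α β : ℝ) : ℝ := (2 / Real.pi) * ∫ θ in α..β, Real.sin θ ^ 2

/-- `π(x)`: the number of primes `p ≤ x`. -/
def primePi (x : ℝ) : ℕ := ((Finset.Icc 1 ⌊x⌋₊).filter Nat.Prime).card

/-- `e_p(w) = exp(2πi w/p)`. -/
def ep (p : ℕ) (w : ZMod p) : ℂ :=
  Complex.exp (2 * (Real.pi : ℂ) * Complex.I * (w.val : ℂ) / (p : ℂ))

section QSeries

open UpperHalfPlane ModularForm Function.Periodic Filter Topology
open scoped MatrixGroups Manifold

/-- `f` is given on the upper half plane by the power series `φ` in `exp (2πiτ/h)`. -/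
def HasQ (h : ℝ) (f : ℍ → ℂ) (φ : PowerSeries ℂ) : Prop :=
  ∀ τ : ℍ, HasSum (fun n => PowerSeries.coeff n φ * qParam h τ ^ n) (f τ)

namespace HasQ

variable {h : ℝ} {f g : ℍ → ℂ} {φ ψ : PowerSeries ℂ}

theorem add (hf : HasQ h f φ) (hg : HasQ h g ψ) : HasQ h (fun τ => f τ + g τ) (φ + ψ) := by
  intro τ
  simpa [add_mul] using (hf τ).add (hg τ)

theorem sub (hf : HasQ h f φ) (hg : HasQ h g ψ) : HasQ h (fun τ => f τ - g τ) (φ - ψ) := by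
  intro τ
  simpa [sub_mul] using (hf τ).sub (hg τ)

theorem const (c : ℂ) : HasQ h (fun _ => c) (PowerSeries.C c) := by
  intro τ
  have := hasSum_single (f := fun n => PowerSeries.coeff n (PowerSeries.C c) * qParam h τ ^ n) 0
    (by intro n hn; simp [PowerSeries.coeff_C, hn])
  simpa using this

theorem mul (hf : HasQ h f φ) (hg : HasQ h g ψ) : HasQ h (fun τ => f τ * g τ) (φ * ψ) := by
  intro τ
  have h1 := summable_norm_iff.mpr (hf τ).summable
  have h2 := summable_norm_iff.mpr (hg τ).summable
  have hs := (summable_norm_sum_mul_antidiagonal_of_summable_norm h1 h2).of_norm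
  have h3 := tsum_mul_tsum_eq_tsum_sum_antidiagonal_of_summable_norm h1 h2
  rw [(hf τ).tsum_eq, (hg τ).tsum_eq] at h3
  show HasSum _ (f τ * g τ)
  rw [h3]
  refine hs.hasSum.congr_fun fun n => ?_
  rw [PowerSeries.coeff_mul, Finset.sum_mul]
  refine Finset.sum_congr rfl fun x hx => ?_
  rw [HasAntidiagonal.mem_antidiagonal] at hx
  rw [← hx, pow_add]
  ring

theorem prod {ι : Type*} (s : Finset ι) {F : ι → ℍ → ℂ} {Φ : ι → PowerSeries ℂ}
    (hF : ∀ i ∈ s, HasQ h (F i) (Φ i)) : HasQ h (fun τ => ∏ i ∈ s, F i τ) (∏ i ∈ s, Φ i) := by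
  induction s using Finset.induction_on with
  | empty => simpa using const (h := h) 1
  | insert a s ha ih =>
    simp only [Finset.prod_insert ha]
    exact (hF a (by simp)).mul (ih fun i hi => hF i (by simp [hi]))

theorem sum {ι : Type*} (s : Finset ι) {F : ι → ℍ → ℂ} {Φ : ι → PowerSeries ℂ}
    (hF : ∀ i ∈ s, HasQ h (F i) (Φ i)) : HasQ h (fun τ => ∑ i ∈ s, F i τ) (∑ i ∈ s, Φ i) := by
  induction s using Finset.induction_on with
  | empty => simpa using const (h := h) 0
  | insert a s ha ih =>
    simp only [Finset.sum_insert ha]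
    exact (hF a (by simp)).add (ih fun i hi => hF i (by simp [hi]))

theorem pow (hf : HasQ h f φ) (n : ℕ) : HasQ h (fun τ => f τ ^ n) (φ ^ n) := by
  have := prod (h := h) (Finset.range n) (F := fun _ => f) (Φ := fun _ => φ) fun _ _ => hf
  simpa using this

theorem const_mul (hf : HasQ h f φ) (c : ℂ) : HasQ h (fun τ => c * f τ) (PowerSeries.C c * φ) :=
  (const c).mul hf

/-- The power series as an analytic function on the unit disc. -/
theorem hasFPowerSeriesOnBall (hh : 0 < h) (hf : HasQ h f φ) :
    HasFPowerSeriesOnBall (FormalMultilinearSeries.ofScalars ℂ (fun n => PowerSeries.coeff n φ)).sum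
      (FormalMultilinearSeries.ofScalars ℂ (fun n => PowerSeries.coeff n φ)) 0 1 := by
  set p := FormalMultilinearSeries.ofScalars ℂ (fun n => PowerSeries.coeff n φ)
  have hr : 1 ≤ p.radius := by
    refine ENNReal.le_of_forall_nnreal_lt fun r hr => ?_
    have hr1 : (r : ℝ) < 1 := by exact_mod_cast hr
    rcases eq_or_ne r 0 with rfl | hr0
    · simp
    have hq : (r : ℂ) ≠ 0 := by exact_mod_cast hr0
    have hn : ‖(r : ℂ)‖ < 1 := by simpa using hr1
    have := hf ⟨invQParam h r, im_invQParam_pos_of_norm_lt_one hh hn hq⟩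
    have hs := summable_norm_iff.mpr this.summable
    simp only [qParam_right_inv hh.ne' hq] at hs
    refine p.le_radius_of_summable ?_
    refine hs.congr fun n => ?_
    simp [p]
  exact (p.hasFPowerSeriesOnBall (lt_of_lt_of_le one_pos hr)).mono one_pos hr

theorem eq_sum (hf : HasQ h f φ) (τ : ℍ) :
    f τ = (FormalMultilinearSeries.ofScalars ℂ (fun n => PowerSeries.coeff n φ)).sum
      (qParam h τ) := by
  rw [← (hf τ).tsum_eq]
  exact (FormalMultilinearSeries.ofScalars_sum_eq (E := ℂ) (fun n => PowerSeries.coeff n φ)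
    (qParam h τ)).symm

theorem bounded (hh : 0 < h) (hf : HasQ h f φ) : IsBoundedAtImInfty f :=
  isBoundedAtImInfty_of_hasSum_qExpansion hh hf

theorem tendsto (hh : 0 < h) (hf : HasQ h f φ) :
    Tendsto f atImInfty (𝓝 (PowerSeries.coeff 0 φ)) := by
  have h1 := (hasFPowerSeriesOnBall hh hf).hasFPowerSeriesAt.continuousAt.tendsto
  have h2 := h1.comp (qParam_tendsto_atImInfty hh)
  have h3 : (FormalMultilinearSeries.ofScalars ℂ (fun n => PowerSeries.coeff n φ)).sum 0 =
      PowerSeries.coeff 0 φ := by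
    refine (FormalMultilinearSeries.ofScalarsSum_zero (E := ℂ)
      (fun n => PowerSeries.coeff n φ)).trans ?_
    simp
  rw [h3] at h2
  exact h2.congr fun τ => (hf.eq_sum τ).symm

theorem mdifferentiable (hh : 0 < h) (hf : HasQ h f φ) : MDiff f := by
  rw [UpperHalfPlane.mdifferentiable_iff]
  have h1 := (hasFPowerSeriesOnBall hh hf).differentiableOn
  have h2 : DifferentiableOn ℂ (fun z : ℂ => (FormalMultilinearSeries.ofScalars ℂ
      (fun n => PowerSeries.coeff n φ)).sum (qParam h z)) {z | 0 < z.im} := by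
    refine h1.comp (differentiable_qParam.differentiableOn) fun z hz => ?_
    have := norm_qParam_lt_one hh hz
    rw [Metric.mem_eball, edist_zero_right, ← ofReal_norm, ENNReal.ofReal_lt_one]
    exact this
  refine h2.congr fun z hz => ?_
  rw [Function.comp_apply, hf.eq_sum, ofComplex_apply_of_im_pos hz]

theorem unique (hh : 0 < h) (hf : HasQ h f φ) (hg : HasQ h f ψ) : φ = ψ := by
  have h1 := (hasFPowerSeriesOnBall hh hf)
  have h2 := (hasFPowerSeriesOnBall hh hg)
  have key : (FormalMultilinearSeries.ofScalars ℂ (fun n => PowerSeries.coeff n φ)).sum =ᶠ[𝓝 0]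
      (FormalMultilinearSeries.ofScalars ℂ (fun n => PowerSeries.coeff n ψ)).sum := by
    refine (h1.hasFPowerSeriesAt.continuousAt.eventuallyEq_nhds_iff_eventuallyEq_nhdsNE
      h2.hasFPowerSeriesAt.continuousAt).mp ?_
    have hb : ∀ᶠ q : ℂ in 𝓝[≠] 0, ‖q‖ < 1 := by
      refine nhdsWithin_le_nhds ?_
      filter_upwards [Metric.ball_mem_nhds (0 : ℂ) one_pos] with q hq
      simpa using hq
    filter_upwards [hb, self_mem_nhdsWithin] with q hq hq0
    have e1 := hf.eq_sum ⟨invQParam h q, im_invQParam_pos_of_norm_lt_one hh hq hq0⟩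
    have e2 := hg.eq_sum ⟨invQParam h q, im_invQParam_pos_of_norm_lt_one hh hq hq0⟩
    rw [e1] at e2
    simpa [UpperHalfPlane.coe_mk, qParam_right_inv hh.ne' hq0] using e2
  have h3 := h1.hasFPowerSeriesAt.congr key
  have h4 := h3.eq_formalMultilinearSeries h2.hasFPowerSeriesAt
  ext n
  simpa using congr_arg (FormalMultilinearSeries.coeff · n) h4

end HasQ

end QSeries

section LevelOneForms

open UpperHalfPlane ModularForm Function.Periodic Filter Topology ModularGroup
open scoped MatrixGroups Manifold

/-- `v` is a modular form of level one and weight `k` with `q`-expansion `φ`. -/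
structure IsLevelOne (k : ℤ) (v : ℍ → ℂ) (φ : PowerSeries ℂ) : Prop where
  hasQ : HasQ 1 v φ
  slash_S : v ∣[k] S = v

theorem HasQ.slash_T {v : ℍ → ℂ} {φ : PowerSeries ℂ} (hv : HasQ 1 v φ) (k : ℤ) :
    v ∣[k] T = v := by
  ext τ
  have h1 : v (T • τ) = v τ := by
    rw [hv.eq_sum, hv.eq_sum]
    congr 1
    rw [modular_T_smul]
    simp only [coe_vadd, qParam]
    rw [Complex.exp_eq_exp_iff_exists_int]
    exact ⟨1, by push_cast; ring⟩
  rw [SL_slash_apply, h1]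
  have h2 : denom T τ = 1 := by rw [ModularGroup.denom_apply]; simp [T]
  rw [h2]
  simp

namespace IsLevelOne

variable {k l : ℤ} {v w : ℍ → ℂ} {φ ψ : PowerSeries ℂ}

theorem slash (hv : IsLevelOne k v φ) (γ : SL(2, ℤ)) : v ∣[k] γ = v :=
  SlashInvariantForm.slash_action_generators_SL2Z hv.slash_S (hv.hasQ.slash_T k) γ

theorem smul (hv : IsLevelOne k v φ) (γ : SL(2, ℤ)) (τ : ℍ) :
    v (γ • τ) = denom γ τ ^ k * v τ := by
  have h := congr_fun (hv.slash γ) τ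
  rw [SL_slash_apply] at h
  rw [← h, mul_comm, mul_assoc, ← zpow_add₀ (denom_ne_zero _ _)]
  simp

theorem of_S (hv : HasQ 1 v φ) (h : ∀ τ : ℍ, v (S • τ) = (τ : ℂ) ^ k * v τ) :
    IsLevelOne k v φ := by
  refine ⟨hv, funext fun τ => ?_⟩
  rw [SL_slash_apply, h, denom_S, mul_comm, ← mul_assoc, ← zpow_add₀ τ.ne_zero]
  simp

theorem apply_S (hv : IsLevelOne k v φ) (τ : ℍ) : v (S • τ) = (τ : ℂ) ^ k * v τ := by
  rw [hv.smul, denom_S]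

/-- The bundled modular form. -/
def toForm (hv : IsLevelOne k v φ) : ModularForm 𝒮ℒ k where
  toFun := v
  slash_action_eq' := fun _ ⟨γ, hγ⟩ => hγ ▸ hv.slash γ
  holo' := hv.hasQ.mdifferentiable one_pos
  bdd_at_cusps' {c} hc := by
    rw [Subgroup.IsArithmetic.isCusp_iff_isCusp_SL2Z] at hc
    rw [OnePoint.isBoundedAt_iff_forall_SL2Z hc]
    intro γ _
    rw [hv.slash γ]
    exact hv.hasQ.bounded one_pos

@[simp] theorem coe_toForm (hv : IsLevelOne k v φ) : (hv.toForm : ℍ → ℂ) = v := rfl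

theorem of_form (f : ModularForm 𝒮ℒ k) : IsLevelOne k f (qExpansion 1 f) := by
  refine ⟨fun τ => ModularForm.hasSum_qExpansion (f := f) one_pos
    one_mem_strictPeriods_SL τ, ?_⟩
  exact SlashInvariantFormClass.slash_action_eq f _ ⟨S, rfl⟩

theorem qExpansion_eq (hv : IsLevelOne k v φ) : qExpansion 1 hv.toForm = φ :=
  (of_form hv.toForm).hasQ.unique one_pos hv.hasQ

theorem mul (hv : IsLevelOne k v φ) (hw : IsLevelOne l w ψ) :
    IsLevelOne (k + l) (fun τ => v τ * w τ) (φ * ψ) := by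
  refine of_S (hv.hasQ.mul hw.hasQ) fun τ => ?_
  rw [hv.apply_S, hw.apply_S, zpow_add₀ τ.ne_zero]
  ring

theorem sub (hv : IsLevelOne k v φ) (hw : IsLevelOne k w ψ) :
    IsLevelOne k (fun τ => v τ - w τ) (φ - ψ) := by
  refine of_S (hv.hasQ.sub hw.hasQ) fun τ => ?_
  rw [hv.apply_S, hw.apply_S]
  ring

theorem const_mul (hv : IsLevelOne k v φ) (c : ℂ) :
    IsLevelOne k (fun τ => c * v τ) (PowerSeries.C c * φ) := by
  refine of_S (hv.hasQ.const_mul c) fun τ => ?_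
  rw [hv.apply_S]
  ring

theorem pow (hv : IsLevelOne k v φ) (n : ℕ) :
    IsLevelOne (n * k) (fun τ => v τ ^ n) (φ ^ n) := by
  refine of_S (hv.hasQ.pow n) fun τ => ?_
  rw [hv.apply_S, mul_pow, mul_comm (n : ℤ), zpow_mul, zpow_natCast]

theorem weight_zero (hv : IsLevelOne 0 v φ) : ∃ c, φ = PowerSeries.C c := by
  obtain ⟨c, hc⟩ := ModularFormClass.levelOne_weight_zero_const hv.toForm
  refine ⟨c, hv.hasQ.unique one_pos ?_⟩
  have : v = fun _ => c := hc
  rw [this]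
  exact HasQ.const c

theorem div_discriminant (hv : IsLevelOne k v φ) (h0 : PowerSeries.coeff 0 φ = 0) :
    ∃ w ψ, IsLevelOne (k - 12) w ψ ∧ ∀ τ, v τ = w τ * (E₄ τ ^ 3 - E₆ τ ^ 2) := by
  have h0' : (qExpansion 1 hv.toForm).coeff 0 = 0 := by rw [hv.qExpansion_eq, h0]
  have hw := of_form (CuspForm.discriminantEquiv (toCuspForm hv.toForm h0'))
  refine ⟨_, _, hw.const_mul (1 / 1728), fun τ => ?_⟩
  have h2 := discriminant_mul_discriminantEquiv_apply (toCuspForm hv.toForm h0') τ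
  rw [toCuspForm_apply, discriminant_eq_E₄_cube_sub_E₆_sq] at h2
  change _ = v τ at h2
  rw [← h2]
  ring

end IsLevelOne

/-- The `q`-expansion of `E₂`. -/
def serP : PowerSeries ℤ :=
  PowerSeries.mk fun n => if n = 0 then 1 else -24 * (ArithmeticFunction.sigma 1 n : ℤ)

/-- The `q`-expansion of `E₄`. -/
def serQ : PowerSeries ℤ :=
  PowerSeries.mk fun n => if n = 0 then 1 else 240 * (ArithmeticFunction.sigma 3 n : ℤ)

/-- The `q`-expansion of `E₆`. -/
def serR : PowerSeries ℤ :=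
  PowerSeries.mk fun n => if n = 0 then 1 else -504 * (ArithmeticFunction.sigma 5 n : ℤ)

theorem bernoulli_four_eq : _root_.bernoulli 4 = -1 / 30 := by
  rw [bernoulli_eq_bernoulli'_of_ne_one (by norm_num), bernoulli'_four]

theorem bernoulli_six_eq : _root_.bernoulli 6 = 1 / 42 := by
  have h5 : bernoulli' 5 = 0 := bernoulli'_eq_zero_of_odd (by decide) (by norm_num)
  have h62 : Nat.choose 6 2 = 15 := by decide
  have h64 : Nat.choose 6 4 = 15 := by decide
  rw [bernoulli_eq_bernoulli'_of_ne_one (by norm_num), bernoulli'_def]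
  norm_num [sum_range_succ, h5, h62, h64]

theorem isLevelOne_E₄ : IsLevelOne 4 E₄ (serQ.map (Int.castRingHom ℂ)) := by
  convert IsLevelOne.of_form E₄ using 1
  ext n
  rw [EisensteinSeries.E_qExpansion_coeff _ ⟨2, rfl⟩]
  simp only [serQ, PowerSeries.coeff_map, PowerSeries.coeff_mk]
  split_ifs
  · simp
  · norm_num [bernoulli_four_eq]

theorem isLevelOne_E₆ : IsLevelOne 6 E₆ (serR.map (Int.castRingHom ℂ)) := by
  convert IsLevelOne.of_form E₆ using 1
  ext n
  rw [EisensteinSeries.E_qExpansion_coeff _ ⟨3, rfl⟩]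
  simp only [serR, PowerSeries.coeff_map, PowerSeries.coeff_mk]
  split_ifs
  · simp
  · norm_num [bernoulli_six_eq]

theorem hasQ_E2 : HasQ 1 EisensteinSeries.E2 (serP.map (Int.castRingHom ℂ)) := by
  intro τ
  have := EisensteinSeries.hasSum_qExpansion_E2 τ
  refine this.congr_fun fun n => ?_
  simp only [serP, PowerSeries.coeff_map, PowerSeries.coeff_mk]
  split_ifs <;> simp [qParam]

end LevelOneForms

section Ramanujan

open UpperHalfPlane ModularForm Function.Periodic Filter Topology ModularGroup Derivative
open scoped MatrixGroups Manifold

/-- The derivation `q d/dq` on power series. -/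
def qDeriv {R : Type*} [CommRing R] (φ : PowerSeries R) : PowerSeries R :=
  PowerSeries.mk fun n => (n : R) * PowerSeries.coeff n φ

theorem HasQ.normalizedDeriv {f : ℍ → ℂ} {φ : PowerSeries ℂ} (hf : HasQ 1 f φ) :
    HasQ 1 (normalizedDerivOfComplex f) (qDeriv φ) := by
  intro τ
  set q := qParam 1 (τ : ℂ) with hq
  have hq1 : ‖q‖ < 1 := norm_qParam_lt_one one_pos τ.im_pos
  obtain ⟨r, hr0, hr1⟩ := exists_between hq1
  have hr : 0 < r := (norm_nonneg q).trans_lt hr0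
  have hsum : Summable fun n => ‖PowerSeries.coeff n φ‖ * r ^ n := by
    have hq0 : (r : ℂ) ≠ 0 := by exact_mod_cast hr.ne'
    have hn : ‖(r : ℂ)‖ < 1 := by simpa [abs_of_pos hr] using hr1
    have := hf ⟨invQParam 1 r, im_invQParam_pos_of_norm_lt_one one_pos hn hq0⟩
    have hs := summable_norm_iff.mpr this.summable
    simp only [qParam_right_inv one_ne_zero hq0] at hs
    refine hs.congr fun n => ?_
    simp [abs_of_pos hr]
  have hder := Complex.hasSum_deriv_of_summable_norm (U := Metric.ball 0 r)
    (F := fun n w => PowerSeries.coeff n φ * w ^ n) hsum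
    (fun n => (differentiable_const _ |>.mul (differentiable_pow n)).differentiableOn)
    Metric.isOpen_ball (fun n w hw => by
      rw [norm_mul, norm_pow]
      have : ‖w‖ ≤ r := (by simpa using hw : ‖w‖ < r).le
      gcongr) (z := q) (by simpa using hr0)
  set G : ℂ → ℂ := fun w => ∑' n, PowerSeries.coeff n φ * w ^ n with hG
  have hGd : DifferentiableAt ℂ G q := by
    have : DifferentiableOn ℂ G (Metric.ball 0 r) :=
      Complex.differentiableOn_tsum_of_summable_norm hsum
        (fun n => (differentiable_const _ |>.mul (differentiable_pow n)).differentiableOn)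
        Metric.isOpen_ball (fun n w hw => by
          rw [norm_mul, norm_pow]
          have : ‖w‖ ≤ r := (by simpa using hw : ‖w‖ < r).le
          gcongr)
    exact this.differentiableAt (Metric.isOpen_ball.mem_nhds (by simpa using hr0))
  have hqd : HasDerivAt (fun z : ℂ => qParam 1 z) (2 * Real.pi * Complex.I * q) (τ : ℂ) := by
    have h1 : HasDerivAt (fun z : ℂ => 2 * Real.pi * Complex.I * z / (1 : ℝ))
        (2 * Real.pi * Complex.I) (τ : ℂ) := by
      simpa using (hasDerivAt_id (τ : ℂ)).const_mul (2 * Real.pi * Complex.I : ℂ)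
    exact h1.cexp.congr_deriv (mul_comm _ _)
  have hcomp : HasDerivAt (f ∘ ofComplex) (deriv G q * (2 * Real.pi * Complex.I * q)) τ := by
    refine (hGd.hasDerivAt.comp (τ : ℂ) hqd).congr_of_eventuallyEq ?_
    filter_upwards [isOpen_upperHalfPlaneSet.mem_nhds τ.im_pos] with z hz
    have h3 := (hf ⟨z, hz⟩).tsum_eq
    rw [Function.comp_apply, ofComplex_apply_of_im_pos hz, ← h3]
    rfl
  have hpi : (2 * Real.pi * Complex.I : ℂ) ≠ 0 := by
    simp [Real.pi_ne_zero]
  have hval : normalizedDerivOfComplex f τ = deriv G q * q := by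
    rw [normalizedDerivOfComplex, hcomp.deriv]
    field_simp
  rw [hval]
  refine (hder.mul_right q).congr_fun fun n => ?_
  simp only [qDeriv, PowerSeries.coeff_mk, deriv_const_mul_field', deriv_pow_field]
  rcases n with _ | n
  · simp
  · simp [pow_succ]
    ring

theorem IsLevelOne.eq_zero_of_weight_lt {k : ℤ} {v : ℍ → ℂ} {φ : PowerSeries ℂ}
    (hk : k < 12) (hv : IsLevelOne k v φ) (h0 : PowerSeries.coeff 0 φ = 0) : φ = 0 := by
  obtain ⟨w, ψ, hw, hvw⟩ := hv.div_discriminant h0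
  have hw0 : w = 0 := ModularFormClass.levelOne_neg_weight_eq_zero (by lia) hw.toForm
  refine hv.hasQ.unique one_pos fun τ => ?_
  rw [hvw, hw0]
  simp

theorem isLevelOne_serreDerivative {k : ℤ} {v : ℍ → ℂ} {φ : PowerSeries ℂ}
    (hv : IsLevelOne k v φ) : IsLevelOne (k + 2) (serreDerivative k v)
      (qDeriv φ - PowerSeries.C (k * 12⁻¹ : ℂ) * serP.map (Int.castRingHom ℂ) * φ) := by
  refine ⟨?_, serreDerivative_slash_invariant (hv.hasQ.mdifferentiable one_pos) hv.slash_S⟩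
  have := hv.hasQ.normalizedDeriv.sub ((hasQ_E2.const_mul (k * 12⁻¹ : ℂ)).mul hv.hasQ)
  exact this

theorem isLevelOne_derivE2 : IsLevelOne 4
    (fun τ => normalizedDerivOfComplex EisensteinSeries.E2 τ -
      (12⁻¹ : ℂ) * EisensteinSeries.E2 τ ^ 2)
    (qDeriv (serP.map (Int.castRingHom ℂ)) -
      PowerSeries.C (12⁻¹ : ℂ) * serP.map (Int.castRingHom ℂ) ^ 2) := by
  refine ⟨hasQ_E2.normalizedDeriv.sub ((hasQ_E2.pow 2).const_mul _), ?_⟩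
  set e := EisensteinSeries.E2
  set u : ℂ := (2 * Real.pi * Complex.I)⁻¹ with hu
  have hpi : (Real.pi : ℂ) ≠ 0 := by simp [Real.pi_ne_zero]
  have he : e ∣[(2 : ℤ)] S = fun τ : ℍ => e τ + 12 * u * (τ : ℂ)⁻¹ := by
    rw [EisensteinSeries.E2_slash_action]
    ext τ
    have hτ := τ.ne_zero
    have hS : (S : Matrix.SpecialLinearGroup (Fin 2) ℤ) 1 0 = 1 := by simp [S]
    simp only [Pi.sub_apply, Pi.smul_apply, EisensteinSeries.D2, denom_S, hS, riemannZeta_two,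
      smul_eq_mul, hu, mul_inv, Complex.inv_I]
    field_simp
    push_cast
    linear_combination (12 : ℂ) * Complex.I_sq * 0
  have hmd : MDiff e := hasQ_E2.mdifferentiable one_pos
  have h1 := normalizedDerivOfComplex_SL_slash (k := 2) hmd (γ := S)
  have hinv : ∀ τ : ℍ, HasDerivAt (fun z : ℂ => 12 * u * z⁻¹) (12 * u * -((τ : ℂ) ^ 2)⁻¹) τ :=
    fun τ => (hasDerivAt_inv τ.ne_zero).const_mul _
  have h2 : ∀ τ : ℍ, normalizedDerivOfComplex (fun τ : ℍ => e τ + 12 * u * (τ : ℂ)⁻¹) τ =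
      normalizedDerivOfComplex e τ + u * (12 * u * -((τ : ℂ) ^ 2)⁻¹) := by
    intro τ
    simp only [normalizedDerivOfComplex, ← hu]
    have hd : DifferentiableAt ℂ (e ∘ ofComplex) τ := by
      have := (UpperHalfPlane.mdifferentiable_iff.mp hmd)
      exact this.differentiableAt (isOpen_upperHalfPlaneSet.mem_nhds τ.im_pos)
    have h3 := hd.hasDerivAt.add (hinv τ)
    have h4 := h3.congr_of_eventuallyEq
      (f₁ := (fun τ : ℍ => e τ + 12 * u * (τ : ℂ)⁻¹) ∘ ofComplex) (by
        filter_upwards [isOpen_upperHalfPlaneSet.mem_nhds τ.im_pos] with z hz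
        simp [ofComplex_apply_of_im_pos hz])
    rw [h4.deriv, mul_add]
  rw [he] at h1
  ext τ
  have h3 := congr_fun h1 τ
  rw [h2] at h3
  have hS : (S : Matrix.SpecialLinearGroup (Fin 2) ℤ) 1 0 = 1 := by simp [S]
  have h4 := congr_fun he τ
  rw [SL_slash_apply, denom_S] at h4
  simp only [Pi.sub_apply, SL_slash_apply, denom_S, hS] at h3
  rw [SL_slash_apply, denom_S]
  have hτ := τ.ne_zero
  have e4 : (τ : ℂ) ^ (-4 : ℤ) = (τ : ℂ) ^ (-2 : ℤ) * (τ : ℂ) ^ (-2 : ℤ) := by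
    rw [← zpow_add₀ hτ]; norm_num
  have e2 : (τ : ℂ) ^ (-(2 + 2) : ℤ) = (τ : ℂ) ^ (-4 : ℤ) := by norm_num
  rw [e2] at h3
  have h5 : (12⁻¹ * e (S • τ) ^ 2) * (τ : ℂ) ^ (-4 : ℤ) =
      12⁻¹ * (e τ + 12 * u * (τ : ℂ)⁻¹) ^ 2 := by
    rw [← h4, e4]; ring
  rw [sub_mul, h5]
  have h6 : ((2 : ℤ) : ℂ) = 2 := by norm_num
  simp only [h6, ← hu, Int.cast_one, one_div, ← inv_pow] at h3
  linear_combination -h3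

theorem qDeriv_map {R S : Type*} [CommRing R] [CommRing S] (f : R →+* S) (φ : PowerSeries R) :
    qDeriv (φ.map f) = (qDeriv φ).map f := by
  ext n
  simp [qDeriv]

@[simp] theorem constantCoeff_qDeriv {R : Type*} [CommRing R] (φ : PowerSeries R) :
    PowerSeries.constantCoeff (qDeriv φ) = 0 := by
  rw [← PowerSeries.coeff_zero_eq_constantCoeff_apply]
  simp [qDeriv, -PowerSeries.coeff_zero_eq_constantCoeff]

@[simp] theorem constantCoeff_serP : PowerSeries.constantCoeff serP = 1 := by
  rw [← PowerSeries.coeff_zero_eq_constantCoeff_apply]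
  simp [serP, -PowerSeries.coeff_zero_eq_constantCoeff]

@[simp] theorem constantCoeff_serQ : PowerSeries.constantCoeff serQ = 1 := by
  rw [← PowerSeries.coeff_zero_eq_constantCoeff_apply]
  simp [serQ, -PowerSeries.coeff_zero_eq_constantCoeff]

@[simp] theorem constantCoeff_serR : PowerSeries.constantCoeff serR = 1 := by
  rw [← PowerSeries.coeff_zero_eq_constantCoeff_apply]
  simp [serR, -PowerSeries.coeff_zero_eq_constantCoeff]

@[simp] theorem constantCoeff_map_ringHom {R S : Type*} [CommRing R] [CommRing S] (f : R →+* S)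
    (φ : PowerSeries R) :
    PowerSeries.constantCoeff (φ.map f) = f (PowerSeries.constantCoeff φ) := by
  simp [← PowerSeries.coeff_zero_eq_constantCoeff_apply, -PowerSeries.coeff_zero_eq_constantCoeff]

theorem powerSeries_map_int_injective {φ ψ : PowerSeries ℤ}
    (h : φ.map (Int.castRingHom ℂ) = ψ.map (Int.castRingHom ℂ)) : φ = ψ :=
  PowerSeries.map_injective _ (RingHom.injective_int _) h

theorem powerSeries_C_inv {n : ℕ} [n.AtLeastTwo] (hn : (OfNat.ofNat n : ℂ) ≠ 0) :
    (OfNat.ofNat n : PowerSeries ℂ) * PowerSeries.C ((OfNat.ofNat n : ℂ)⁻¹) = 1 := by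
  rw [show (OfNat.ofNat n : PowerSeries ℂ) = PowerSeries.C (OfNat.ofNat n : ℂ) from
    (map_ofNat _ n).symm, ← map_mul, mul_inv_cancel₀ hn, map_one]

theorem ramanujan_P : 12 * qDeriv serP = serP ^ 2 - serQ := by
  have h := isLevelOne_derivE2.sub (isLevelOne_E₄.const_mul (-12⁻¹))
  have h0 := h.eq_zero_of_weight_lt (by norm_num) (by simp)
  apply powerSeries_map_int_injective
  rw [qDeriv_map] at h0
  have h12 := powerSeries_C_inv (n := 12) (by norm_num)
  simp only [map_sub, map_mul, map_pow, map_ofNat, map_neg] at h0 ⊢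
  linear_combination 12 * h0 +
    (serP.map (Int.castRingHom ℂ) ^ 2 - serQ.map (Int.castRingHom ℂ)) * h12

theorem ramanujan_Q : 3 * qDeriv serQ = serP * serQ - serR := by
  have h := (isLevelOne_serreDerivative isLevelOne_E₄).sub (isLevelOne_E₆.const_mul (-3⁻¹))
  have h0 := h.eq_zero_of_weight_lt (by norm_num) (by norm_num)
  apply powerSeries_map_int_injective
  rw [qDeriv_map] at h0
  have h12 := powerSeries_C_inv (n := 3) (by norm_num)
  have e : (((4 : ℤ) : ℂ) * 12⁻¹) = 3⁻¹ := by norm_num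
  rw [e] at h0
  simp only [map_sub, map_mul, map_neg, map_ofNat] at h0 ⊢
  linear_combination 3 * h0 + (serP.map (Int.castRingHom ℂ) * serQ.map (Int.castRingHom ℂ) -
    serR.map (Int.castRingHom ℂ)) * h12

theorem ramanujan_R : 2 * qDeriv serR = serP * serR - serQ ^ 2 := by
  have h := (isLevelOne_serreDerivative isLevelOne_E₆).sub ((isLevelOne_E₄.pow 2).const_mul (-2⁻¹))
  have h0 := h.eq_zero_of_weight_lt (by norm_num) (by norm_num)
  apply powerSeries_map_int_injective
  rw [qDeriv_map] at h0
  have h12 := powerSeries_C_inv (n := 2) (by norm_num)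
  have e : (((6 : ℤ) : ℂ) * 12⁻¹) = 2⁻¹ := by norm_num
  rw [e] at h0
  simp only [map_sub, map_mul, map_neg, map_ofNat, map_pow] at h0 ⊢
  linear_combination 2 * h0 + (serP.map (Int.castRingHom ℂ) * serR.map (Int.castRingHom ℂ) -
    serQ.map (Int.castRingHom ℂ) ^ 2) * h12

end Ramanujan

section JSurjective

open UpperHalfPlane ModularForm Function.Periodic Filter Topology ModularGroup
open scoped MatrixGroups Manifold

/-- The form `E₄³ - E₆²`, which is `1728` times the discriminant. -/
def Zf (τ : ℍ) : ℂ := E₄ τ ^ 3 - E₆ τ ^ 2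

/-- The form `E₄³`. -/
def Yf (τ : ℍ) : ℂ := E₄ τ ^ 3

/-- The `q`-expansion of `E₄³`. -/
def serY : PowerSeries ℤ := serQ ^ 3

/-- The `q`-expansion of `E₄³ - E₆²`. -/
def serZ : PowerSeries ℤ := serQ ^ 3 - serR ^ 2

theorem Zf_ne_zero (τ : ℍ) : Zf τ ≠ 0 := by
  have h := discriminant_ne_zero τ
  rw [discriminant_eq_E₄_cube_sub_E₆_sq] at h
  intro h0
  rw [Zf] at h0
  simp [h0] at h

theorem isLevelOne_Yf : IsLevelOne 12 Yf (serY.map (Int.castRingHom ℂ)) := by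
  have := isLevelOne_E₄.pow 3
  rw [← map_pow] at this
  exact this

theorem isLevelOne_Zf : IsLevelOne 12 Zf (serZ.map (Int.castRingHom ℂ)) := by
  have := isLevelOne_Yf.sub (isLevelOne_E₆.pow 2)
  rw [← map_pow, ← map_sub] at this
  exact this

theorem exists_Yf_eq (c : ℂ) : ∃ τ : ℍ, Yf τ = c * Zf τ := by
  by_contra! hne
  have hh := isLevelOne_Yf.sub (isLevelOne_Zf.const_mul c)
  set h : ℍ → ℂ := fun τ => Yf τ - c * Zf τ with hdef
  have hh0 : ∀ τ, h τ ≠ 0 := fun τ => sub_ne_zero.mpr (hne τ)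
  have hlim : Tendsto (fun τ => Zf τ / h τ) atImInfty (𝓝 0) := by
    have h1 := isLevelOne_Zf.hasQ.tendsto one_pos
    have h2 := hh.hasQ.tendsto one_pos
    have := h1.div h2 (by simp [serY, serZ])
    have e : PowerSeries.coeff 0 (serZ.map (Int.castRingHom ℂ)) = 0 := by simp [serZ]
    rw [e, zero_div] at this
    exact this
  have hslash : ∀ γ : SL(2, ℤ), (fun τ => Zf τ / h τ) ∣[(0 : ℤ)] γ = fun τ => Zf τ / h τ := by
    intro γ
    ext τ
    rw [SL_slash_apply, isLevelOne_Zf.smul, hh.smul]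
    have := zpow_ne_zero 12 (denom_ne_zero γ τ)
    simp only [neg_zero, zpow_zero, mul_one]
    rw [mul_div_mul_left _ _ this]
  let F : ModularForm 𝒮ℒ 0 :=
    { toFun := fun τ => Zf τ / h τ
      slash_action_eq' := fun _ ⟨γ, hγ⟩ => hγ ▸ hslash γ
      holo' := (isLevelOne_Zf.hasQ.mdifferentiable one_pos).div
        (hh.hasQ.mdifferentiable one_pos) hh0
      bdd_at_cusps' := fun {d} hd => by
        rw [Subgroup.IsArithmetic.isCusp_iff_isCusp_SL2Z] at hd
        rw [OnePoint.isBoundedAt_iff_forall_SL2Z hd]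
        intro γ _
        rw [hslash γ]
        exact hlim.isBigO_one ℝ }
  obtain ⟨b, hb⟩ := ModularFormClass.levelOne_weight_zero_const F
  have hb' : (fun τ => Zf τ / h τ) = fun _ => b := hb
  rw [hb'] at hlim
  have hb0 : b = 0 := tendsto_nhds_unique tendsto_const_nhds hlim
  have := congr_fun hb' UpperHalfPlane.I
  rw [hb0] at this
  exact div_ne_zero (Zf_ne_zero _) (hh0 _) this

end JSurjective

section WeierstrassUniqueness

open Filter Topology

theorem eventually_eq_zero_of_deriv_mul {D u w : ℂ → ℂ} (hD : AnalyticAt ℂ D 0)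
    (hu : ContinuousAt u 0) (hw : ContinuousAt w 0)
    (h : ∀ᶠ z in 𝓝[≠] 0, deriv D z * (z * u z) = D z * w z)
    (hn : ∀ n : ℕ, (n : ℂ) * u 0 ≠ w 0) : ∀ᶠ z in 𝓝 0, D z = 0 := by
  by_contra hne
  obtain ⟨n, k, hk, hk0, hDk⟩ := hD.exists_eventuallyEq_pow_smul_nonzero_iff.mpr hne
  simp only [sub_zero, smul_eq_mul] at hDk
  have hderiv : ∀ᶠ z in 𝓝 0, deriv D z * z = z ^ n * (n * k z + z * deriv k z) := by
    filter_upwards [hDk.eventually_nhds, hk.eventually_analyticAt] with z hz hkz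
    have hz' : D =ᶠ[𝓝 z] fun y => y ^ n * k y := hz
    rw [hz'.deriv_eq]
    have := ((hasDerivAt_pow n z).mul hkz.differentiableAt.hasDerivAt).deriv
    have e : (fun y => y ^ n * k y) = (fun y => y ^ n) * k := rfl
    rw [e, this]
    rcases n with _ | n
    · simp; ring
    · simp; ring
  have key : ∀ᶠ z in 𝓝[≠] 0, (n * k z + z * deriv k z) * u z = k z * w z := by
    filter_upwards [h, hDk.filter_mono nhdsWithin_le_nhds,
      hderiv.filter_mono nhdsWithin_le_nhds, self_mem_nhdsWithin] with z h1 h2 h3 h4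
    have hz : z ^ n ≠ 0 := pow_ne_zero _ h4
    apply mul_left_cancel₀ hz
    rw [h2] at h1
    linear_combination h1 - u z * h3
  have hkd : ContinuousAt (deriv k) 0 := hk.deriv.continuousAt
  have lim1 : Tendsto (fun z => (n * k z + z * deriv k z) * u z) (𝓝[≠] 0)
      (𝓝 ((n * k 0 + 0 * deriv k 0) * u 0)) := by
    have hkc := hk.continuousAt
    have : ContinuousAt (fun z => (n * k z + z * deriv k z) * u z) 0 := by fun_prop
    exact this.tendsto.mono_left nhdsWithin_le_nhds
  have lim2 : Tendsto (fun z => k z * w z) (𝓝[≠] 0) (𝓝 (k 0 * w 0)) :=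
    (hk.continuousAt.mul hw).tendsto.mono_left nhdsWithin_le_nhds
  have := tendsto_nhds_unique (lim1.congr' key) lim2
  apply hn n
  apply mul_left_cancel₀ hk0
  linear_combination this

theorem PeriodPair.eventually_notMem (L : PeriodPair) (x : ℂ) : ∀ᶠ z in 𝓝[≠] x, z ∉ L.lattice := by
  filter_upwards [(L.compl_lattice_sdiff_singleton_mem_nhds x : _ ∈ 𝓝 x) |>
    mem_nhdsWithin_of_mem_nhds, self_mem_nhdsWithin] with z hz hzx hzl
  exact hz ⟨hzl, hzx⟩

theorem PeriodPair.countable_lattice (L : PeriodPair) : (L.lattice : Set ℂ).Countable := by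
  have : (L.lattice : Set ℂ) = Set.range fun v : ℤ × ℤ => v.1 * L.ω₁ + v.2 * L.ω₂ := by
    ext x
    simp [PeriodPair.mem_lattice]
  rw [this]
  exact Set.countable_range _

theorem PeriodPair.eventuallyEq_weierstrassP {L M : PeriodPair} (h₂ : L.g₂ = M.g₂)
    (h₃ : L.g₃ = M.g₃) : L.weierstrassP =ᶠ[𝓝[≠] 0] M.weierstrassP := by
  set a := L.weierstrassPExcept 0 with ha
  set b := M.weierstrassPExcept 0 with hb
  set a' := L.derivWeierstrassPExcept 0 with ha'
  set b' := M.derivWeierstrassPExcept 0 with hb'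
  have Ha : AnalyticAt ℂ a 0 := L.analyticAt_weierstrassPExcept 0
  have Hb : AnalyticAt ℂ b 0 := M.analyticAt_weierstrassPExcept 0
  have Ha' : AnalyticAt ℂ a' 0 := L.analyticAt_derivWeierstrassPExcept 0
  have Hb' : AnalyticAt ℂ b' 0 := M.analyticAt_derivWeierstrassPExcept 0
  have e1 (N : PeriodPair) (z : ℂ) : N.weierstrassP z = N.weierstrassPExcept 0 z + 1 / z ^ 2 := by
    have := N.weierstrassPExcept_add 0 z
    simpa using this.symm
  have e2 (N : PeriodPair) (z : ℂ) :
      N.derivWeierstrassP z = N.derivWeierstrassPExcept 0 z - 2 / z ^ 3 := by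
    have := N.derivWeierstrassPExcept_def 0 z
    simp only [ZeroMemClass.coe_zero, sub_zero] at this
    rw [this]; ring
  have key : ∀ᶠ z in 𝓝 (0 : ℂ), (a - b) z = 0 := by
    refine eventually_eq_zero_of_deriv_mul (u := fun z => z ^ 3 * (a' z + b' z) - 4)
      (w := fun z => 4 * ((z ^ 2 * a z + 1) ^ 2 + (z ^ 2 * a z + 1) * (z ^ 2 * b z + 1) +
        (z ^ 2 * b z + 1) ^ 2) - L.g₂ * z ^ 4) (Ha.sub Hb) ?_ ?_ ?_ ?_
    · have := Ha'.continuousAt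
      have := Hb'.continuousAt
      fun_prop
    · have := Ha.continuousAt
      have := Hb.continuousAt
      fun_prop
    · filter_upwards [L.eventually_notMem 0, M.eventually_notMem 0, self_mem_nhdsWithin,
        Ha.eventually_analyticAt.filter_mono nhdsWithin_le_nhds,
        Hb.eventually_analyticAt.filter_mono nhdsWithin_le_nhds] with z hL hM hz hza hzb
      have hz : z ≠ 0 := hz
      have d1 : deriv a z = a' z := L.eqOn_deriv_weierstrassPExcept_derivWeierstrassPExcept 0
        (fun h => hL h.1)
      have d2 : deriv b z = b' z := M.eqOn_deriv_weierstrassPExcept_derivWeierstrassPExcept 0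
        (fun h => hM h.1)
      rw [deriv_sub hza.differentiableAt hzb.differentiableAt, d1, d2, Pi.sub_apply]
      have r1 := L.derivWeierstrassP_sq z hL
      have r2 := M.derivWeierstrassP_sq z hM
      rw [e1, e2] at r1 r2
      rw [← h₂, ← h₃] at r2
      rw [← ha, ← ha'] at r1
      rw [← hb, ← hb'] at r2
      have r : (a' z - 2 / z ^ 3) ^ 2 - (b' z - 2 / z ^ 3) ^ 2 =
        4 * ((a z + 1 / z ^ 2) ^ 3 - (b z + 1 / z ^ 2) ^ 3) - L.g₂ * (a z - b z) := by
        linear_combination r1 - r2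
      have : z ^ 4 * ((a' z - 2 / z ^ 3) ^ 2 - (b' z - 2 / z ^ 3) ^ 2) =
        z ^ 4 * (4 * ((a z + 1 / z ^ 2) ^ 3 - (b z + 1 / z ^ 2) ^ 3) - L.g₂ * (a z - b z)) := by
        rw [r]
      field_simp at this
      apply mul_left_cancel₀ (pow_ne_zero 2 hz)
      linear_combination this
    · intro n hn
      simp only [zero_pow two_ne_zero, zero_pow three_ne_zero, zero_pow four_ne_zero] at hn
      norm_num at hn
      have : ((n * 4 + 12 : ℕ) : ℂ) = 0 := by push_cast; linear_combination -hn
      exact absurd (Nat.cast_eq_zero.mp this) (by omega)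
  filter_upwards [key.filter_mono nhdsWithin_le_nhds] with z hz
  rw [e1, e1, ← ha, ← hb, sub_eq_zero.mp hz]

theorem PeriodPair.lattice_le_of_invariants {L M : PeriodPair} (h₂ : L.g₂ = M.g₂)
    (h₃ : L.g₃ = M.g₃) : L.lattice ≤ M.lattice := by
  have hev := PeriodPair.eventuallyEq_weierstrassP h₂ h₃
  set S : Set ℂ := (L.lattice : Set ℂ) ∪ M.lattice with hS
  have hconn : IsPreconnected Sᶜ :=
    ((L.countable_lattice.union M.countable_lattice).isPathConnected_compl_of_one_lt_rank
      (by simp)).isConnected.isPreconnected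
  obtain ⟨z₀, hz, hzL, hzM⟩ := ((eventually_eventually_nhdsWithin.mpr hev).and
    ((L.eventually_notMem 0).and (M.eventually_notMem 0))).exists
  have hz₀ : ∀ᶠ z in 𝓝 z₀, L.weierstrassP z = M.weierstrassP z := by
    by_cases h0 : z₀ = 0
    · exact absurd L.lattice.zero_mem (h0 ▸ hzL)
    · rwa [nhdsWithin_eq_nhds.mpr (isOpen_compl_singleton.mem_nhds h0)] at hz
  have hEq : Set.EqOn L.weierstrassP M.weierstrassP Sᶜ :=
    AnalyticOnNhd.eqOn_of_preconnected_of_eventuallyEq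
      (L.analyticOnNhd_weierstrassP.mono fun z hz h => hz (Or.inl h))
      (M.analyticOnNhd_weierstrassP.mono fun z hz h => hz (Or.inr h)) hconn
      (z₀ := z₀) (by simpa [hS] using ⟨hzL, hzM⟩) hz₀
  intro l hl
  by_contra hlM
  have hor := L.order_weierstrassP l hl
  have hc : L.weierstrassP =ᶠ[𝓝[≠] l] M.weierstrassP := by
    filter_upwards [L.eventually_notMem l, M.eventually_notMem l] with z h1 h2
    exact hEq (by simpa [hS] using ⟨h1, h2⟩)
  rw [meromorphicOrderAt_congr hc] at hor
  have := (M.analyticOnNhd_weierstrassP l hlM).meromorphicOrderAt_nonneg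
  rw [hor] at this
  exact absurd this (by decide)

theorem PeriodPair.lattice_eq_of_invariants {L M : PeriodPair} (h₂ : L.g₂ = M.g₂)
    (h₃ : L.g₃ = M.g₃) : L.lattice = M.lattice :=
  le_antisymm (lattice_le_of_invariants h₂ h₃) (lattice_le_of_invariants h₂.symm h₃.symm)

end WeierstrassUniqueness

section JInjective

open UpperHalfPlane ModularForm EisensteinSeries
open scoped MatrixGroups

/-- The period pair `(c τ, c)`. -/
def scaledPair (τ : ℍ) (c : ℂ) (hc : c ≠ 0) : PeriodPair where
  ω₁ := c * τ
  ω₂ := c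
  indep := by
    rw [LinearIndependent.pair_iff]
    intro s t h
    simp only [Complex.real_smul] at h
    have h1 : (s : ℂ) * τ + t = 0 := by
      apply mul_left_cancel₀ hc
      linear_combination h
    have h2 := congr_arg Complex.im h1
    simp at h2
    have hs : s = 0 := h2.resolve_right τ.im_ne_zero
    subst hs
    simpa using h1

theorem scaledPair_G (τ : ℍ) (c : ℂ) (hc : c ≠ 0) {k : ℕ} (hk : 3 ≤ k) :
    (scaledPair τ c hc).G k = (c ^ k)⁻¹ * (2 * riemannZeta k * E hk τ) := by
  have h := tsum_eisSummand_eq_riemannZeta_mul_eisensteinSeries hk τ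
  have hE : (E hk τ : ℂ) = 1 / 2 * eisensteinSeries 0 k τ := rfl
  rw [hE, show 2 * riemannZeta k * (1 / 2 * eisensteinSeries 0 k τ) =
    riemannZeta k * eisensteinSeries 0 k τ by ring, ← h, ← tsum_mul_left, PeriodPair.G,
    ← (scaledPair τ c hc).latticeEquivProd.symm.toEquiv.tsum_eq,
    ← (finTwoArrowEquiv ℤ).symm.tsum_eq]
  refine tsum_congr fun v => ?_
  have : (((scaledPair τ c hc).latticeEquivProd.symm v : (scaledPair τ c hc).lattice) : ℂ) =
    c * (v.1 * τ + v.2) := by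
    rw [PeriodPair.latticeEquiv_symm_apply]
    simp [scaledPair]; ring
  simp only [LinearEquiv.coe_toEquiv, eisSummand, finTwoArrowEquiv]
  erw [this]
  simp [mul_pow, mul_comm]

theorem exists_smul_eq_of_lattice_eq {τ₁ τ₂ : ℍ} {c : ℂ} (hc : c ≠ 0)
    (h : (scaledPair τ₁ c hc).lattice = (scaledPair τ₂ 1 one_ne_zero).lattice) :
    ∃ γ : SL(2, ℤ), γ • τ₁ = τ₂ := by
  have hind {m n : ℤ} (τ : ℍ) (e : (m : ℂ) * τ + n = 0) : m = 0 ∧ n = 0 := by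
    have := LinearIndependent.pair_iff.mp (scaledPair τ 1 one_ne_zero).indep m n
      (by simpa [scaledPair] using e)
    exact_mod_cast this
  have m1 : (c * τ₁ : ℂ) ∈ (scaledPair τ₂ 1 one_ne_zero).lattice := by
    rw [← h]; exact PeriodPair.ω₁_mem_lattice _
  have m2 : (c : ℂ) ∈ (scaledPair τ₂ 1 one_ne_zero).lattice := by
    rw [← h]; exact PeriodPair.ω₂_mem_lattice _
  have m3 : (1 * τ₂ : ℂ) ∈ (scaledPair τ₁ c hc).lattice := by
    rw [h]; exact PeriodPair.ω₁_mem_lattice _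
  have m4 : (1 : ℂ) ∈ (scaledPair τ₁ c hc).lattice := by
    rw [h]; exact PeriodPair.ω₂_mem_lattice _
  rw [PeriodPair.mem_lattice] at m1 m2 m3 m4
  obtain ⟨p, q, h1⟩ := m1
  obtain ⟨r, s, h2⟩ := m2
  obtain ⟨a, b, h3⟩ := m3
  obtain ⟨u, v, h4⟩ := m4
  simp only [scaledPair, one_mul, mul_one] at h1 h2 h3 h4
  have i1 := hind (m := a * p + b * r - 1) (n := a * q + b * s) τ₂ (by
    push_cast; linear_combination h3 + (a:ℂ) * h1 + (b:ℂ) * h2)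
  have i2 := hind (m := u * p + v * r) (n := u * q + v * s - 1) τ₂ (by
    push_cast; linear_combination h4 + (u:ℂ) * h1 + (v:ℂ) * h2)
  have hdet : (a * v - b * u) * (p * s - q * r) = 1 := by
    have : (a * v - b * u) * (p * s - q * r) =
      (a * p + b * r) * (u * q + v * s) - (a * q + b * s) * (u * p + v * r) := by ring
    rw [this, i1.2, i2.1]
    have x1 : a * p + b * r = 1 := by linarith [i1.1]
    have x2 : u * q + v * s = 1 := by linarith [i2.2]
    rw [x1, x2]; ring
  have hden : (u : ℂ) * τ₁ + v ≠ 0 := by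
    intro e
    have : c * ((u : ℂ) * τ₁ + v) = 1 := by linear_combination h4
    rw [e, mul_zero] at this
    exact zero_ne_one this
  have hτ : (τ₂ : ℂ) = (a * τ₁ + b) / (u * τ₁ + v) := by
    rw [eq_div_iff hden]
    apply mul_left_cancel₀ hc
    linear_combination -h3 + (τ₂ : ℂ) * h4
  have him : (a * v - b * u : ℝ) * τ₁.im = τ₂.im * Complex.normSq (u * τ₁ + v) := by
    have : (τ₂ : ℂ) * (u * τ₁ + v) = a * τ₁ + b := by rw [hτ, div_mul_cancel₀ _ hden]
    have e1 := congr_arg Complex.re this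
    have e2 := congr_arg Complex.im this
    simp at e1 e2
    simp only [Complex.normSq_apply, Complex.add_re, Complex.mul_re, Complex.intCast_re,
      coe_re, Complex.intCast_im, zero_mul, sub_zero, Complex.add_im, Complex.mul_im, add_zero,
      coe_im]
    linear_combination e1 * (u * τ₁.im) - e2 * (u * τ₁.re + v)
  have hpos : 0 < (a * v - b * u : ℝ) := by
    have : 0 < τ₂.im * Complex.normSq (u * τ₁ + v) :=
      mul_pos τ₂.im_pos (Complex.normSq_pos.mpr hden)
    rw [← him] at this
    exact pos_of_mul_pos_left this τ₁.im_pos.le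
  have hpos' : 0 < a * v - b * u := by exact_mod_cast hpos
  have hone : a * v - b * u = 1 := by
    rcases Int.eq_one_or_neg_one_of_mul_eq_one hdet with h | h
    · exact h
    · omega
  let γ : SL(2, ℤ) := ⟨!![a, b; u, v], by rw [Matrix.det_fin_two_of]; exact hone⟩
  refine ⟨γ, ?_⟩
  apply UpperHalfPlane.ext
  rw [UpperHalfPlane.coe_specialLinearGroup_apply, hτ]
  simp [γ]

theorem exists_smul_eq_of_Yf_mul_Zf {τ₁ τ₂ : ℍ} (h : Yf τ₁ * Zf τ₂ = Yf τ₂ * Zf τ₁) :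
    ∃ γ : SL(2, ℤ), γ • τ₁ = τ₂ := by
  have z1 := Zf_ne_zero τ₁
  have z2 := Zf_ne_zero τ₂
  have hex : ∃ l : ℂ, l ≠ 0 ∧ E₄ τ₂ = l ^ 4 * E₄ τ₁ ∧ E₆ τ₂ = l ^ 6 * E₆ τ₁ := by
    simp only [Yf, Zf] at h z1 z2
    generalize E₄ τ₁ = x at *
    generalize E₄ τ₂ = y at *
    generalize E₆ τ₁ = u at *
    generalize E₆ τ₂ = v at *
    have h' : x ^ 3 * v ^ 2 = y ^ 3 * u ^ 2 := by linear_combination -h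
    by_cases hx : x = 0
    · subst hx
      have hu : u ≠ 0 := by rintro rfl; simp at z1
      have hy : y = 0 := by
        have : y ^ 3 * u ^ 2 = 0 := by rw [← h']; ring
        simpa [hu] using this
      subst hy
      have hv : v ≠ 0 := by rintro rfl; simp at z2
      obtain ⟨l, hl⟩ := IsAlgClosed.exists_pow_nat_eq (v / u) (n := 6) (by norm_num)
      refine ⟨l, ?_, by simp, by rw [hl]; field_simp⟩
      rintro rfl
      rw [zero_pow (by norm_num)] at hl
      exact div_ne_zero hv hu hl.symm
    by_cases hu : u = 0
    · subst hu
      have hv : v = 0 := by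
        have : x ^ 3 * v ^ 2 = 0 := by rw [h']; ring
        simpa [hx] using this
      subst hv
      have hy : y ≠ 0 := by rintro rfl; simp at z2
      obtain ⟨l, hl⟩ := IsAlgClosed.exists_pow_nat_eq (y / x) (n := 4) (by norm_num)
      refine ⟨l, ?_, by rw [hl]; field_simp, by simp⟩
      rintro rfl
      rw [zero_pow (by norm_num)] at hl
      exact div_ne_zero hy hx hl.symm
    have hy : y ≠ 0 := by
      rintro rfl
      have : x ^ 3 * v ^ 2 = 0 := by rw [h']; ring
      have hv : v = 0 := by simpa [hx] using this
      subst hv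
      simp at z2
    have hv : v ≠ 0 := by
      rintro rfl
      have : y ^ 3 * u ^ 2 = 0 := by rw [← h']; ring
      simp [hy, hu] at this
    obtain ⟨l, hl⟩ := IsAlgClosed.exists_pow_nat_eq ((v / u) * (x / y)) (n := 2) (by norm_num)
    refine ⟨l, ?_, ?_, ?_⟩
    · rintro rfl
      rw [zero_pow (by norm_num)] at hl
      exact mul_ne_zero (div_ne_zero hv hu) (div_ne_zero hx hy) hl.symm
    · rw [show l ^ 4 = (l ^ 2) ^ 2 by ring, hl]
      field_simp
      linear_combination -h'
    · rw [show l ^ 6 = (l ^ 2) ^ 3 by ring, hl]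
      field_simp
      linear_combination -h'
  obtain ⟨l, hl, h4, h6⟩ := hex
  have hg {k : ℕ} (hk : 3 ≤ k) (he : E hk τ₂ = l ^ k * E hk τ₁) :
      (scaledPair τ₁ l⁻¹ (inv_ne_zero hl)).G k = (scaledPair τ₂ 1 one_ne_zero).G k := by
    rw [scaledPair_G _ _ _ hk, scaledPair_G _ _ _ hk, he]
    simp; ring
  refine exists_smul_eq_of_lattice_eq (inv_ne_zero hl)
    (PeriodPair.lattice_eq_of_invariants ?_ ?_)
  · rw [PeriodPair.g₂, PeriodPair.g₂, hg (by norm_num) h4]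
  · rw [PeriodPair.g₃, PeriodPair.g₃, hg (by norm_num) h6]

end JInjective

section HeckeCosets

open UpperHalfPlane Function.Periodic ModularGroup
open scoped MatrixGroups

theorem isLevelOne_apply_T {k : ℤ} {v : ℍ → ℂ} {φ : PowerSeries ℂ} (hv : IsLevelOne k v φ) (τ : ℍ) :
    v (T • τ) = v τ := by
  rw [hv.smul]
  have h2 : denom T τ = 1 := by rw [ModularGroup.denom_apply]; simp [T]
  rw [h2]
  simp

theorem IsLevelOne.apply_add_int {k : ℤ} {v : ℍ → ℂ} {φ : PowerSeries ℂ} (hv : IsLevelOne k v φ)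
    (n : ℤ) {τ w : ℍ} (h : (w : ℂ) = τ + n) : v w = v τ := by
  rw [hv.hasQ.eq_sum, hv.hasQ.eq_sum]
  congr 1
  rw [h]
  simp only [qParam]
  rw [Complex.exp_eq_exp_iff_exists_int]
  exact ⟨n, by push_cast; ring⟩

theorem HasQ.expand {h : ℝ} {f : ℍ → ℂ} {φ : PowerSeries ℂ} (hf : HasQ h f φ) (n : ℕ) (hn : n ≠ 0)
    {h' : ℝ} {g : ℍ → ℂ} {m : ℍ → ℍ} (hg : ∀ τ, g τ = f (m τ))
    (hm : ∀ τ, qParam h (m τ) = qParam h' τ ^ n) : HasQ h' g (φ.expand n hn) := by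
  intro τ
  rw [hg]
  have h1 := hf (m τ)
  rw [hm] at h1
  have hi : Function.Injective fun i : ℕ => n * i := fun a b h => Nat.eq_of_mul_eq_mul_left
    (Nat.pos_of_ne_zero hn) h
  refine (hi.hasSum_iff ?_).mp ?_
  · intro x hx
    have : ¬ n ∣ x := fun ⟨y, hy⟩ => hx ⟨y, hy.symm⟩
    rw [PowerSeries.coeff_expand_of_not_dvd _ _ _ this, zero_mul]
  · refine h1.congr_fun fun i => ?_
    simp [PowerSeries.coeff_expand_mul, pow_mul]

theorem HasQ.rescale {h : ℝ} {f : ℍ → ℂ} {φ : PowerSeries ℂ} (hf : HasQ h f φ)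
    {h' : ℝ} {g : ℍ → ℂ} {m : ℍ → ℍ} {c : ℂ} (hg : ∀ τ, g τ = f (m τ))
    (hm : ∀ τ, qParam h (m τ) = c * qParam h' τ) : HasQ h' g (φ.rescale c) := by
  intro τ
  rw [hg]
  refine (hf (m τ)).congr_fun fun i => ?_
  rw [hm, PowerSeries.coeff_rescale]
  ring

variable (p : ℕ) [hp : Fact p.Prime]

/-- The representatives `τ ↦ p τ` and `τ ↦ (τ + b) / p` of the matrices of determinant `p`
modulo `SL₂(ℤ)`. -/
def cosetPt (i : Option (ZMod p)) (τ : ℍ) : ℍ :=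
  match i with
  | none => ⟨p * τ, by
      have : 0 < (p : ℝ) := by exact_mod_cast hp.out.pos
      simpa using mul_pos this τ.im_pos⟩
  | some b => ⟨(τ + b.val) / p, by
      have : 0 < (p : ℝ) := by exact_mod_cast hp.out.pos
      have e : (τ + b.val : ℂ) / p = (((p : ℝ)⁻¹ : ℝ) : ℂ) * (τ + b.val) := by
        push_cast; field_simp
      rw [e, Complex.re_ofReal_mul |> fun _ => Complex.im_ofReal_mul]
      have h2 := τ.im_pos
      simp only [Complex.add_im, coe_im, Complex.natCast_im, add_zero]
      positivity⟩

/-- The translate of a weight `k` form by a matrix of determinant `p`. -/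
def cosetForm (k : ℤ) (v : ℍ → ℂ) (i : Option (ZMod p)) (τ : ℍ) : ℂ :=
  match i with
  | none => (p : ℂ) ^ k * v (cosetPt p none τ)
  | some b => v (cosetPt p (some b) τ)

/-- The permutation of the cosets induced by `S`. -/
def cosetPermS : Option (ZMod p) → Option (ZMod p)
  | none => some 0
  | some b => if b = 0 then none else some (-b⁻¹)

theorem cosetPermS_involutive : Function.Involutive (cosetPermS p) := by
  rintro (_ | b)
  · simp [cosetPermS]
  · by_cases hb : b = 0
    · simp [cosetPermS, hb]
    · simp [cosetPermS, hb, inv_neg]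

/-- The permutation of the cosets induced by `T`. -/
def cosetPermT : Option (ZMod p) ≃ Option (ZMod p) := Equiv.optionCongr (Equiv.addRight 1)

theorem coe_cosetPt_none (τ : ℍ) : (cosetPt p none τ : ℂ) = p * τ := rfl

theorem coe_cosetPt_some (b : ZMod p) (τ : ℍ) : (cosetPt p (some b) τ : ℂ) = (τ + b.val) / p := rfl

variable {k : ℤ} {v : ℍ → ℂ} {φ : PowerSeries ℂ}

theorem coe_S_smul (τ : ℍ) : ((S • τ : ℍ) : ℂ) = -1 / τ := by
  rw [modular_S_smul]
  rw [coe_mk, inv_neg, neg_div, one_div]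

theorem coe_T_smul (τ : ℍ) : ((T • τ : ℍ) : ℂ) = τ + 1 := by
  rw [modular_T_smul]
  simp [add_comm]

theorem IsLevelOne.apply_of_coe_eq (hv : IsLevelOne k v φ) {a b c d : ℤ} (hdet : a * d - b * c = 1)
    {τ w : ℍ} (h : (w : ℂ) * (c * τ + d) = a * τ + b) : v w = (c * τ + d : ℂ) ^ k * v τ := by
  let γ : SL(2, ℤ) := ⟨!![a, b; c, d], by rw [Matrix.det_fin_two_of]; exact hdet⟩
  have hd : denom γ τ = c * τ + d := by rw [ModularGroup.denom_apply]; simp [γ]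
  have hne : (c * τ + d : ℂ) ≠ 0 := hd ▸ denom_ne_zero γ τ
  have : γ • τ = w := by
    apply UpperHalfPlane.ext
    rw [UpperHalfPlane.coe_specialLinearGroup_apply]
    simp only [γ]
    simp
    rw [div_eq_iff hne, h]
  rw [← this, hv.smul, hd]

theorem cosetForm_T (hv : IsLevelOne k v φ) (i : Option (ZMod p)) (τ : ℍ) :
    cosetForm p k v i (T • τ) = cosetForm p k v (cosetPermT p i) τ := by
  have hp0 : (p : ℂ) ≠ 0 := by exact_mod_cast hp.out.ne_zero
  rcases i with _ | b
  · simp only [cosetForm, cosetPermT, Equiv.optionCongr_apply, Option.map_none]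
    rw [hv.apply_add_int (p : ℤ) (τ := cosetPt p none τ)]
    rw [coe_cosetPt_none, coe_cosetPt_none, coe_T_smul]
    push_cast; ring
  · simp only [cosetForm, cosetPermT, Equiv.optionCongr_apply, Option.map_some, Equiv.coe_addRight]
    have : ((b.val + 1 : ℤ) : ZMod p) = (((b + 1).val : ℤ) : ZMod p) := by simp
    rw [ZMod.intCast_eq_intCast_iff_dvd_sub] at this
    obtain ⟨n, hn⟩ := this
    rw [← hv.apply_add_int n (τ := cosetPt p (some b) (T • τ))]
    rw [coe_cosetPt_some, coe_cosetPt_some, coe_T_smul]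
    have hn' : (((b + 1).val : ℂ) - (b.val + 1)) = p * n := by exact_mod_cast hn
    field_simp
    linear_combination hn'

theorem cosetForm_S (hv : IsLevelOne k v φ) (i : Option (ZMod p)) (τ : ℍ) :
    cosetForm p k v i (S • τ) = (τ : ℂ) ^ k * cosetForm p k v (cosetPermS p i) τ := by
  have hp0 : (p : ℂ) ≠ 0 := by exact_mod_cast hp.out.ne_zero
  have hτ := τ.ne_zero
  rcases i with _ | b
  · simp only [cosetForm, cosetPermS]
    rw [hv.apply_of_coe_eq (a := 0) (b := -1) (c := 1) (d := 0) (by norm_num)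
      (τ := cosetPt p (some 0) τ), ← mul_assoc, ← mul_zpow]
    · rw [coe_cosetPt_some]
      congr 2
      push_cast
      simp
      field_simp
    · rw [coe_cosetPt_some, coe_cosetPt_none, coe_S_smul]
      push_cast
      simp
      field_simp
  · by_cases hb : b = 0
    · subst hb
      simp only [cosetForm, cosetPermS, if_true]
      rw [hv.apply_of_coe_eq (a := 0) (b := -1) (c := 1) (d := 0) (by norm_num)
        (τ := cosetPt p none τ), ← mul_assoc, ← mul_zpow]
      · rw [coe_cosetPt_none]
        congr 2
        push_cast
        ring
      · rw [coe_cosetPt_some, coe_cosetPt_none, coe_S_smul]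
        push_cast
        simp
        field_simp
    · simp only [cosetForm, cosetPermS, if_neg hb]
      set b' : ZMod p := -b⁻¹ with hb'
      have h1 : ((1 + b.val * b'.val : ℤ) : ZMod p) = 0 := by
        push_cast
        rw [ZMod.natCast_zmod_val, ZMod.natCast_zmod_val, hb']
        field_simp
        ring
      rw [ZMod.intCast_zmod_eq_zero_iff_dvd] at h1
      obtain ⟨n, hn⟩ := h1
      rw [hv.apply_of_coe_eq (a := b.val) (b := -n) (c := p) (d := -b'.val)
        (by linear_combination -hn) (τ := cosetPt p (some b') τ)]
      · rw [coe_cosetPt_some]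
        congr 2
        push_cast
        field_simp
        ring
      · rw [coe_cosetPt_some, coe_cosetPt_some, coe_S_smul]
        have hcast : (1 + b.val * b'.val : ℂ) = p * n := by exact_mod_cast hn
        push_cast
        field_simp
        linear_combination -(τ : ℂ) * hcast

/-- The `p`-th root of unity `exp(2πi/p)`. -/
def zetaC : ℂ := Complex.exp (2 * Real.pi * Complex.I / p)

/-- The `q^{1/p}`-expansion attached to a coset. -/
def cosetSeries {R : Type*} [CommRing R] (c : R) (ζ : R) (φ : PowerSeries R)
    (i : Option (ZMod p)) : PowerSeries R :=
  match i with
  | none => PowerSeries.C c * φ.expand (p ^ 2) (pow_ne_zero 2 hp.out.ne_zero)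
  | some b => φ.rescale (ζ ^ b.val)

theorem hasQ_expand_prime (hv : HasQ 1 v φ) : HasQ p v (φ.expand p hp.out.ne_zero) := by
  have hp0 : (p : ℂ) ≠ 0 := by exact_mod_cast hp.out.ne_zero
  refine hv.expand p _ (m := id) (fun _ => rfl) fun τ => ?_
  simp only [qParam, id, ← Complex.exp_nat_mul]
  congr 1
  push_cast
  field_simp

theorem hasQ_cosetForm (hv : HasQ 1 v φ) (i : Option (ZMod p)) :
    HasQ p (cosetForm p k v i) (cosetSeries p ((p : ℂ) ^ k) (zetaC p) φ i) := by
  have hp0 : (p : ℂ) ≠ 0 := by exact_mod_cast hp.out.ne_zero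
  rcases i with _ | b
  · refine HasQ.const_mul ?_ _
    refine hv.expand _ _ (m := cosetPt p none) (fun _ => rfl) fun τ => ?_
    rw [coe_cosetPt_none]
    simp only [qParam, ← Complex.exp_nat_mul]
    congr 1
    push_cast
    field_simp
  · refine hv.rescale (m := cosetPt p (some b)) (fun _ => rfl) fun τ => ?_
    rw [coe_cosetPt_some]
    simp only [qParam, zetaC, ← Complex.exp_nat_mul, ← Complex.exp_add]
    congr 1
    push_cast
    field_simp
    ring

/-- A product over the cosets of level one data is again of level one. -/
theorem exists_isLevelOne_prod {u : Option (ZMod p) → ℍ → ℂ} {Φ : PowerSeries ℂ}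
    (hS : ∀ i τ, u i (S • τ) = (τ : ℂ) ^ k * u (cosetPermS p i) τ)
    (hT : ∀ i τ, u i (T • τ) = u (cosetPermT p i) τ)
    (hΦ : HasQ p (fun τ => ∏ i, u i τ) Φ) :
    ∃ ψ, Φ = ψ.expand p hp.out.ne_zero ∧
      IsLevelOne (k * (p + 1)) (fun τ => ∏ i, u i τ) ψ := by
  have hp0 : (p : ℂ) ≠ 0 := by exact_mod_cast hp.out.ne_zero
  have hppos : 0 < (p : ℝ) := by exact_mod_cast hp.out.pos
  have hTi (τ : ℍ) : ∏ i, u i (T • τ) = ∏ i, u i τ := by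
    simp_rw [hT]
    exact Equiv.prod_comp (cosetPermT p) fun i => u i τ
  have hζ : IsPrimitiveRoot (zetaC p) p := Complex.isPrimitiveRoot_exp p hp.out.ne_zero
  have hresc : HasQ p (fun τ => ∏ i, u i (T • τ)) (Φ.rescale (zetaC p)) := by
    refine hΦ.rescale (m := fun τ => T • τ) (fun _ => rfl) fun τ => ?_
    rw [coe_T_smul]
    simp only [qParam, zetaC, ← Complex.exp_add]
    congr 1
    push_cast
    field_simp
    ring
  simp_rw [hTi] at hresc
  have huniq := hresc.unique hppos hΦ
  have hcoeff (n : ℕ) (hn : ¬ p ∣ n) : PowerSeries.coeff n Φ = 0 := by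
    have := congr_arg (PowerSeries.coeff n) huniq
    rw [PowerSeries.coeff_rescale] at this
    have h1 : zetaC p ^ n ≠ 1 := fun h => hn (hζ.dvd_of_pow_eq_one n h)
    have h2 : (zetaC p ^ n - 1) * PowerSeries.coeff n Φ = 0 := by linear_combination this
    exact (mul_eq_zero.mp h2).resolve_left (sub_ne_zero.mpr h1)
  have hexp :
      Φ = (PowerSeries.mk fun n => PowerSeries.coeff (p * n) Φ).expand p hp.out.ne_zero := by
    ext n
    by_cases hn : p ∣ n
    · obtain ⟨m, rfl⟩ := hn
      rw [PowerSeries.coeff_expand_mul, PowerSeries.coeff_mk]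
    · rw [hcoeff n hn, PowerSeries.coeff_expand_of_not_dvd _ _ _ hn]
  refine ⟨_, hexp, IsLevelOne.of_S ?_ ?_⟩
  · intro τ
    have h1 := hΦ τ
    have hi : Function.Injective fun i : ℕ => p * i := fun a b h => Nat.eq_of_mul_eq_mul_left
      hp.out.pos h
    rw [← hi.hasSum_iff] at h1
    · refine h1.congr_fun fun i => ?_
      simp only [PowerSeries.coeff_mk, Function.comp, pow_mul]
      congr 2
      simp only [qParam, ← Complex.exp_nat_mul]
      congr 1
      push_cast
      field_simp
    · intro x hx
      have : ¬ p ∣ x := fun ⟨y, hy⟩ => hx ⟨y, hy.symm⟩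
      rw [hcoeff x this, zero_mul]
  · intro τ
    simp_rw [hS]
    rw [Finset.prod_mul_distrib, Finset.prod_const, ← zpow_natCast, ← zpow_mul]
    congr 1
    · simp [Fintype.card_option, ZMod.card]
    · exact Equiv.prod_comp (cosetPermS_involutive p).toPerm fun i => u i τ

end HeckeCosets

section FixedPoints

open UpperHalfPlane ModularGroup
open scoped MatrixGroups Modular

variable (p : ℕ) [hp : Fact p.Prime]

theorem exists_cosetForm_eq_of_fixed {k : ℤ} {v : ℍ → ℂ} {φ : PowerSeries ℂ}
    (hv : IsLevelOne k v φ) {a b c d : ℤ} (hdet : a * d - b * c = p) {τ : ℍ}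
    (hτ : (c * τ + d : ℂ) * τ = a * τ + b) :
    ∃ i, cosetForm p k v i τ = (p / (c * τ + d) : ℂ) ^ k * v τ := by
  have hp0 : (p : ℂ) ≠ 0 := by exact_mod_cast hp.out.ne_zero
  have hp0' : (p : ℤ) ≠ 0 := by exact_mod_cast hp.out.ne_zero
  have hne : (c * τ + d : ℂ) ≠ 0 := by
    intro h
    have h' : (a * τ + b : ℂ) = 0 := by rw [← hτ, h, zero_mul]
    have : ((a * d - b * c : ℤ) : ℂ) = 0 := by
      have h1 : (a * d - b * c : ℂ) * τ = 0 := by linear_combination d * h' - b * h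
      push_cast
      exact (mul_eq_zero.mp h1).resolve_right τ.ne_zero
    rw [hdet] at this
    exact hp0 (by exact_mod_cast this)
  by_cases hac : (p : ℤ) ∣ a ∧ (p : ℤ) ∣ c
  · obtain ⟨⟨a', rfl⟩, ⟨c', rfl⟩⟩ := hac
    have h := hv.apply_of_coe_eq (a := a') (b := b) (c := c') (d := d)
      (by apply mul_left_cancel₀ hp0'; linear_combination hdet) (τ := cosetPt p none τ) (w := τ)
      (by rw [coe_cosetPt_none]; push_cast at hτ; linear_combination hτ)
    refine ⟨none, ?_⟩
    rw [coe_cosetPt_none] at h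
    have e : (c' * (p * τ) + d : ℂ) = ((p * c' : ℤ) : ℂ) * τ + d := by push_cast; ring
    rw [e] at h
    rw [h, cosetForm, ← mul_assoc, ← mul_zpow, div_mul_cancel₀ _ hne]
  · have hF : (a : ZMod p) * d - b * c = 0 := by
      have := congr_arg (Int.cast : ℤ → ZMod p) hdet
      push_cast at this
      simpa using this
    have : ∃ s : ZMod p, s * a = b ∧ s * c = d := by
      by_cases ha : (a : ZMod p) = 0
      · have hc : (c : ZMod p) ≠ 0 := by
          intro hc
          exact hac ⟨(ZMod.intCast_zmod_eq_zero_iff_dvd _ _).mp ha,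
            (ZMod.intCast_zmod_eq_zero_iff_dvd _ _).mp hc⟩
        refine ⟨d / c, ?_, by field_simp⟩
        field_simp
        linear_combination hF
      · refine ⟨b / a, by field_simp, ?_⟩
        field_simp
        linear_combination -hF
    obtain ⟨s, hs1, hs2⟩ := this
    have d1 : (p : ℤ) ∣ b - s.val * a := by
      rw [← ZMod.intCast_zmod_eq_zero_iff_dvd]
      push_cast
      rw [ZMod.natCast_zmod_val, hs1, sub_self]
    have d2 : (p : ℤ) ∣ d - s.val * c := by
      rw [← ZMod.intCast_zmod_eq_zero_iff_dvd]
      push_cast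
      rw [ZMod.natCast_zmod_val, hs2, sub_self]
    obtain ⟨b', hb'⟩ := d1
    obtain ⟨d', hd'⟩ := d2
    have hbC : (b - s.val * a : ℂ) = p * b' := by exact_mod_cast hb'
    have hdC : (d - s.val * c : ℂ) = p * d' := by exact_mod_cast hd'
    have e : (c * ((τ + s.val) / p) + d' : ℂ) = (c * τ + d) / p := by
      field_simp
      linear_combination -hdC
    have h := hv.apply_of_coe_eq (a := a) (b := b') (c := c) (d := d')
      (by apply mul_left_cancel₀ hp0'; linear_combination hdet - a * hd' + c * hb')
      (τ := cosetPt p (some s) τ) (w := τ)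
      (by
        rw [coe_cosetPt_some, e]
        field_simp
        linear_combination hτ + hbC)
    refine ⟨some s, ?_⟩
    rw [coe_cosetPt_some, e] at h
    rw [h, cosetForm, ← mul_assoc, ← mul_zpow, div_mul_div_cancel₀ hne, div_self hp0, one_zpow,
      one_mul]

theorem exists_fixed_of_cosetForm_mul {τ : ℍ} {i : Option (ZMod p)}
    (h : Yf τ * cosetForm p 12 Zf i τ = cosetForm p 12 Yf i τ * Zf τ) :
    ∃ a b c d : ℤ, a * d - b * c = p ∧ (c * τ + d : ℂ) * τ = a * τ + b := by
  have hp0 : (p : ℂ) ≠ 0 := by exact_mod_cast hp.out.ne_zero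
  have h1 : Yf (cosetPt p i τ) * Zf τ = Yf τ * Zf (cosetPt p i τ) := by
    rcases i with _ | b
    · simp only [cosetForm] at h
      apply mul_left_cancel₀ (zpow_ne_zero 12 hp0)
      linear_combination -h
    · simp only [cosetForm] at h
      exact h.symm
  obtain ⟨γ, hγ⟩ := exists_smul_eq_of_Yf_mul_Zf h1
  have hdet := γ.det_coe
  rw [Matrix.det_fin_two] at hdet
  have hne := denom_ne_zero γ (cosetPt p i τ)
  rw [ModularGroup.denom_apply] at hne
  have h2 := congr_arg UpperHalfPlane.coe hγ
  rw [UpperHalfPlane.coe_specialLinearGroup_apply] at h2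
  simp only [algebraMap_int_eq, eq_intCast, Complex.ofReal_intCast] at h2
  rw [div_eq_iff hne] at h2
  rcases i with _ | b
  · rw [coe_cosetPt_none] at h2
    refine ⟨γ 0 0 * p, γ 0 1, γ 1 0 * p, γ 1 1, by linear_combination p * hdet, ?_⟩
    push_cast
    linear_combination -h2
  · rw [coe_cosetPt_some] at h2
    refine ⟨γ 0 0, γ 0 0 * b.val + γ 0 1 * p, γ 1 0, γ 1 0 * b.val + γ 1 1 * p,
      by linear_combination p * hdet, ?_⟩
    push_cast
    field_simp at h2
    linear_combination -h2

theorem exists_reduced_form_of_fixed {τ : ℍ} (hfd : τ ∈ 𝒟) {a b c d : ℤ}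
    (hdet : a * d - b * c = p) (hτ : (c * τ + d : ℂ) * τ = a * τ + b) :
    (a + d) ^ 2 < 4 * (p : ℤ) ∧ ∃ A B C : ℤ, B ^ 2 - 4 * A * C = (a + d) ^ 2 - 4 * p ∧ 0 < A ∧
      |B| ≤ A ∧ A ≤ C ∧ (A * τ ^ 2 + B * τ + C : ℂ) = 0 := by
  obtain ⟨hn, hre⟩ := hfd
  have him := τ.im_pos
  have h1 := congr_arg Complex.re hτ
  have h2 := congr_arg Complex.im hτ
  simp at h1 h2
  have hc : c ≠ 0 := by
    rintro rfl
    have hda : (d : ℝ) = a := by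
      apply mul_right_cancel₀ him.ne'
      linear_combination h2
    have hda' : d = a := by exact_mod_cast hda
    subst hda'
    have : IsSquare (p : ℤ) := ⟨d, by linear_combination -hdet⟩
    have h3 : IsSquare p := by exact_mod_cast this
    exact hp.out.prime.irreducible.not_isSquare h3
  have e2 : (2 * c * τ.re : ℝ) = a - d := by
    apply mul_right_cancel₀ him.ne'
    linear_combination h2
  have e1 : (c * Complex.normSq τ : ℝ) = -b := by
    rw [Complex.normSq_apply]
    simp only [coe_re, coe_im]
    linear_combination -h1 + τ.re * e2
  have hdetR : (a * d - b * c : ℝ) = p := by exact_mod_cast hdet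
  have hlt : ((a + d) ^ 2 - 4 * p : ℝ) < 0 := by
    have : ((a + d) ^ 2 - 4 * p : ℝ) = -(2 * c * τ.im) ^ 2 := by
      rw [Complex.normSq_apply] at e1
      simp only [coe_re, coe_im] at e1
      linear_combination (4 : ℝ) * hdetR + 4 * c * e1 - (a - d + 2 * c * τ.re) * e2
    rw [this]
    have : (2 * c * τ.im : ℝ) ≠ 0 :=
      mul_ne_zero (mul_ne_zero two_ne_zero (by exact_mod_cast hc)) him.ne'
    have := pow_pos (abs_pos.mpr this) 2
    rw [sq_abs] at this
    linarith
  refine ⟨by have : ((a + d) ^ 2 : ℝ) < 4 * p := by linarith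
             exact_mod_cast this, ?_⟩
  rw [abs_le] at hre
  rcases lt_or_gt_of_ne hc with hneg | hpos
  · refine ⟨-c, a - d, b, by linear_combination -4 * hdet, by omega, ?_, ?_, ?_⟩
    · have hcR : (c : ℝ) < 0 := by exact_mod_cast hneg
      rw [abs_le]
      constructor
      · have : (-(-c) : ℝ) ≤ a - d := by rw [← e2]; nlinarith [hre.1, hre.2]
        exact_mod_cast this
      · have : (a - d : ℝ) ≤ -c := by rw [← e2]; nlinarith [hre.1, hre.2]
        exact_mod_cast this
    · have hcR : (c : ℝ) < 0 := by exact_mod_cast hneg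
      have : (-c : ℝ) ≤ b := by nlinarith
      exact_mod_cast this
    · push_cast
      linear_combination -hτ
  · refine ⟨c, d - a, -b, by linear_combination -4 * hdet, hpos, ?_, ?_, ?_⟩
    · have hcR : (0 : ℝ) < c := by exact_mod_cast hpos
      rw [abs_le]
      constructor
      · have : (-c : ℝ) ≤ d - a := by nlinarith [hre.1, hre.2]
        exact_mod_cast this
      · have : (d - a : ℝ) ≤ c := by nlinarith [hre.1, hre.2]
        exact_mod_cast this
    · have hcR : (0 : ℝ) < c := by exact_mod_cast hpos
      have : (c : ℝ) ≤ -b := by nlinarith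
      exact_mod_cast this
    · push_cast
      linear_combination hτ

theorem exists_eigenvalue_of_cosetForm_mul {τ : ℍ} (hfd : τ ∈ 𝒟) {i : Option (ZMod p)}
    (h : Yf τ * cosetForm p 12 Zf i τ = cosetForm p 12 Yf i τ * Zf τ) :
    ∃ (t A B C : ℤ) (μ : ℂ), t ^ 2 < 4 * (p : ℤ) ∧ B ^ 2 - 4 * A * C = t ^ 2 - 4 * p ∧ 0 < A ∧
      |B| ≤ A ∧ A ≤ C ∧ (A * τ ^ 2 + B * τ + C : ℂ) = 0 ∧ μ * (t - μ) = p ∧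
      (∃ j, cosetForm p 12 Zf j τ = μ ^ 12 * Zf τ) ∧
      ∃ j, cosetForm p 12 Zf j τ = (t - μ) ^ 12 * Zf τ := by
  have hp0 : (p : ℂ) ≠ 0 := by exact_mod_cast hp.out.ne_zero
  obtain ⟨a, b, c, d, hdet, hτ⟩ := exists_fixed_of_cosetForm_mul p h
  obtain ⟨ht, A, B, C, h1, h2, h3, h4, h5⟩ := exists_reduced_form_of_fixed p hfd hdet hτ
  have hdetC : (a * d - b * c : ℂ) = p := by exact_mod_cast hdet
  have hμ : (c * τ + d : ℂ) * ((a + d : ℤ) - (c * τ + d)) = p := by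
    push_cast
    linear_combination hdetC - c * hτ
  have hμ0 : (c * τ + d : ℂ) ≠ 0 := fun h0 => by rw [h0, zero_mul] at hμ; exact hp0 hμ.symm
  have hμ1 : ((a + d : ℤ) - (c * τ + d) : ℂ) ≠ 0 :=
    fun h0 => by rw [h0, mul_zero] at hμ; exact hp0 hμ.symm
  obtain ⟨i1, hi1⟩ := exists_cosetForm_eq_of_fixed p isLevelOne_Zf hdet hτ
  obtain ⟨i2, hi2⟩ := exists_cosetForm_eq_of_fixed p isLevelOne_Zf
    (a := d) (b := -b) (c := -c) (d := a) (τ := τ) (by linear_combination hdet)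
    (by push_cast; linear_combination -hτ)
  refine ⟨a + d, A, B, C, c * τ + d, ht, h1, h2, h3, h4, h5, hμ, ⟨i2, ?_⟩, ⟨i1, ?_⟩⟩
  · rw [hi2, zpow_ofNat]
    congr 2
    rw [← hμ, div_eq_iff]
    · push_cast; ring
    · convert hμ1 using 1
      push_cast; ring
  · rw [hi1, zpow_ofNat]
    congr 2
    rw [← hμ, mul_div_cancel_left₀ _ hμ0]

theorem coe_eq_of_quadratic {A B C : ℤ} (hA : 0 < A) {τ w : ℍ}
    (h1 : (A * τ ^ 2 + B * τ + C : ℂ) = 0) (h2 : (A * w ^ 2 + B * w + C : ℂ) = 0) : τ = w := by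
  have h : (τ - w : ℂ) * (A * (τ + w) + B) = 0 := by linear_combination h1 - h2
  rcases mul_eq_zero.mp h with h | h
  · exact UpperHalfPlane.ext (sub_eq_zero.mp h)
  · have := congr_arg Complex.im h
    simp at this
    have := τ.im_pos
    have := w.im_pos
    rcases ‹A = 0 ∨ _› with h | h
    · exact absurd h hA.ne'
    · linarith

end FixedPoints

section IntegralForms

open UpperHalfPlane ModularForm EisensteinSeries

/-- The quotient of the discriminant series `serZ` by its variable. -/
def serZdiv : PowerSeries ℤ := PowerSeries.mk fun n => PowerSeries.coeff (n + 1) serZ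

theorem constantCoeff_serZ : PowerSeries.constantCoeff serZ = 0 := by
  simp [serZ]

theorem serZ_eq_X_mul : serZ = PowerSeries.X * serZdiv := by
  ext n
  rcases n with _ | n
  · simpa using constantCoeff_serZ
  · rw [PowerSeries.coeff_succ_X_mul]
    simp [serZdiv]

theorem constantCoeff_serZdiv : PowerSeries.constantCoeff serZdiv = 1728 := by
  have h0 : PowerSeries.constantCoeff serZdiv = PowerSeries.coeff 1 serZ := by
    rw [← PowerSeries.coeff_zero_eq_constantCoeff_apply]; simp [serZdiv]
  rw [h0, serZ, map_sub, pow_succ, pow_succ, pow_succ, pow_zero, one_mul, pow_two]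
  have a1 : (antidiagonal 1 : Finset (ℕ × ℕ)) = {(0, 1), (1, 0)} := by decide
  have q0 : PowerSeries.coeff 0 serQ = 1 := by simp [serQ]
  have q1 : PowerSeries.coeff 1 serQ = 240 := by simp [serQ]
  have r0 : PowerSeries.coeff 0 serR = 1 := by simp [serR]
  have r1 : PowerSeries.coeff 1 serR = -504 := by simp [serR]
  simp only [PowerSeries.coeff_mul, a1, sum_pair (show ((0, 1) : ℕ × ℕ) ≠ (1, 0) by decide),
    q0, q1, r0, r1]
  norm_num

variable {R : Type*} [CommRing R]

/-- The homogeneous polynomial of degree `N` in the series of `E₄³` and `E₄³ - E₆²` with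
coefficients `c`. -/
def formSeries (N : ℕ) (c : ℕ → R) : PowerSeries R :=
  ∑ i ∈ range (N + 1), PowerSeries.C (c i) * (serY.map (Int.castRingHom R)) ^ (N - i) *
    (serZ.map (Int.castRingHom R)) ^ i

theorem map_formSeries {R' : Type*} [CommRing R'] (f : R →+* R') (N : ℕ) (c : ℕ → R) :
    (formSeries N c).map f = formSeries N (fun i => f (c i)) := by
  have h (φ : PowerSeries ℤ) : (φ.map (Int.castRingHom R)).map f = φ.map (Int.castRingHom R') := by
    ext; simp
  simp [formSeries, h]

theorem map_map_intCast {R' : Type*} [CommRing R'] (f : R →+* R') (φ : PowerSeries ℤ) :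
    (φ.map (Int.castRingHom R)).map f = φ.map (Int.castRingHom R') := by
  ext; simp

theorem map_injective_of_injective {R' : Type*} [CommRing R'] {f : R →+* R'}
    (hf : Function.Injective f) : Function.Injective (PowerSeries.map f) := by
  intro φ ψ h
  ext n
  apply hf
  simpa using congrArg (PowerSeries.coeff n) h

theorem constantCoeff_serY : PowerSeries.constantCoeff serY = 1 := by simp [serY]

theorem IsLevelOne.exists_eq_sum {v : ℍ → ℂ} {ι : R →+* ℂ}
    (h1728 : IsUnit (1728 : R)) (N : ℕ) {φ : PowerSeries R}
    (hv : IsLevelOne (12 * N) v (φ.map ι)) :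
    ∃ c : ℕ → R, ∀ τ, v τ = ∑ i ∈ range (N + 1), ι (c i) * Yf τ ^ (N - i) * Zf τ ^ i := by
  induction N generalizing v φ with
  | zero =>
    obtain ⟨c, hc⟩ := IsLevelOne.weight_zero (by simpa using hv)
    have hc' : c = ι (PowerSeries.constantCoeff φ) := by
      have := congrArg PowerSeries.constantCoeff hc
      rw [constantCoeff_map_ringHom] at this
      simpa using this.symm
    refine ⟨fun _ => PowerSeries.constantCoeff φ, fun τ => ?_⟩
    have h1 : HasQ 1 v (PowerSeries.C c) := hc ▸ hv.hasQ
    rw [(h1 τ).unique (HasQ.const c τ)]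
    simp [hc']
  | succ N ih =>
    set c₀ := PowerSeries.constantCoeff φ with hc₀
    set φ' := φ - PowerSeries.C c₀ * (serY.map (Int.castRingHom R)) ^ (N + 1) with hφ'
    have hY : IsLevelOne (12 * ((N + 1 : ℕ) : ℤ)) (fun τ => ι c₀ * Yf τ ^ (N + 1))
        ((PowerSeries.C c₀ * (serY.map (Int.castRingHom R)) ^ (N + 1)).map ι) := by
      have := (isLevelOne_Yf.pow (N + 1)).const_mul (ι c₀)
      rw [mul_comm] at this
      simpa [map_map_intCast] using this
    have hv' : IsLevelOne (12 * ((N + 1 : ℕ) : ℤ)) (fun τ => v τ - ι c₀ * Yf τ ^ (N + 1))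
        (φ'.map ι) := by
      rw [hφ', map_sub]
      exact hv.sub hY
    have h0 : PowerSeries.constantCoeff φ' = 0 := by
      simp [hφ', ← hc₀, constantCoeff_map_ringHom, constantCoeff_serY]
    obtain ⟨w, ψ, hw, hwv⟩ := hv'.div_discriminant (by simp [h0])
    obtain ⟨φ₂, hφ₂⟩ := PowerSeries.X_dvd_iff.mpr h0
    have hunit : IsUnit (serZdiv.map (Int.castRingHom R)) := by
      rw [PowerSeries.isUnit_iff_constantCoeff, constantCoeff_map_ringHom, constantCoeff_serZdiv]
      simpa using h1728
    obtain ⟨rho, hrho⟩ := hunit.exists_right_inv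
    have hψ : ψ = (φ₂ * rho).map ι := by
      have h1 : HasQ 1 (fun τ => v τ - ι c₀ * Yf τ ^ (N + 1))
          (ψ * serZ.map (Int.castRingHom ℂ)) := by
        intro τ
        beta_reduce
        rw [hwv τ]
        exact (hw.hasQ.mul isLevelOne_Zf.hasQ) τ
      have h2 := h1.unique one_pos hv'.hasQ
      rw [hφ₂, serZ_eq_X_mul, map_mul, map_mul, PowerSeries.map_X, PowerSeries.map_X,
        mul_left_comm] at h2
      have h3 := mul_left_cancel₀ PowerSeries.X_ne_zero h2
      have h4 := congrArg (PowerSeries.map ι) hrho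
      rw [map_mul, map_map_intCast, map_one] at h4
      rw [map_mul, ← h3, mul_assoc, h4, mul_one]
    rw [hψ] at hw
    obtain ⟨c, hc⟩ := ih (v := w) (φ := φ₂ * rho) (by
      convert hw using 1
      push_cast; ring)
    refine ⟨fun i => Nat.casesOn i c₀ c, fun τ => ?_⟩
    rw [sum_range_succ']
    have h5 := hwv τ
    rw [hc τ, Finset.sum_mul] at h5
    have h6 : v τ = ∑ i ∈ range (N + 1), ι (c i) * Yf τ ^ (N - i) * Zf τ ^ i * Zf τ +
      ι c₀ * Yf τ ^ (N + 1) := by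
      rw [← sub_eq_iff_eq_add]; exact h5
    rw [h6]
    simp only [Nat.add_sub_add_right, pow_succ, mul_assoc, Nat.sub_zero, pow_zero, mul_one]
    rfl

theorem IsLevelOne.exists_eq_formSeries {v : ℍ → ℂ} {ι : R →+* ℂ}
    (hι : Function.Injective ι) (h1728 : IsUnit (1728 : R)) (N : ℕ) {φ : PowerSeries R}
    (hv : IsLevelOne (12 * N) v (φ.map ι)) :
    ∃ c : ℕ → R, (∀ τ, v τ = ∑ i ∈ range (N + 1), ι (c i) * Yf τ ^ (N - i) * Zf τ ^ i) ∧
      φ = formSeries N c := by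
  obtain ⟨c, hc⟩ := hv.exists_eq_sum h1728
  refine ⟨c, hc, map_injective_of_injective hι (hv.hasQ.unique one_pos ?_)⟩
  rw [map_formSeries]
  have h : HasQ 1 (fun τ => ∑ i ∈ range (N + 1), ι (c i) * Yf τ ^ (N - i) * Zf τ ^ i)
      (formSeries N fun i => ι (c i)) :=
    HasQ.sum _ fun i _ =>
      ((isLevelOne_Yf.hasQ.pow _).const_mul _).mul (isLevelOne_Zf.hasQ.pow _)
  intro τ
  rw [hc τ]
  exact h τ

/-- A form whose series vanishes to order larger than its degree has zero coefficients. -/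
theorem eq_zero_of_X_pow_dvd_formSeries [IsDomain R] (h1728 : (1728 : R) ≠ 0) (N : ℕ) {c : ℕ → R}
    (h : PowerSeries.X ^ (N + 1) ∣ formSeries N c) : ∀ i ≤ N, c i = 0 := by
  intro i
  induction i using Nat.strong_induction_on with
  | _ i ih =>
  intro hi
  have h0 : PowerSeries.coeff i (formSeries N c) = 0 :=
    PowerSeries.X_pow_dvd_iff.mp h i (by omega)
  have hz : serZ.map (Int.castRingHom R) = PowerSeries.X * serZdiv.map (Int.castRingHom R) := by
    rw [serZ_eq_X_mul, map_mul, PowerSeries.map_X]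
  rw [formSeries, map_sum, sum_eq_single i] at h0
  · rw [hz, mul_pow, mul_left_comm, PowerSeries.coeff_X_pow_mul', if_pos le_rfl, Nat.sub_self,
      PowerSeries.coeff_zero_eq_constantCoeff_apply] at h0
    simp only [map_mul, map_pow, PowerSeries.constantCoeff_C, constantCoeff_map_ringHom,
      constantCoeff_serY, constantCoeff_serZdiv] at h0
    simpa [h1728] using h0
  · intro j hj hji
    rw [hz, mul_pow, mul_left_comm, PowerSeries.coeff_X_pow_mul']
    split_ifs with hle
    · simp [ih j (by omega) (by omega)]
    · rfl
  · intro hni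
    simp only [Finset.mem_range] at hni
    omega

end IntegralForms

section HeckePolynomials

open UpperHalfPlane ModularForm EisensteinSeries ModularGroup

theorem expand_map_intCast (p : ℕ) [hp : Fact p.Prime] {κ : Type*} [Field κ] [CharP κ p]
    (φ : PowerSeries ℤ) :
    (φ.map (Int.castRingHom κ)).expand p hp.out.ne_zero = (φ.map (Int.castRingHom κ)) ^ p := by
  have h : (((φ.map (Int.castRingHom κ)).expand p hp.out.ne_zero).map (frobenius κ p)) =
      (φ.map (Int.castRingHom κ)) ^ p :=
    MvPowerSeries.map_frobenius_expand (σ := Unit) p hp.out.ne_zero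
  rw [PowerSeries.map_expand, map_map_intCast] at h
  exact h

theorem charP_powerSeries (p : ℕ) (κ : Type*) [Field κ] [CharP κ p] : CharP (PowerSeries κ) p :=
  charP_of_injective_ringHom (f := PowerSeries.C (R := κ)) PowerSeries.C_injective p

theorem expand_injective {R : Type*} [CommRing R] (n : ℕ) (hn : n ≠ 0) :
    Function.Injective (PowerSeries.expand n hn : PowerSeries R → PowerSeries R) := by
  intro φ ψ h
  ext m
  simpa using congrArg (PowerSeries.coeff (n * m)) h

variable (p : ℕ) [hp : Fact p.Prime] {R κ : Type*} [CommRing R] [Field κ] [CharP κ p]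

theorem map_cosetSeries {R' : Type*} [CommRing R'] (f : R →+* R') (c ζ : R)
    (φ : PowerSeries R) (i : Option (ZMod p)) :
    (cosetSeries p c ζ φ i).map f = cosetSeries p (f c) (f ζ) (φ.map f) i := by
  rcases i with _ | b
  · simp [cosetSeries, PowerSeries.map_expand]
  · ext n
    simp [cosetSeries, PowerSeries.coeff_rescale]

theorem exists_form_of_prod {ι : R →+* ℂ} (hι : Function.Injective ι) (h1728 : IsUnit (1728 : R))
    {k : ℤ} {N : ℕ} (hkN : k * (p + 1) = 12 * N) {u : Option (ZMod p) → ℍ → ℂ} {Φ : PowerSeries R}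
    {C₀ : ℂ} (hC₀ : C₀ ≠ 0)
    (hS : ∀ i τ, u i (S • τ) = (τ : ℂ) ^ k * u (cosetPermS p i) τ)
    (hT : ∀ i τ, u i (T • τ) = u (cosetPermT p i) τ)
    (hΦ : HasQ p (fun τ => C₀ * ∏ i, u i τ) (Φ.map ι)) :
    ∃ c : ℕ → R, (∀ τ, C₀ * ∏ i, u i τ =
      ∑ i ∈ range (N + 1), ι (c i) * Yf τ ^ (N - i) * Zf τ ^ i) ∧
      Φ = (formSeries N c).expand p hp.out.ne_zero := by
  have h1 : HasQ p (fun τ => ∏ i, u i τ) (PowerSeries.C C₀⁻¹ * Φ.map ι) := by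
    have := hΦ.const_mul C₀⁻¹
    simpa only [inv_mul_cancel_left₀ hC₀] using this
  obtain ⟨ψ, hψ, hl⟩ := exists_isLevelOne_prod p hS hT h1
  set ψ' : PowerSeries R := PowerSeries.mk fun n => PowerSeries.coeff (p * n) Φ with hψ'
  have h2 : Φ.map ι = (PowerSeries.C C₀ * ψ).expand p hp.out.ne_zero := by
    rw [map_mul, PowerSeries.expand_C, ← hψ, ← mul_assoc, ← map_mul, mul_inv_cancel₀ hC₀, map_one,
      one_mul]
  have h3 : ψ'.map ι = PowerSeries.C C₀ * ψ := by
    ext n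
    have := congrArg (PowerSeries.coeff (p * n)) h2
    rw [PowerSeries.coeff_expand_mul] at this
    rw [← this]
    simp [hψ']
  have h4 : Φ = ψ'.expand p hp.out.ne_zero := by
    apply map_injective_of_injective hι
    rw [PowerSeries.map_expand, h3, h2]
  have h5 := hl.const_mul C₀
  rw [hkN, ← h3] at h5
  obtain ⟨c, hc, hc'⟩ := h5.exists_eq_formSeries hι h1728
  exact ⟨c, hc, by rw [h4, ← hc']⟩

theorem map_eq_one_of_pow_prime {ζ : κ} (h : ζ ^ p = 1) : ζ = 1 := by
  have := sub_pow_char (p := p) ζ 1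
  rw [h, one_pow, sub_self] at this
  exact sub_eq_zero.mp (pow_eq_zero_iff hp.out.ne_zero |>.mp this)

variable {ι : R →+* ℂ} {π : R →+* κ} {ζ : R}

theorem eq_of_zetaC (hι : Function.Injective ι) (hζ : ι ζ = zetaC p) : π ζ = 1 := by
  apply map_eq_one_of_pow_prime p
  rw [← map_pow]
  have : ζ ^ p = 1 := by
    apply hι
    rw [map_pow, hζ, map_one, zetaC, ← Complex.exp_nat_mul]
    have hp0 : (p : ℂ) ≠ 0 := by exact_mod_cast hp.out.ne_zero
    rw [mul_div_cancel₀ _ hp0, Complex.exp_two_pi_mul_I]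
  rw [this, map_one]

theorem hasQ_cosetForm_map (hζ : ι ζ = zetaC p) {v : ℍ → ℂ} {φ : PowerSeries ℤ}
    (hv : IsLevelOne 12 v (φ.map (Int.castRingHom ℂ))) (i : Option (ZMod p)) :
    HasQ p (cosetForm p 12 v i)
      ((cosetSeries p ((p : R) ^ 12) ζ (φ.map (Int.castRingHom R)) i).map ι) := by
  have h := hasQ_cosetForm p (k := 12) hv.hasQ i
  rw [map_cosetSeries, hζ, map_map_intCast, map_pow, map_natCast]
  exact_mod_cast h

theorem exists_normForm (hι : Function.Injective ι) (h1728 : IsUnit (1728 : R))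
    (hζ : ι ζ = zetaC p) (x : R) :
    ∃ c : ℕ → R, (∀ τ, ∏ i, (ι x * Zf τ - cosetForm p 12 Zf i τ) =
      ∑ i ∈ range (p + 1 + 1), ι (c i) * Yf τ ^ (p + 1 - i) * Zf τ ^ i) ∧
      formSeries (p + 1) (fun i => π (c i)) =
        PowerSeries.C (π x ^ (p + 1)) * serZ.map (Int.castRingHom κ) ^ (p + 1) -
          PowerSeries.C (π x) * serZ.map (Int.castRingHom κ) ^ 2 := by
  set zR := serZ.map (Int.castRingHom R) with hzR
  set z := serZ.map (Int.castRingHom κ) with hz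
  obtain ⟨c, hc, hΦ⟩ := exists_form_of_prod p hι h1728 (k := 12) (N := p + 1) (C₀ := 1)
    (u := fun i τ => ι x * Zf τ - cosetForm p 12 Zf i τ)
    (Φ := ∏ i, (PowerSeries.C x * zR.expand p hp.out.ne_zero - cosetSeries p ((p : R) ^ 12) ζ zR i))
    (by push_cast; ring) one_ne_zero
    (fun i τ => by
      simp only [cosetForm_S p isLevelOne_Zf, isLevelOne_Zf.apply_S]; ring)
    (fun i τ => by
      simp only [cosetForm_T p isLevelOne_Zf, isLevelOne_apply_T isLevelOne_Zf])
    (by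
      simp only [one_mul, map_prod, map_sub, map_mul, PowerSeries.map_C, PowerSeries.map_expand]
      refine HasQ.prod _ fun i _ => HasQ.sub ?_ (hasQ_cosetForm_map p hζ isLevelOne_Zf i)
      rw [hzR, map_map_intCast]
      exact (hasQ_expand_prime p isLevelOne_Zf.hasQ).const_mul _)
  refine ⟨c, by simpa using hc, ?_⟩
  apply expand_injective p hp.out.ne_zero
  rw [← map_formSeries, ← PowerSeries.map_expand, ← hΦ]
  have hz' : zR.map π = z := map_map_intCast _ _
  simp only [map_prod, map_sub, map_mul, PowerSeries.map_C, PowerSeries.map_expand,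
    map_cosetSeries, hz', eq_of_zetaC p hι hζ, Fintype.prod_option]
  simp only [cosetSeries, one_pow, PowerSeries.rescale_one, RingHom.id_apply, prod_const, map_pow,
    map_natCast, CharP.cast_eq_zero, zero_pow (show 12 ≠ 0 by decide), map_zero, zero_mul, sub_zero,
    card_univ, ZMod.card, PowerSeries.expand_C]
  have := charP_powerSeries p κ
  rw [sub_pow_char]
  simp only [hz, expand_map_intCast]
  ring

theorem exists_fixedForm (hι : Function.Injective ι) (h1728 : IsUnit (1728 : R))
    (hζ : ι ζ = zetaC p) :
    ∃ c : ℕ → R, (∀ τ, ((p : ℂ) ^ 12)⁻¹ *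
      ∏ i, (Yf τ * cosetForm p 12 Zf i τ - cosetForm p 12 Yf i τ * Zf τ) =
      ∑ i ∈ range (2 * (p + 1) + 1), ι (c i) * Yf τ ^ (2 * (p + 1) - i) * Zf τ ^ i) ∧
      formSeries (2 * (p + 1)) (fun i => π (c i)) =
        -(serY.map (Int.castRingHom κ) ^ p * serZ.map (Int.castRingHom κ) -
          serY.map (Int.castRingHom κ) * serZ.map (Int.castRingHom κ) ^ p) ^ 2 := by
  have hp0 : (p : ℂ) ^ 12 ≠ 0 := pow_ne_zero _ (by exact_mod_cast hp.out.ne_zero)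
  set zR := serZ.map (Int.castRingHom R) with hzR
  set z := serZ.map (Int.castRingHom κ) with hz
  set yR := serY.map (Int.castRingHom R) with hyR
  set y := serY.map (Int.castRingHom κ) with hy
  obtain ⟨c, hc, hΦ⟩ := exists_form_of_prod p hι h1728 (k := 24) (N := 2 * (p + 1))
    (C₀ := ((p : ℂ) ^ 12)⁻¹)
    (u := fun i τ => Yf τ * cosetForm p 12 Zf i τ - cosetForm p 12 Yf i τ * Zf τ)
    (Φ := ∏ i, (yR.expand p hp.out.ne_zero * cosetSeries p 1 ζ zR i -
      cosetSeries p 1 ζ yR i * zR.expand p hp.out.ne_zero))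
    (by push_cast; ring) (inv_ne_zero hp0)
    (fun i τ => by
      simp only [cosetForm_S p isLevelOne_Zf, isLevelOne_Zf.apply_S, cosetForm_S p isLevelOne_Yf,
        isLevelOne_Yf.apply_S]
      rw [show (24 : ℤ) = 12 + 12 by norm_num, zpow_add₀ τ.ne_zero]
      ring)
    (fun i τ => by
      simp only [cosetForm_T p isLevelOne_Zf, isLevelOne_apply_T isLevelOne_Zf,
        cosetForm_T p isLevelOne_Yf, isLevelOne_apply_T isLevelOne_Yf])
    (by
      have h1 : HasQ p (fun τ => ∏ i, (Yf τ * cosetForm p 12 Zf i τ - cosetForm p 12 Yf i τ * Zf τ))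
          ((∏ i, (yR.expand p hp.out.ne_zero * cosetSeries p ((p : R) ^ 12) ζ zR i -
      cosetSeries p ((p : R) ^ 12) ζ yR i * zR.expand p hp.out.ne_zero)).map ι) := by
        simp only [map_prod, map_sub, map_mul]
        refine HasQ.prod _ fun i _ =>
          HasQ.sub (HasQ.mul ?_ (hasQ_cosetForm_map p hζ isLevelOne_Zf i))
          (HasQ.mul (hasQ_cosetForm_map p hζ isLevelOne_Yf i) ?_)
        · rw [PowerSeries.map_expand, hyR, map_map_intCast]
          exact hasQ_expand_prime p isLevelOne_Yf.hasQ
        · rw [PowerSeries.map_expand, hzR, map_map_intCast]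
          exact hasQ_expand_prime p isLevelOne_Zf.hasQ
      have h2 := h1.const_mul ((p : ℂ) ^ 12)⁻¹
      convert h2 using 1
      have h3 : (∏ i, (yR.expand p hp.out.ne_zero * cosetSeries p ((p : R) ^ 12) ζ zR i -
          cosetSeries p ((p : R) ^ 12) ζ yR i * zR.expand p hp.out.ne_zero)) =
          PowerSeries.C ((p : R) ^ 12) *
          ∏ i, (yR.expand p hp.out.ne_zero * cosetSeries p 1 ζ zR i -
          cosetSeries p 1 ζ yR i * zR.expand p hp.out.ne_zero) := by
        rw [Fintype.prod_option, Fintype.prod_option]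
        simp only [cosetSeries, map_one]
        ring
      rw [h3, map_mul, PowerSeries.map_C, ← mul_assoc, ← map_mul, map_pow, map_natCast,
        inv_mul_cancel₀ hp0, map_one, one_mul])
  refine ⟨c, hc, ?_⟩
  apply expand_injective p hp.out.ne_zero
  rw [← map_formSeries, ← PowerSeries.map_expand, ← hΦ]
  have hz' : zR.map π = z := map_map_intCast _ _
  have hy' : yR.map π = y := map_map_intCast _ _
  have he (φ : PowerSeries ℤ) : (φ.map (Int.castRingHom κ)).expand (p ^ 2)
      (pow_ne_zero 2 hp.out.ne_zero) = (φ.map (Int.castRingHom κ)) ^ (p * p) := by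
    simp only [pow_two p]
    rw [PowerSeries.expand_mul p hp.out.ne_zero p hp.out.ne_zero, expand_map_intCast, map_pow,
      expand_map_intCast, pow_mul]
  simp only [map_prod, map_sub, map_mul, PowerSeries.map_expand,
    map_cosetSeries, hz', hy', eq_of_zetaC p hι hζ, Fintype.prod_option]
  simp only [cosetSeries, one_pow, PowerSeries.rescale_one, RingHom.id_apply, prod_const, map_pow,
    map_one, card_univ, ZMod.card, one_mul, map_neg, map_sub, map_mul]
  have := charP_powerSeries p κ
  rw [sub_pow_char]
  simp only [hz, hy, expand_map_intCast, he, mul_pow]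
  ring

end HeckePolynomials

section Places

open IsLocalRing

theorem exists_valuationSubring_charP (p : ℕ) [hp : Fact p.Prime] :
    ∃ A : ValuationSubring ℂ, CharP (ResidueField A) p := by
  set Z : Subring ℂ := (Int.castRingHom ℂ).range
  have hI : Ideal.span {(p : Z)} ≠ ⊤ := by
    rw [Ne, Ideal.span_singleton_eq_top]
    rintro h
    obtain ⟨⟨_, m, rfl⟩, hm⟩ := h.exists_right_inv
    have h1 : (p : ℂ) * (m : ℂ) = 1 := by
      have := congrArg Subtype.val hm
      simpa using this
    have h2 : (p : ℤ) * m = 1 := by exact_mod_cast h1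
    have h3 : (p : ℤ) ∣ 1 := ⟨m, h2.symm⟩
    have h4 : p ∣ 1 := by exact_mod_cast h3
    exact hp.out.one_lt.ne' (Nat.dvd_one.mp h4)
  obtain ⟨A, -, hA⟩ := Ideal.image_subset_nonunits_valuationSubring _ hI
  refine ⟨A, ?_⟩
  have hmem : ((p : A) : ℂ) ∈ A.nonunits := by
    apply hA
    exact ⟨p, Ideal.subset_span rfl, by simp⟩
  have h0 : (p : ResidueField A) = 0 := by
    rw [← map_natCast (residue A), residue_eq_zero_iff]
    exact A.coe_mem_nonunits_iff.mp hmem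
  exact (CharP.charP_iff_prime_eq_zero hp.out).mpr h0

variable {A : ValuationSubring ℂ}

theorem exists_root_lift (P : Polynomial A) (hP : P.map (residue A) ≠ 0) {s : ResidueField A}
    (hs : (P.map (residue A)).eval s = 0) :
    ∃ r : A, P.eval r = 0 ∧ residue A r = s := by
  induction hn : P.natDegree generalizing P with
  | zero =>
    rw [natDegree_eq_zero] at hn
    obtain ⟨c, rfl⟩ := hn
    rw [map_C, eval_C] at hs
    rw [map_C, hs, map_zero] at hP
    exact absurd rfl hP
  | succ n ih =>
    have hdeg : (P.map A.subtype).degree ≠ 0 := by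
      rw [degree_map_eq_of_injective A.subtype_injective, degree_eq_natDegree (by
        rintro rfl; simp at hn), hn]
      simp
      exact Nat.cast_add_one_ne_zero n
    obtain ⟨r, hr⟩ := IsAlgClosed.exists_root _ hdeg
    rw [IsRoot.def, eval_map] at hr
    by_cases hrA : r ∈ A
    · have hroot : P.eval ⟨r, hrA⟩ = 0 := by
        apply A.subtype_injective
        rw [map_zero, ← hr, ← eval₂_hom]
        rfl
      obtain ⟨Q, rfl⟩ := dvd_iff_isRoot.mpr hroot
      by_cases hrs : residue A ⟨r, hrA⟩ = s
      · exact ⟨_, hroot, hrs⟩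
      · rw [Polynomial.map_mul] at hP hs
        rw [eval_mul] at hs
        have h1 : (Q.map (residue A)).eval s = 0 := by
          refine (mul_eq_zero.mp hs).resolve_left ?_
          simpa [sub_eq_zero] using Ne.symm hrs
        have hQ : Q ≠ 0 := by rintro rfl; simp at hn
        have h2 : Q.natDegree = n := by
          rw [(monic_X_sub_C _).natDegree_mul' hQ, natDegree_X_sub_C] at hn
          omega
        obtain ⟨r', hr', h'⟩ := ih Q (right_ne_zero_of_mul hP) h1 h2
        exact ⟨r', by simp [hr'], h'⟩
    · have hr0 : r ≠ 0 := by rintro rfl; exact hrA A.zero_mem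
      have hu : r⁻¹ ∈ A := (A.mem_or_inv_mem r).resolve_left hrA
      set u : A := ⟨r⁻¹, hu⟩ with hu_def
      have hum : residue A u = 0 := by
        rw [residue_eq_zero_iff, ← A.coe_mem_nonunits_iff]
        exact A.inv_mem_nonunits_iff.mpr (Or.inr hrA)
      have hroot : (P.reflect (n + 1)).eval u = 0 := by
        apply A.subtype_injective
        let _ := invertibleOfNonzero hr0
        have := (eval₂_reflect_eq_zero_iff A.subtype r (n + 1) P hn.le).mpr hr
        rw [map_zero, ← this, ← eval₂_hom]
        congr 1
      obtain ⟨Q, hQ⟩ := dvd_iff_isRoot.mpr hroot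
      have hQn : Q.natDegree ≤ n := by
        by_cases hQ0 : Q = 0
        · simp [hQ0]
        have h1 : (P.reflect (n + 1)).natDegree ≤ n + 1 := by
          simpa [hn] using natDegree_reflect_le (N := n + 1) (p := P)
        rw [hQ, (monic_X_sub_C _).natDegree_mul' hQ0, natDegree_X_sub_C] at h1
        omega
      have hPQ : P = (1 - C u * X) * Q.reflect n := by
        rw [← reflect_reflect (N := n + 1) (p := P), hQ, add_comm n 1,
          reflect_mul _ _ (natDegree_X_sub_C_le u) hQn, reflect_sub, reflect_C, pow_one]
        congr 2
        exact reflect_one_X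
      have hPQ' : P.map (residue A) = (Q.reflect n).map (residue A) := by
        conv_lhs => rw [hPQ]
        simp [hum]
      rw [hPQ'] at hP hs
      have h3 : (Q.reflect n).natDegree ≤ n := by
        simpa [hQn] using natDegree_reflect_le (N := n) (p := Q)
      have h4 : (Q.reflect n).natDegree = n := by
        apply le_antisymm h3
        have hQ0 : Q.reflect n ≠ 0 := by
          intro h; rw [h] at hP; simp at hP
        have : P.natDegree ≤ 1 + (Q.reflect n).natDegree := by
          conv_lhs => rw [hPQ]
          refine natDegree_mul_le.trans (Nat.add_le_add_right ?_ _)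
          compute_degree
        omega
      obtain ⟨r', hr', h'⟩ := ih _ hP hs h4
      exact ⟨r', by rw [hPQ, eval_mul, hr', mul_zero], h'⟩

theorem exists_unit_root {p : ℕ} [CharP (ResidueField A) p] {t : ℤ} {μ : ℂ}
    (h : μ * (t - μ) = p) :
    ∃ ν : A, residue A ν = (t : ResidueField A) ∧ ((ν : ℂ) = μ ∨ (ν : ℂ) = t - μ) := by
  have hint (n : ℤ) : (n : ℂ) ∈ A := by simp
  have hnat : (p : ℂ) ∈ A := by simp
  have hμ : μ ∈ A := by
    rcases A.mem_or_inv_mem μ with h1 | h1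
    · exact h1
    · by_cases h0 : μ = 0
      · rw [h0]; exact A.zero_mem
      · have h2 : μ = t - μ⁻¹ * p := by rw [← h]; field_simp; ring
        rw [h2]
        exact A.toSubring.sub_mem (hint t) (A.mul_mem _ _ h1 hnat)
  set m : A := ⟨μ, hμ⟩
  have h1 : m * ((t : A) - m) = (p : A) := by
    apply A.subtype_injective
    simpa using h
  have h2 : residue A m * ((t : ResidueField A) - residue A m) = 0 := by
    have := congrArg (residue A) h1
    simpa using this
  rcases mul_eq_zero.mp h2 with h3 | h3
  · exact ⟨(t : A) - m, by simp [h3], Or.inr (by simp [m])⟩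
  · exact ⟨m, (sub_eq_zero.mp h3).symm, Or.inl rfl⟩

end Places

section ReductionOfFixedPoints

open UpperHalfPlane ModularForm EisensteinSeries ModularGroup IsLocalRing
open scoped Modular MatrixGroups

theorem isUnit_natCast_of_not_dvd (p : ℕ) {A : ValuationSubring ℂ}
    [CharP (ResidueField A) p] {n : ℕ} (h : ¬ p ∣ n) :
    IsUnit (n : A) := by
  by_contra hn
  rw [← mem_nonunits_iff, ← mem_maximalIdeal, ← residue_eq_zero_iff, map_natCast,
    CharP.cast_eq_zero_iff _ p] at hn
  exact h hn

variable (p : ℕ) [hp : Fact p.Prime] {A : ValuationSubring ℂ}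

theorem not_dvd_1728 (h5 : 5 ≤ p) : ¬ p ∣ 1728 := by
  intro h
  rw [show 1728 = 2 ^ 6 * 3 ^ 3 by norm_num, hp.out.dvd_mul] at h
  rcases h with h | h
  · have := (Nat.prime_dvd_prime_iff_eq hp.out Nat.prime_two).mp (hp.out.dvd_of_dvd_pow h)
    omega
  · have := (Nat.prime_dvd_prime_iff_eq hp.out Nat.prime_three).mp (hp.out.dvd_of_dvd_pow h)
    omega

theorem exists_zeta : ∃ ζ : A, A.subtype ζ = zetaC p := by
  have h1 : zetaC p ^ p = 1 := by
    have hp0 : (p : ℂ) ≠ 0 := by exact_mod_cast hp.out.ne_zero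
    rw [zetaC, ← Complex.exp_nat_mul, mul_div_cancel₀ _ hp0, Complex.exp_two_pi_mul_I]
  have h2 : zetaC p ∈ A := by
    rcases A.mem_or_inv_mem (zetaC p) with h | h
    · exact h
    · have h0 : zetaC p ≠ 0 := Complex.exp_ne_zero _
      have h3 : zetaC p = (zetaC p)⁻¹ ^ (p - 1) := by
        rw [inv_pow, ← mul_eq_one_iff_eq_inv₀ (pow_ne_zero _ h0), ← pow_succ',
          Nat.sub_add_cancel hp.out.one_le, h1]
      rw [h3]
      exact A.toSubring.pow_mem h _
  exact ⟨⟨_, h2⟩, rfl⟩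

/-- The reduction of `fixedForm` at a point of the prime field vanishes. -/
theorem exists_fixed_point_lift [CharP (ResidueField A) p] (h5 : 5 ≤ p) {s : ResidueField A}
    (hs : s ^ p = s) :
    ∃ τ ∈ 𝒟, ∃ r : A, Yf τ = r * Zf τ ∧ residue A r = s ∧
      ∃ i, Yf τ * cosetForm p 12 Zf i τ = cosetForm p 12 Yf i τ * Zf τ := by
  obtain ⟨ζ, hζ⟩ := exists_zeta p (A := A)
  have h1728 : IsUnit (1728 : A) := by
    exact_mod_cast isUnit_natCast_of_not_dvd p (A := A) (not_dvd_1728 p h5)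
  obtain ⟨c, hc, hc'⟩ := exists_fixedForm p (π := residue A) A.subtype_injective h1728 hζ
  set N := 2 * (p + 1) with hN
  set d : ℕ → ResidueField A := fun i =>
    if i = 2 then -1 else if i = p + 1 then 2 else if i = 2 * p then -1 else 0 with hd
  have hsum {M : Type} [CommRing M] (F : ResidueField A → ℕ → M) (hF : ∀ i, F 0 i = 0) :
      ∑ i ∈ range (N + 1), F (d i) i = F (-1) 2 + F 2 (p + 1) + F (-1) (2 * p) := by
    have hsub : ({2, p + 1, 2 * p} : Finset ℕ) ⊆ range (N + 1) := by
      intro i hi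
      simp only [Finset.mem_insert, Finset.mem_singleton] at hi
      simp only [Finset.mem_range]
      omega
    rw [← sum_subset hsub, sum_insert, sum_insert, sum_singleton]
    · have e1 : d 2 = -1 := by simp [hd]
      have e2 : d (p + 1) = 2 := by
        change (if _ then _ else _) = _
        rw [if_neg (by omega), if_pos rfl]
      have e3 : d (2 * p) = -1 := by
        change (if _ then _ else _) = _; rw [if_neg (by omega), if_neg (by omega), if_pos rfl]
      rw [e1, e2, e3, add_assoc]
    · simp only [Finset.mem_singleton]; omega
    · simp only [Finset.mem_insert, Finset.mem_singleton]; omega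
    · intro i _ hi
      simp only [Finset.mem_insert, Finset.mem_singleton, not_or] at hi
      have : d i = 0 := by simp only [hd]; rw [if_neg hi.1, if_neg hi.2.1, if_neg hi.2.2]
      rw [this, hF]
  have hk1728 : (1728 : ResidueField A) ≠ 0 := by
    have := (h1728.map (residue A)).ne_zero
    rwa [map_ofNat] at this
  have hcd : ∀ i ≤ N, residue A (c i) = d i := by
    have hser : formSeries N (fun i => residue A (c i) - d i) = 0 := by
      have h1 : formSeries N (fun i => residue A (c i) - d i) =
          formSeries N (fun i => residue A (c i)) - formSeries N d := by
        simp only [formSeries, map_sub, sub_mul, sum_sub_distrib]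
      rw [h1, hc', formSeries,
        hsum (M := PowerSeries (ResidueField A)) (fun a i => PowerSeries.C a *
        (serY.map (Int.castRingHom (ResidueField A))) ^ (N - i) *
        (serZ.map (Int.castRingHom (ResidueField A))) ^ i) (by simp),
        show N - 2 = 2 * p by omega, show N - (p + 1) = p + 1 by omega,
        show N - 2 * p = 2 by omega]
      simp only [map_neg, map_one, map_ofNat]
      ring
    intro i hi
    exact sub_eq_zero.mp
      (eq_zero_of_X_pow_dvd_formSeries hk1728 N (by rw [hser]; exact dvd_zero _) i hi)
  set P : Polynomial A := ∑ i ∈ range (N + 1), Polynomial.C (c i) * Polynomial.X ^ (N - i) with hP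
  have hP0 : P.map (residue A) ≠ 0 := by
    intro h
    have h2 := congrArg (fun q => Polynomial.coeff q (2 * p)) h
    simp only [hP, Polynomial.map_sum, Polynomial.map_mul, map_C, Polynomial.map_pow, map_X,
      finsetSum_coeff, coeff_C_mul, coeff_X_pow, coeff_zero] at h2
    rw [sum_eq_single 2, if_pos (by omega), hcd 2 (by omega)] at h2
    · simp [hd] at h2
    · intro i hi hi2
      simp only [Finset.mem_range] at hi
      rw [if_neg (by omega), mul_zero]
    · intro h3
      simp only [Finset.mem_range] at h3
      omega
  have hPs : (P.map (residue A)).eval s = 0 := by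
    have h2 : (P.map (residue A)).eval s = ∑ i ∈ range (N + 1), d i * s ^ (N - i) := by
      simp only [hP, Polynomial.map_sum, Polynomial.map_mul, map_C, Polynomial.map_pow, map_X,
        eval_finsetSum, eval_mul, eval_C, eval_pow, eval_X]
      refine sum_congr rfl fun i hi => ?_
      simp only [Finset.mem_range] at hi
      rw [hcd i (by omega)]
    rw [h2, hsum (fun a i => a * s ^ (N - i)) (by simp), show N - 2 = p * 2 by omega,
      show N - (p + 1) = p + 1 by omega, show N - 2 * p = 2 by omega, pow_mul, pow_succ s p, hs]
    ring
  obtain ⟨r, hr, hrs⟩ := exists_root_lift P hP0 hPs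
  obtain ⟨τ₀, hτ₀⟩ := exists_Yf_eq (r : ℂ)
  obtain ⟨γ, hγ⟩ := ModularGroup.exists_smul_mem_fd τ₀
  have hτ : Yf (γ • τ₀) = r * Zf (γ • τ₀) := by
    rw [isLevelOne_Yf.smul, isLevelOne_Zf.smul, hτ₀]
    ring
  refine ⟨γ • τ₀, hγ, r, hτ, hrs, ?_⟩
  set τ := γ • τ₀
  have hprod := hc τ
  have h0 : ∑ i ∈ range (N + 1), A.subtype (c i) * Yf τ ^ (N - i) * Zf τ ^ i = 0 := by
    have h3 : ∑ i ∈ range (N + 1), A.subtype (c i) * Yf τ ^ (N - i) * Zf τ ^ i =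
        A.subtype (P.eval r) * Zf τ ^ N := by
      simp only [hP, eval_finsetSum, eval_mul, eval_C, eval_pow, eval_X, map_sum, map_mul, map_pow,
        Finset.sum_mul]
      refine sum_congr rfl fun i hi => ?_
      simp only [Finset.mem_range] at hi
      rw [hτ, mul_pow, mul_assoc, mul_assoc, ← pow_add, mul_assoc,
        Nat.sub_add_cancel (show i ≤ N by omega)]
      rfl
    rw [h3, hr, map_zero, zero_mul]
  rw [h0] at hprod
  have hp0 : ((p : ℂ) ^ 12)⁻¹ ≠ 0 := inv_ne_zero (pow_ne_zero _ (by exact_mod_cast hp.out.ne_zero))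
  obtain ⟨i, -, hi⟩ := Finset.prod_eq_zero_iff.mp ((mul_eq_zero.mp hprod).resolve_left hp0)
  exact ⟨i, sub_eq_zero.mp hi⟩

theorem exists_quadratic_point [CharP (ResidueField A) p] (h5 : 5 ≤ p) {s : ResidueField A}
    (hs : s ^ p = s) :
    ∃ (τ : ℍ) (r : A) (t a b c : ℤ) (e : ℕ → ResidueField A),
      Yf τ = r * Zf τ ∧ residue A r = s ∧ t ^ 2 < 4 * (p : ℤ) ∧
      b ^ 2 - 4 * a * c = t ^ 2 - 4 * p ∧ 0 < a ∧ |b| ≤ a ∧ a ≤ c ∧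
      (a * τ ^ 2 + b * τ + c : ℂ) = 0 ∧
      formSeries (p + 1) e =
        PowerSeries.C (((t : ResidueField A) ^ 12) ^ (p + 1)) *
          serZ.map (Int.castRingHom (ResidueField A)) ^ (p + 1) -
        PowerSeries.C ((t : ResidueField A) ^ 12) *
          serZ.map (Int.castRingHom (ResidueField A)) ^ 2 ∧
      ∑ i ∈ range (p + 1 + 1), e i * s ^ (p + 1 - i) = 0 := by
  obtain ⟨τ, hfd, r, hr, hrs, i, hi⟩ := exists_fixed_point_lift p h5 hs
  obtain ⟨t, a, b, c, μ, ht, hdisc, ha, hb, hc, hq, hμ, hj1, hj2⟩ :=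
    exists_eigenvalue_of_cosetForm_mul p hfd hi
  obtain ⟨ν, hν, hν'⟩ := exists_unit_root (p := p) (A := A) hμ
  obtain ⟨j, hj⟩ : ∃ j, cosetForm p 12 Zf j τ = (ν : ℂ) ^ 12 * Zf τ := by
    rcases hν' with h | h <;> rw [h] <;> assumption
  obtain ⟨ζ, hζ⟩ := exists_zeta p (A := A)
  have h1728 : IsUnit (1728 : A) := by
    exact_mod_cast isUnit_natCast_of_not_dvd p (A := A) (not_dvd_1728 p h5)
  obtain ⟨e, he, he'⟩ := exists_normForm p (π := residue A) A.subtype_injective h1728 hζ (ν ^ 12)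
  refine ⟨τ, r, t, a, b, c, fun i => residue A (e i), hr, hrs, ht, hdisc, ha, hb, hc, hq, ?_, ?_⟩
  · rw [he', map_pow (residue A), hν]
  · have h0 : ∏ i, (A.subtype (ν ^ 12) * Zf τ - cosetForm p 12 Zf i τ) = 0 := by
      refine Finset.prod_eq_zero (Finset.mem_univ j) ?_
      rw [hj, map_pow]
      exact sub_self _
    rw [he τ] at h0
    have h3 : ∑ i ∈ range (p + 1 + 1), A.subtype (e i) * Yf τ ^ (p + 1 - i) * Zf τ ^ i =
        A.subtype (∑ i ∈ range (p + 1 + 1), e i * r ^ (p + 1 - i)) * Zf τ ^ (p + 1) := by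
      simp only [map_sum, map_mul, map_pow, Finset.sum_mul]
      refine sum_congr rfl fun i hi => ?_
      simp only [Finset.mem_range] at hi
      rw [hr, mul_pow, mul_assoc, mul_assoc, ← pow_add, mul_assoc,
        Nat.sub_add_cancel (show i ≤ p + 1 by omega)]
      rfl
    rw [h3] at h0
    have h4 := (mul_eq_zero.mp h0).resolve_right (pow_ne_zero _ (Zf_ne_zero τ))
    have h5 : ∑ i ∈ range (p + 1 + 1), e i * r ^ (p + 1 - i) = 0 := by
      apply A.subtype_injective
      rw [h4, map_zero]
    have h6 := congrArg (residue A) h5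
    simpa [hrs] using h6

end ReductionOfFixedPoints

section HasseInvariant

/-- The cubic `W³ - 3QW + 2R`. -/
def cubicPoly {S : Type*} [CommRing S] (Q R : S) : Polynomial S :=
  X ^ 3 - C (3 * Q) * X + C (2 * R)

/-- The coefficient of `W^(p-1)` in `(W³ - 3QW + 2R)^((p-1)/2)`. -/
def hasseCoeff {S : Type*} [CommRing S] (p : ℕ) (Q R : S) : S :=
  ((cubicPoly Q R) ^ (p / 2)).coeff (p - 1)

theorem map_hasseCoeff {S T : Type*} [CommRing S] [CommRing T] (f : S →+* T) (p : ℕ) (Q R : S) :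
    f (hasseCoeff p Q R) = hasseCoeff p (f Q) (f R) := by
  rw [hasseCoeff, hasseCoeff, ← coeff_map]
  congr 1
  simp only [cubicPoly, Polynomial.map_pow, Polynomial.map_add, Polynomial.map_sub,
    Polynomial.map_mul, map_X, map_C, map_mul, map_ofNat, Polynomial.map_ofNat]

theorem frobTrace_eq_hasseCoeff (p : ℕ) [hp : Fact p.Prime] (h5 : 5 ≤ p) (Q R : ZMod p) :
    (frobTrace p (-3 * Q) (2 * R) : ZMod p) = hasseCoeff p Q R := by
  have hchar : ringChar (ZMod p) ≠ 2 := by rw [ZMod.ringChar_zmod_n]; omega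
  have hodd : p % 2 = 1 := by
    rcases hp.out.eq_two_or_odd with h | h
    · omega
    · exact h
  set F := cubicPoly Q R with hF
  have hev (x : ZMod p) : F.eval x = x ^ 3 + -3 * Q * x + 2 * R := by
    simp [hF, cubicPoly]; ring
  have h1 : (numPoints p (-3 * Q) (2 * R) : ℤ) =
      1 + ∑ x : ZMod p, (quadraticChar (ZMod p) (F.eval x) + 1) := by
    rw [numPoints]
    push_cast
    congr 1
    simp_rw [← quadraticChar_card_sqrts hchar]
    rw [Nat.card_eq_fintype_card, Fintype.card_subtype, ← Nat.cast_sum]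
    congr 1
    rw [← Finset.card_sigma]
    refine Finset.card_bij (fun P _ => ⟨P.1, P.2⟩) ?_ ?_ ?_
    · intro P hP
      simp only [Finset.mem_filter, Finset.mem_univ, true_and] at hP
      simp [hev, hP]
    · rintro ⟨a, b⟩ _ ⟨c, d⟩ _ h
      simpa using h
    · rintro ⟨x, y⟩ h
      simp only [Finset.mem_sigma, Finset.mem_univ, true_and, Set.mem_toFinset,
        Set.mem_ofPred_eq, hev] at h
      exact ⟨(x, y), by simp [h], rfl⟩
  have h2 : (frobTrace p (-3 * Q) (2 * R) : ZMod p) = -∑ x : ZMod p, (F.eval x) ^ (p / 2) := by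
    rw [frobTrace, h1, sum_add_distrib]
    push_cast
    have h3 (x : ZMod p) : ((quadraticChar (ZMod p) (F.eval x) : ℤ) : ZMod p) =
        F.eval x ^ (p / 2) := by
      rw [quadraticChar_eq_pow_of_char_ne_two' hchar, ZMod.card]
    simp only [h3]
    simp
  have hdeg : (F ^ (p / 2)).natDegree < 2 * (p - 1) := by
    have h3 : F.natDegree ≤ 3 := by
      rw [hF, cubicPoly]; compute_degree
    have h4 := natDegree_pow_le (p := F) (n := p / 2)
    have h5 : p / 2 * F.natDegree ≤ p / 2 * 3 := Nat.mul_le_mul_left _ h3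
    omega
  have hsum (i : ℕ) (hi : i < 2 * (p - 1)) :
      ∑ x : ZMod p, x ^ i = if i = p - 1 then -1 else 0 := by
    by_cases h0 : i < p - 1
    · rw [if_neg (by omega), FiniteField.sum_pow_lt_card_sub_one]
      rwa [ZMod.card]
    · have hu := FiniteField.sum_pow_units (ZMod p) i
      have hsplit : ∑ x : ZMod p, x ^ i = ∑ x : (ZMod p)ˣ, ((x : ZMod p) ^ i) := by
        rw [← sum_subset (subset_univ ((univ : Finset (ZMod p)).erase 0))]
        · symm
          refine sum_bij (fun x _ => (x : ZMod p)) (fun x _ => by simp)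
            (fun x _ y _ h => Units.ext h)
            (fun y hy => ?_) (fun _ _ => rfl)
          simp only [Finset.mem_erase, Finset.mem_univ, and_true] at hy
          exact ⟨Units.mk0 y hy, Finset.mem_univ _, rfl⟩
        · intro x _ hx
          simp only [Finset.mem_erase, Finset.mem_univ, and_true, not_not] at hx
          rw [hx, zero_pow (by omega)]
      rw [hsplit, hu, ZMod.card]
      congr 1
      rw [eq_iff_iff]
      constructor
      · rintro ⟨k, rfl⟩
        have : k < 2 := by
          rw [mul_comm] at hi
          exact Nat.lt_of_mul_lt_mul_right hi
        have : k ≠ 0 := by rintro rfl; omega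
        rw [show k = 1 by omega, mul_one]
      · rintro rfl; exact dvd_rfl
  rw [h2, hasseCoeff, ← hF]
  simp_rw [← eval_pow, eval_eq_sum_range' hdeg]
  rw [sum_comm]
  simp_rw [← Finset.mul_sum]
  rw [sum_congr rfl fun i hi => by rw [hsum i (Finset.mem_range.mp hi)], sum_eq_single (p - 1)]
  · simp
  · intro i _ hi
    simp [hi]
  · intro h
    simp only [Finset.mem_range] at h
    omega

/-- In characteristic `p`, the Hasse coefficient of a solution of Ramanujan's equations is
annihilated by the square of the derivation. -/
theorem derivation_derivation_hasseCoeff {S : Type*} [CommRing S] (D : Derivation ℤ S S) {P Q R : S}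
    (hP : 12 * D P = P ^ 2 - Q) (hQ : 3 * D Q = P * Q - R) (hR : 2 * D R = P * R - Q ^ 2)
    {p : ℕ} (hp : (p : S) = 0) (h5 : 5 ≤ p) (hodd : p % 2 = 1) :
    144 * D (D (hasseCoeff p Q R)) = 0 := by
  let _ : Differential S := ⟨D⟩
  obtain ⟨k, rfl⟩ : ∃ k, p = k + 5 := ⟨p - 5, by omega⟩
  set m := (k + 5) / 2 with hm
  obtain ⟨l, hl⟩ : ∃ l, m = l + 1 := ⟨m - 1, by omega⟩
  have h2m : (2 * m : S) = -1 := by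
    have : ((2 * m + 1 : ℕ) : S) = 0 := by rw [show 2 * m + 1 = k + 5 by omega, hp]
    push_cast at this
    linear_combination this
  have h2m' : (2 * m : Polynomial S) = -1 := by
    have := congrArg (C : S →+* Polynomial S) h2m
    simpa only [map_mul, map_ofNat, map_natCast, map_neg, map_one] using this
  have hk : (k : S) = -5 := by push_cast at hp; linear_combination hp
  set H := cubicPoly Q R with hH
  set G := H ^ m with hG
  let δ : Derivation ℤ (Polynomial S) (Polynomial S) := Differential.mapCoeffs
  have hHd : derivative H = 3 * X ^ 2 - C (3 * Q) := by
    rw [hH, cubicPoly]; simp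
    rw [map_ofNat]; ring
  have hδH : δ H = - C (3 * D Q) * X + C (2 * D R) := by
    have h3 : D (3 * Q) = 3 * D Q := by
      have : (3 : S) * Q = (3 : ℕ) • Q := by simp
      rw [this, map_nsmul]; simp
    have h2 : D (2 * R) = 2 * D R := by
      have : (2 : S) * R = (2 : ℕ) • R := by simp
      rw [this, map_nsmul]; simp
    have hX : δ X = 0 := Differential.mapCoeffs_X
    have hC (a : S) : δ (C a) = C (D a) := Differential.mapCoeffs_C a
    rw [hH, cubicPoly, map_add, map_sub, Derivation.leibniz_pow, Derivation.leibniz, hX, hC, hC,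
      h3, h2]
    simp
    ring
  have key : 6 * δ H + (X ^ 2 + C P * X - C (2 * Q)) * derivative H = 3 * (X + C P) * H := by
    rw [hδH, hHd, hQ, hR, hH, cubicPoly]
    simp only [map_sub, map_mul, map_pow, map_ofNat]
    ring
  have hG1 : G = H ^ l * H := by rw [hG, hl, pow_succ]
  have hGd : 2 * H * derivative G = -(derivative H * G) := by
    rw [hG1, ← pow_succ, ← hl, derivative_pow, hl, Nat.add_sub_cancel, C_eq_natCast]
    rw [hl] at h2m'
    linear_combination (H ^ (l + 1) * derivative H) * h2m'
  have hδG : 12 * δ G = -3 * (X + C P) * G - 2 * (X ^ 2 + C P * X - C (2 * Q)) * derivative G := by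
    rw [hG1, ← pow_succ, ← hl, derivative_pow, Derivation.leibniz_pow, hl, Nat.add_sub_cancel,
      C_eq_natCast, nsmul_eq_mul, smul_eq_mul]
    rw [hl] at h2m'
    linear_combination (2 * (l + 1 : ℕ) * H ^ l) * key + 3 * (X + C P) * H ^ (l + 1) * h2m'
  have hδG' : 12 * δ G = C (-3) * (G * X) + C (-3 * P) * G + C (-2) * (derivative G * X ^ 2) +
      C (-2 * P) * (derivative G * X) + C (4 * Q) * derivative G := by
    rw [hδG]; simp only [map_mul, map_neg, map_ofNat]; ring
  have hGd' : C 2 * (derivative G * X ^ 3) + C (-6 * Q) * (derivative G * X) +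
      C (4 * R) * derivative G = C (-3) * (G * X ^ 2) + C (3 * Q) * G := by
    rw [hHd, hH, cubicPoly] at hGd
    simp only [map_mul, map_neg, map_ofNat] at hGd ⊢
    linear_combination hGd
  have c1 := congrArg (fun u => coeff u (k + 4)) hδG'
  have c2 := congrArg (fun u => coeff u (k + 3)) hδG'
  have c3 := congrArg (fun u => coeff u (k + 4)) hGd'
  have hco (n : ℕ) : (δ G).coeff n = D (G.coeff n) := Differential.coeff_mapCoeffs G n
  simp only [coeff_add, coeff_C_mul, coeff_ofNat_mul, hco, coeff_mul_X, coeff_derivative,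
    show ∀ (u : Polynomial S), (u * X ^ 2).coeff (k + 4) = u.coeff (k + 2) from
      fun u => coeff_mul_X_pow u 2 (k + 2),
    show ∀ (u : Polynomial S), (u * X ^ 3).coeff (k + 4) = u.coeff (k + 1) from
      fun u => coeff_mul_X_pow u 3 (k + 1),
    show ∀ (u : Polynomial S), (u * X ^ 2).coeff (k + 3) = u.coeff (k + 1) from
      fun u => coeff_mul_X_pow u 2 (k + 1), add_assoc, Nat.reduceAdd, Nat.cast_add, hk,
      Nat.cast_ofNat, Nat.cast_one] at c1 c2 c3
  have hA : hasseCoeff (k + 5) Q R = G.coeff (k + 4) := rfl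
  rw [hA]
  set A := G.coeff (k + 4)
  set B := G.coeff (k + 3)
  set D3 := G.coeff (k + 2)
  have hA1 : 12 * D A = B - P * A := by linear_combination c1
  have hB1 : 12 * D B = P * B - Q * A := by linear_combination c2 - c3
  have hA2 := congrArg D hA1
  have h12 : D (12 * D A) = 12 * D (D A) := by
    have : (12 : S) * D A = (12 : ℕ) • D A := by simp
    rw [this, map_nsmul]; simp
  rw [h12, map_sub, Derivation.leibniz, smul_eq_mul, smul_eq_mul] at hA2
  linear_combination 12 * hA2 + hB1 - P * hA1 - A * hP

/-- The derivation `q d/dq` on power series. -/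
def qDerivation (S : Type*) [CommRing S] :
    @Derivation ℤ (PowerSeries S) (PowerSeries S) _ _ _ (Ring.toIntAlgebra _) _ _ :=
  @Derivation.mk' ℤ _ (PowerSeries S) _ (Ring.toIntAlgebra _) (PowerSeries S) _ _ _
    (((AddMonoidHom.mulLeft PowerSeries.X).comp
      (PowerSeries.derivative S : PowerSeries S →+ PowerSeries S)).toIntLinearMap)
    fun a b => by
      change PowerSeries.X * PowerSeries.derivative S (a * b) =
        a * (PowerSeries.X * PowerSeries.derivative S b) +
          b * (PowerSeries.X * PowerSeries.derivative S a)
      rw [Derivation.leibniz, smul_eq_mul, smul_eq_mul]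
      ring

theorem qDerivation_apply {S : Type*} [CommRing S] (φ : PowerSeries S) :
    qDerivation S φ = qDeriv φ := by
  ext n
  have h : qDerivation S φ = PowerSeries.X * PowerSeries.derivative S φ := rfl
  rw [h]
  cases n with
  | zero => simp [qDeriv]
  | succ n =>
    rw [PowerSeries.coeff_succ_X_mul, PowerSeries.coeff_derivative, qDeriv]
    simp [mul_comm]

theorem X_pow_dvd_hasseCoeff_sub {κ : Type*} [Field κ] (p : ℕ) [Fact p.Prime] [CharP κ p]
    (h5 : 5 ≤ p) :
    (PowerSeries.X : PowerSeries κ) ^ p ∣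
      hasseCoeff p (serQ.map (Int.castRingHom κ)) (serR.map (Int.castRingHom κ)) -
        PowerSeries.C (hasseCoeff p 1 1) := by
  have hp : p.Prime := Fact.out
  have hodd : p % 2 = 1 := by
    rcases hp.eq_two_or_odd with h | h
    · omega
    · exact h
  have key := derivation_derivation_hasseCoeff (qDerivation κ)
    (P := serP.map (Int.castRingHom κ)) (Q := serQ.map (Int.castRingHom κ))
    (R := serR.map (Int.castRingHom κ)) (p := p)
    (by rw [qDerivation_apply, qDeriv_map]
        simpa [map_ofNat] using congrArg (PowerSeries.map (Int.castRingHom κ)) ramanujan_P)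
    (by rw [qDerivation_apply, qDeriv_map]
        simpa [map_ofNat] using congrArg (PowerSeries.map (Int.castRingHom κ)) ramanujan_Q)
    (by rw [qDerivation_apply, qDeriv_map]
        simpa [map_ofNat] using congrArg (PowerSeries.map (Int.castRingHom κ)) ramanujan_R)
    (by rw [← map_natCast (PowerSeries.C (R := κ)), CharP.cast_eq_zero, map_zero]) h5 hodd
  set A := hasseCoeff p (serQ.map (Int.castRingHom κ)) (serR.map (Int.castRingHom κ)) with hA
  rw [qDerivation_apply, qDerivation_apply] at key
  have h0 : PowerSeries.constantCoeff A = hasseCoeff p 1 1 := by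
    rw [hA, map_hasseCoeff]; simp
  rw [PowerSeries.X_pow_dvd_iff]
  intro n hn
  cases n with
  | zero => simp [h0]
  | succ n =>
    have hc := congrArg (PowerSeries.coeff (n + 1)) key
    rw [← map_ofNat (PowerSeries.C (R := κ)) 144, PowerSeries.coeff_C_mul] at hc
    simp only [qDeriv, PowerSeries.coeff_mk, map_zero, mul_eq_zero] at hc
    have hn0 : ((n + 1 : ℕ) : κ) ≠ 0 := by
      rw [Ne, CharP.cast_eq_zero_iff κ p]
      exact Nat.not_dvd_of_pos_of_lt (Nat.succ_pos n) hn
    have h144 : (144 : κ) ≠ 0 := by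
      have : ((12 ^ 2 : ℕ) : κ) ≠ 0 := by
        rw [Ne, CharP.cast_eq_zero_iff κ p]
        intro h
        have h12 := hp.dvd_of_dvd_pow h
        have := Nat.le_of_dvd (by norm_num) h12
        interval_cases p <;> revert hp h12 <;> decide
      norm_num at this
      exact this
    rw [map_sub, PowerSeries.coeff_C, if_neg (Nat.succ_ne_zero n), sub_zero]
    tauto

end HasseInvariant

section WeightedSpan

variable (κ : Type*) [Field κ] {S : Type*} [CommRing S] [Algebra κ S]

/-- The span of the monomials `u^a v^b` of weight `w₁ a + w₂ b = k`. -/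
def weightSpan (u v : S) (w₁ w₂ k : ℤ) : Submodule κ S :=
  Submodule.span κ {x | ∃ a b : ℕ, w₁ * a + w₂ * b = k ∧ x = u ^ a * v ^ b}

variable {κ}

theorem monomial_mem_weightSpan (u v : S) {w₁ w₂ k : ℤ} (a b : ℕ) (h : w₁ * a + w₂ * b = k) :
    u ^ a * v ^ b ∈ weightSpan κ u v w₁ w₂ k :=
  Submodule.subset_span ⟨a, b, h, rfl⟩

theorem mul_mem_weightSpan {u v x y : S} {w₁ w₂ j k l : ℤ} (hx : x ∈ weightSpan κ u v w₁ w₂ j)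
    (hy : y ∈ weightSpan κ u v w₁ w₂ k) (hl : j + k = l) : x * y ∈ weightSpan κ u v w₁ w₂ l := by
  have h := Submodule.mul_mem_mul hx hy
  rw [weightSpan, weightSpan, Submodule.span_mul_span] at h
  refine Submodule.span_mono ?_ h
  rintro _ ⟨_, ⟨a, b, hab, rfl⟩, _, ⟨c, d, hcd, rfl⟩, rfl⟩
  refine ⟨a + c, b + d, ?_, ?_⟩
  · push_cast; linear_combination hab + hcd + hl
  · simp only [pow_add]; ring

theorem pow_mem_weightSpan {u v x : S} {w₁ w₂ k l : ℤ} (hx : x ∈ weightSpan κ u v w₁ w₂ k) (n : ℕ)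
    (hl : n * k = l) : x ^ n ∈ weightSpan κ u v w₁ w₂ l := by
  induction n generalizing l with
  | zero => simpa using monomial_mem_weightSpan (κ := κ) u v 0 0 (by simpa using hl)
  | succ n ih =>
    rw [pow_succ]
    exact mul_mem_weightSpan (ih rfl) hx (by rw [← hl]; push_cast; ring)

theorem ofNat_mul_mem {M : Submodule κ S} {x : S} (n : ℕ) (hx : x ∈ M) : (n : S) * x ∈ M := by
  rw [← nsmul_eq_mul]
  exact M.nsmul_mem hx n

theorem coeff_cubicPoly_pow_mem (Q R : S) (m n : ℕ) :
    ((cubicPoly Q R) ^ m).coeff n ∈ weightSpan κ Q R 4 6 (6 * m - 2 * n) := by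
  have hQ : Q ∈ weightSpan κ Q R 4 6 4 := by
    simpa using monomial_mem_weightSpan (κ := κ) Q R (w₁ := 4) (w₂ := 6) 1 0 (by norm_num)
  have hR : R ∈ weightSpan κ Q R 4 6 6 := by
    simpa using monomial_mem_weightSpan (κ := κ) Q R (w₁ := 4) (w₂ := 6) 0 1 (by norm_num)
  induction m generalizing n with
  | zero =>
    rw [pow_zero, coeff_one]
    split_ifs with h
    · subst h
      simpa using monomial_mem_weightSpan (κ := κ) Q R (w₁ := 4) (w₂ := 6) 0 0 (by norm_num)
    · exact zero_mem _
  | succ m ih =>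
    set G := cubicPoly Q R ^ m with hG
    have : cubicPoly Q R ^ (m + 1) = X ^ 3 * G - C (3 * Q) * (X ^ 1 * G) + C (2 * R) * G := by
      rw [pow_succ, ← hG, cubicPoly]; ring
    rw [this, coeff_add, coeff_sub, coeff_C_mul, coeff_C_mul, coeff_X_pow_mul', coeff_X_pow_mul']
    refine add_mem (sub_mem ?_ ?_) ?_
    · split_ifs with h
      · convert ih (n - 3) using 1
        push_cast [Nat.cast_sub h]; ring_nf
      · exact zero_mem _
    · split_ifs with h
      · refine mul_mem_weightSpan (j := 4) (ofNat_mul_mem 3 hQ) (ih (n - 1)) ?_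
        push_cast [Nat.cast_sub h]; ring
      · rw [mul_zero]; exact zero_mem _
    · refine mul_mem_weightSpan (j := 6) (ofNat_mul_mem 2 hR) (ih n) ?_
      push_cast; ring

theorem weightSpan_le (Q R : S) (N : ℕ) :
    weightSpan κ Q R 4 6 (12 * N) ≤ weightSpan κ (Q ^ 3) (Q ^ 3 - R ^ 2) 1 1 N := by
  rw [weightSpan, Submodule.span_le]
  rintro _ ⟨a, b, hab, rfl⟩
  obtain ⟨i, rfl⟩ : ∃ i, a = 3 * i := ⟨a / 3, by omega⟩
  obtain ⟨j, rfl⟩ : ∃ j, b = 2 * j := ⟨b / 2, by omega⟩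
  have hij : (i + j : ℤ) = N := by push_cast at hab; omega
  have hY : Q ^ 3 ∈ weightSpan κ (Q ^ 3) (Q ^ 3 - R ^ 2) 1 1 1 := by
    simpa using monomial_mem_weightSpan (κ := κ) (Q ^ 3) (Q ^ 3 - R ^ 2)
      (w₁ := 1) (w₂ := 1) 1 0 (by norm_num)
  have hZ : Q ^ 3 - R ^ 2 ∈ weightSpan κ (Q ^ 3) (Q ^ 3 - R ^ 2) 1 1 1 := by
    simpa using monomial_mem_weightSpan (κ := κ) (Q ^ 3) (Q ^ 3 - R ^ 2)
      (w₁ := 1) (w₂ := 1) 0 1 (by norm_num)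
  have h := mul_mem_weightSpan (pow_mem_weightSpan hY i (l := i) (by simp))
    (pow_mem_weightSpan (sub_mem hY hZ) j (l := j) (by simp)) hij
  rw [SetLike.mem_coe]
  convert h using 1
  rw [sub_sub_cancel, pow_mul, pow_mul]

theorem exists_sum_of_mem_weightSpan {u v x : S} {N : ℕ} (hx : x ∈ weightSpan κ u v 1 1 N) :
    ∃ c : ℕ → κ, x = ∑ i ∈ range (N + 1), c i • (u ^ (N - i) * v ^ i) := by
  induction hx using Submodule.span_induction with
  | mem x hx =>
    obtain ⟨a, b, hab, rfl⟩ := hx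
    refine ⟨fun i => if i = b then 1 else 0, ?_⟩
    have hb : b ∈ range (N + 1) := by rw [Finset.mem_range]; omega
    simp only [ite_smul, one_smul, zero_smul, Finset.sum_ite_eq', hb, if_true]
    rw [show N - b = a by omega]
  | zero => exact ⟨0, by simp⟩
  | add x y _ _ hx hy =>
    obtain ⟨c, rfl⟩ := hx
    obtain ⟨d, rfl⟩ := hy
    exact ⟨c + d, by simp [add_smul, sum_add_distrib]⟩
  | smul r x _ hx =>
    obtain ⟨c, rfl⟩ := hx
    exact ⟨r • c, by simp [Finset.smul_sum, mul_smul]⟩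

end WeightedSpan

section HasseInvariantOfFixedPoint

variable {κ : Type*} [Field κ]

theorem snd_eq_zero_of_X_pow_dvd_fst (h1728 : (1728 : κ) ≠ 0) (Q₀ R₀ : κ) {N : ℕ}
    {x : PowerSeries κ × κ}
    (hx : x ∈ weightSpan κ (serY.map (Int.castRingHom κ), Q₀ ^ 3)
      (serZ.map (Int.castRingHom κ), Q₀ ^ 3 - R₀ ^ 2) 1 1 N)
    (h : PowerSeries.X ^ (N + 1) ∣ x.1) : x.2 = 0 := by
  obtain ⟨c, rfl⟩ := exists_sum_of_mem_weightSpan hx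
  have h1 : (∑ i ∈ range (N + 1), c i • ((serY.map (Int.castRingHom κ), Q₀ ^ 3) ^ (N - i) *
      (serZ.map (Int.castRingHom κ), Q₀ ^ 3 - R₀ ^ 2) ^ i :  PowerSeries κ × κ)).1 =
      formSeries N c := by
    rw [Prod.fst_sum, formSeries]
    refine sum_congr rfl fun i _ => ?_
    simp [PowerSeries.smul_eq_C_mul, mul_assoc]
  rw [h1] at h
  have h0 := eq_zero_of_X_pow_dvd_formSeries h1728 N h
  rw [sum_eq_zero, Prod.snd_zero]
  intro i hi
  rw [h0 i (by rw [Finset.mem_range] at hi; omega), zero_smul]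

theorem intCast_pow_char (p : ℕ) [Fact p.Prime] [CharP κ p] (t : ℤ) : (t : κ) ^ p = t := by
  have := congrArg (ZMod.castHom dvd_rfl κ) (ZMod.pow_card (t : ZMod p))
  rwa [map_pow, map_intCast] at this

theorem hasseCoeff_pow_eq (p : ℕ) [Fact p.Prime] [CharP κ p] (h5 : 5 ≤ p) {Q₀ R₀ s : κ} {t : ℤ}
    {e : ℕ → κ} (hZ : (Q₀ ^ 3 - R₀ ^ 2) ^ p = Q₀ ^ 3 - R₀ ^ 2) (hZ0 : Q₀ ^ 3 - R₀ ^ 2 ≠ 0)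
    (hs : Q₀ ^ 3 = s * (Q₀ ^ 3 - R₀ ^ 2))
    (he : formSeries (p + 1) e =
      PowerSeries.C (((t : κ) ^ 12) ^ (p + 1)) * serZ.map (Int.castRingHom κ) ^ (p + 1) -
        PowerSeries.C ((t : κ) ^ 12) * serZ.map (Int.castRingHom κ) ^ 2)
    (hes : ∑ i ∈ range (p + 1 + 1), e i * s ^ (p + 1 - i) = 0) :
    (t : κ) = 0 ∨ hasseCoeff p Q₀ R₀ ^ 12 = hasseCoeff p 1 1 ^ 12 * (t : κ) ^ 12 := by
  have hp : p.Prime := Fact.out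
  have hodd : p % 2 = 1 := by
    rcases hp.eq_two_or_odd with h | h
    · omega
    · exact h
  have h1728 : (1728 : κ) ≠ 0 := by
    have := not_dvd_1728 p h5
    rw [← CharP.cast_eq_zero_iff κ p] at this
    exact_mod_cast this
  set y := serY.map (Int.castRingHom κ) with hy
  set z := serZ.map (Int.castRingHom κ) with hz
  set q := serQ.map (Int.castRingHom κ) with hq
  set r := serR.map (Int.castRingHom κ) with hr
  set Z₀ := Q₀ ^ 3 - R₀ ^ 2 with hZ₀
  set T := (t : κ) ^ 12 with hT
  have hTp : T ^ p = T := by rw [hT, ← pow_mul, mul_comm, pow_mul, intCast_pow_char]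
  let S := PowerSeries κ × κ
  let Y : S := (y, Q₀ ^ 3)
  let Z : S := (z, Z₀)
  let A : S := hasseCoeff p (q, Q₀) (r, R₀)
  have hY : Y = ((q, Q₀) : S) ^ 3 := by
    refine Prod.ext ?_ rfl
    change y = q ^ 3
    rw [hy, serY, map_pow]
  have hZ' : Z = ((q, Q₀) : S) ^ 3 - ((r, R₀) : S) ^ 2 := by
    refine Prod.ext ?_ rfl
    change z = q ^ 3 - r ^ 2
    rw [hz, serZ, map_sub, map_pow, map_pow]
  have hA1 : A.1 = hasseCoeff p q r := map_hasseCoeff (RingHom.fst (PowerSeries κ) κ) p _ _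
  have hA2 : A.2 = hasseCoeff p Q₀ R₀ := map_hasseCoeff (RingHom.snd (PowerSeries κ) κ) p _ _
  have hA12 : A ^ 12 ∈ weightSpan κ Y Z 1 1 ((p - 1 : ℕ) : ℤ) := by
    rw [hY, hZ']
    refine weightSpan_le _ _ _ (pow_mem_weightSpan (coeff_cubicPoly_pow_mem _ _ _ _) 12 ?_)
    omega
  have hmono (a b N : ℕ) (h : a + b = N) : Y ^ a * Z ^ b ∈ weightSpan κ Y Z 1 1 N :=
    monomial_mem_weightSpan Y Z a b (by rw [← h]; push_cast; ring)
  set κ₀ := hasseCoeff p (1 : κ) 1 ^ 12 with hκ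
  have hE : T • (A ^ 12 * Z ^ 2) - κ₀ • (T ^ (p + 1) • Z ^ (p + 1) -
      ∑ i ∈ range (p + 1 + 1), e i • (Y ^ (p + 1 - i) * Z ^ i)) ∈
      weightSpan κ Y Z 1 1 ((p + 1 : ℕ) : ℤ) := by
    refine sub_mem (Submodule.smul_mem _ _ ?_) (Submodule.smul_mem _ _ (sub_mem
      (Submodule.smul_mem _ _ ?_) (sum_mem fun i hi => Submodule.smul_mem _ _ ?_)))
    · refine mul_mem_weightSpan hA12 (k := 2) ?_ (by omega)
      simpa using hmono 0 2 2 rfl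
    · simpa using hmono 0 (p + 1) (p + 1) (by simp)
    · rw [Finset.mem_range] at hi
      exact hmono _ _ _ (by omega)
  have hfin := snd_eq_zero_of_X_pow_dvd_fst h1728 Q₀ R₀ hE ?_
  · have hsum : (∑ i ∈ range (p + 1 + 1), e i • (Y ^ (p + 1 - i) * Z ^ i)).2 = 0 := by
      rw [Prod.snd_sum]
      have h (i : ℕ) (hi : i ∈ range (p + 1 + 1)) : (e i • (Y ^ (p + 1 - i) * Z ^ i)).2 =
          Z₀ ^ (p + 1) * (e i * s ^ (p + 1 - i)) := by
        rw [Finset.mem_range] at hi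
        obtain ⟨j, hj⟩ : ∃ j, p + 1 = i + j := ⟨p + 1 - i, by omega⟩
        have : (e i • (Y ^ (p + 1 - i) * Z ^ i)).2 = e i * ((Q₀ ^ 3) ^ (p + 1 - i) * Z₀ ^ i) := rfl
        rw [this, hs, hj, Nat.add_sub_cancel_left]
        ring_nf
      rw [sum_congr rfl h, ← mul_sum, hes, mul_zero]
    have h2 : T * (hasseCoeff p Q₀ R₀ ^ 12 * Z₀ ^ 2) - κ₀ * (T ^ (p + 1) * Z₀ ^ (p + 1) -
        (∑ i ∈ range (p + 1 + 1), e i • (Y ^ (p + 1 - i) * Z ^ i)).2) = 0 := by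
      rw [← hA2]
      exact hfin
    rw [hsum, pow_succ T, pow_succ Z₀ p, hTp, hZ] at h2
    have h3 : T * Z₀ ^ 2 * (hasseCoeff p Q₀ R₀ ^ 12 - κ₀ * T) = 0 := by linear_combination h2
    rcases mul_eq_zero.mp h3 with h | h
    · left
      have hT0 : T = 0 := (mul_eq_zero.mp h).resolve_right (pow_ne_zero 2 hZ0)
      exact pow_eq_zero_iff (by norm_num) |>.mp hT0
    · right
      linear_combination h
  · have hsum : (∑ i ∈ range (p + 1 + 1), e i • (Y ^ (p + 1 - i) * Z ^ i)).1 =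
        formSeries (p + 1) e := by
      rw [Prod.fst_sum, formSeries]
      refine sum_congr rfl fun i _ => ?_
      rw [mul_assoc, ← PowerSeries.smul_eq_C_mul]
      rfl
    have h1 : (T • (A ^ 12 * Z ^ 2) - κ₀ • (T ^ (p + 1) • Z ^ (p + 1) -
        ∑ i ∈ range (p + 1 + 1), e i • (Y ^ (p + 1 - i) * Z ^ i))).1 =
        T • (hasseCoeff p q r ^ 12 * z ^ 2) - κ₀ • (T ^ (p + 1) • z ^ (p + 1) -
          formSeries (p + 1) e) := by
      rw [← hsum, ← hA1]
      rfl
    have h2 : T • (hasseCoeff p q r ^ 12 * z ^ 2) - κ₀ • (T ^ (p + 1) • z ^ (p + 1) -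
          formSeries (p + 1) e) =
        PowerSeries.C T * (z ^ 2 * (hasseCoeff p q r ^ 12 -
          PowerSeries.C (hasseCoeff p (1 : κ) 1) ^ 12)) := by
      rw [he, hκ]
      simp only [PowerSeries.smul_eq_C_mul, map_pow]
      ring
    rw [h1, h2]
    refine Dvd.dvd.mul_left ?_ _
    rw [show p + 1 + 1 = 2 + p by ring, pow_add]
    refine mul_dvd_mul (pow_dvd_pow_of_dvd ?_ 2)
      ((X_pow_dvd_hasseCoeff_sub p h5).trans (sub_dvd_pow_sub_pow _ _ 12))
    rw [hz, serZ_eq_X_mul, map_mul, PowerSeries.map_X]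
    exact dvd_mul_right _ _

end HasseInvariantOfFixedPoint

section LiftedInvariants

open UpperHalfPlane IsLocalRing

/-- The invariant `4α³ / (4α³ + 27β²)` of the curve `Y² = X³ + αX + β`, which is `j / 1728`. -/
def jInv {F : Type*} [Field F] (α β : F) : F := 4 * α ^ 3 / (4 * α ^ 3 + 27 * β ^ 2)

/-- The values of the invariant at ordinary curves over `𝔽_p` are reductions of values at quadratic
points of the upper half plane, the traces matching up to a bounded ambiguity. -/
theorem exists_lift_of_jInv (p : ℕ) [hp : Fact p.Prime] (h5 : 5 ≤ p) :
    ∃ (κ : Type) (_ : Field κ) (_ : CharP κ p) (κ₀ : κ) (J : ℤ × ℤ × ℤ → κ),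
      ∀ α β : ZMod p, 4 * α ^ 3 + 27 * β ^ 2 ≠ 0 → (frobTrace p α β : ZMod p) ≠ 0 →
        ∃ t a b c : ℤ, t ^ 2 < 4 * (p : ℤ) ∧ b ^ 2 - 4 * a * c = t ^ 2 - 4 * p ∧ 0 < a ∧ |b| ≤ a ∧
          a ≤ c ∧ (t = 0 ∨ κ₀ ≠ 0 ∧ κ₀ * (t : κ) ^ 12 = (frobTrace p α β : κ) ^ 12) ∧
          J (a, b, c) = ZMod.castHom dvd_rfl κ (jInv α β) := by
  obtain ⟨A, hA⟩ := exists_valuationSubring_charP p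
  let P : ℤ × ℤ × ℤ → A → Prop := fun F r => ∃ τ : ℍ,
    0 < F.1 ∧ (F.1 * τ ^ 2 + F.2.1 * τ + F.2.2 : ℂ) = 0 ∧ Yf τ = r * Zf τ
  let J : ℤ × ℤ × ℤ → ResidueField A := fun F =>
    if h : ∃ r, P F r then residue A h.choose else 0
  have hPu (F : ℤ × ℤ × ℤ) (r r' : A) (h : P F r) (h' : P F r') : r = r' := by
    obtain ⟨τ, h0, h1, h2⟩ := h
    obtain ⟨τ', -, h1', h2'⟩ := h'
    obtain rfl := coe_eq_of_quadratic h0 h1 h1'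
    exact Subtype.ext (mul_right_cancel₀ (Zf_ne_zero τ) (h2.symm.trans h2'))
  have hJ (F : ℤ × ℤ × ℤ) (r : A) (h : P F r) : J F = residue A r := by
    have hex : ∃ r, P F r := ⟨r, h⟩
    simp only [J, dif_pos hex]
    rw [hPu F _ _ hex.choose_spec h]
  refine ⟨ResidueField A, inferInstance, hA, hasseCoeff p 1 1 ^ 12, J, fun α β hΔ hap => ?_⟩
  set φ : ZMod p →+* ResidueField A := ZMod.castHom dvd_rfl _ with hφ
  have hcop (n : ℕ) (hn : n.Coprime p) : (n : ZMod p) ≠ 0 := by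
    rw [Ne, CharP.cast_eq_zero_iff (ZMod p) p]
    intro h
    exact hp.out.one_lt.ne' (Nat.eq_one_of_dvd_coprimes (hn.symm) dvd_rfl h)
  have h3 : (3 : ZMod p) ≠ 0 := by
    have h : Nat.Coprime 3 p := (Nat.coprime_primes Nat.prime_three hp.out).mpr (by omega)
    exact_mod_cast hcop 3 h
  have h2 : (2 : ZMod p) ≠ 0 := by
    have h : Nat.Coprime 2 p := (Nat.coprime_primes Nat.prime_two hp.out).mpr (by omega)
    exact_mod_cast hcop 2 h
  set Q : ZMod p := -α / 3 with hQ
  set R : ZMod p := β / 2 with hR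
  have hα : α = -3 * Q := by rw [hQ]; field_simp
  have hβ : β = 2 * R := by rw [hR]; field_simp
  have hΔ' : 4 * α ^ 3 + 27 * β ^ 2 = -108 * (Q ^ 3 - R ^ 2) := by rw [hα, hβ]; ring
  have hZ : Q ^ 3 - R ^ 2 ≠ 0 := fun h => hΔ (by rw [hΔ', h, mul_zero])
  have hj : Q ^ 3 = jInv α β * (Q ^ 3 - R ^ 2) := by
    rw [jInv, div_mul_eq_mul_div, eq_div_iff hΔ, hΔ', hα]
    ring
  have hpow (x : ZMod p) : φ x ^ p = φ x := by rw [← map_pow, ZMod.pow_card]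
  obtain ⟨τ, r, t, a, b, c, e, hr, hrs, ht, hd, ha, hb, hc, hq, he, hes⟩ :=
    exists_quadratic_point p h5 (hpow (jInv α β))
  refine ⟨t, a, b, c, ht, hd, ha, hb, hc, ?_, ?_⟩
  · have htr : (frobTrace p α β : ResidueField A) = hasseCoeff p (φ Q) (φ R) := by
      have h := congrArg φ (frobTrace_eq_hasseCoeff p h5 Q R)
      rw [← hα, ← hβ, map_hasseCoeff, map_intCast] at h
      exact h
    have key := hasseCoeff_pow_eq p h5 (Q₀ := φ Q) (R₀ := φ R) (s := φ (jInv α β)) (t := t) (e := e)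
      (by rw [← map_pow, ← map_pow, ← map_sub, hpow])
      (by rw [← map_pow, ← map_pow, ← map_sub]; exact (map_ne_zero φ).mpr hZ)
      (by rw [← map_pow, ← map_pow, ← map_sub, ← map_mul, ← hj]) he hes
    rw [← htr] at key
    rcases key with h | h
    · left
      rw [CharP.intCast_eq_zero_iff (ResidueField A) p] at h
      by_contra h0
      have h1 := Int.le_of_dvd (by positivity) ((abs_dvd_abs (p : ℤ) t).mpr h)
      rw [Nat.abs_cast] at h1
      have h5' : (5 : ℤ) ≤ p := by exact_mod_cast h5
      have h2 : (p : ℤ) ^ 2 ≤ t ^ 2 := by rw [← sq_abs t]; gcongr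
      nlinarith
    · right
      have ha0 : (frobTrace p α β : ResidueField A) ≠ 0 := by
        have := (map_ne_zero φ).mpr hap
        rwa [map_intCast] at this
      refine ⟨fun h0 => ?_, h.symm⟩
      rw [h0, zero_mul] at h
      exact ha0 (pow_eq_zero_iff (by norm_num) |>.mp h)
  · rw [← hrs]
    exact hJ _ _ ⟨τ, ha, hq, hr⟩

end LiftedInvariants

section DivisorBound

theorem succ_pow_six_le (k : ℕ) : (k + 1) ^ 6 ≤ 12 ^ 6 * 2 ^ k := by
  rcases Nat.lt_or_ge k 8 with h | h
  · calc (k + 1) ^ 6 ≤ 12 ^ 6 := Nat.pow_le_pow_left (by omega) 6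
      _ ≤ 12 ^ 6 * 2 ^ k := Nat.le_mul_of_pos_right _ (by positivity)
  · induction k, h using Nat.le_induction with
    | base => norm_num
    | succ k hk ih =>
      obtain ⟨j, rfl⟩ : ∃ j, k = 8 + j := ⟨k - 8, by omega⟩
      have : (8 + j + 1 + 1) ^ 6 ≤ 2 * (8 + j + 1) ^ 6 := by
        zify
        have hj : (0 : ℤ) ≤ j := by positivity
        have h2 : 2 * ((8 : ℤ) + j + 1) ^ 6 = (8 + j + 1 + 1) ^ 6 +
            (62882 + 108588 * j + 46830 * j ^ 2 + 9160 * j ^ 3 + 930 * j ^ 4 +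
              48 * j ^ 5 + j ^ 6) := by
          ring
        rw [h2]
        have : (0 : ℤ) ≤ 62882 + 108588 * j + 46830 * j ^ 2 + 9160 * j ^ 3 + 930 * j ^ 4 +
          48 * j ^ 5 + j ^ 6 := by positivity
        linarith
      calc (8 + j + 1 + 1) ^ 6 ≤ 2 * (8 + j + 1) ^ 6 := this
        _ ≤ 2 * (12 ^ 6 * 2 ^ (8 + j)) := by gcongr
        _ = _ := by ring

theorem exists_card_divisors_pow_six_le : ∃ K : ℕ, ∀ n : ℕ, n ≠ 0 → #n.divisors ^ 6 ≤ K * n := by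
  refine ⟨(12 ^ 6) ^ 64, fun n hn => ?_⟩
  rw [Nat.card_divisors hn, ← prod_pow]
  have h1 : ∏ p ∈ n.primeFactors, (n.factorization p + 1) ^ 6 ≤
      ∏ p ∈ n.primeFactors, (if p < 64 then 12 ^ 6 else 1) * p ^ n.factorization p := by
    refine prod_le_prod' fun p hp => ?_
    have hp2 := (Nat.prime_of_mem_primeFactors hp).two_le
    split_ifs with h
    · exact (succ_pow_six_le _).trans (by gcongr)
    · rw [one_mul]
      calc (n.factorization p + 1) ^ 6 ≤ (2 ^ n.factorization p) ^ 6 := by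
            gcongr
            exact Nat.lt_two_pow_self
        _ = 64 ^ n.factorization p := by rw [← pow_mul, mul_comm, pow_mul]; norm_num
        _ ≤ _ := by gcongr; omega
  refine h1.trans ?_
  rw [prod_mul_distrib, ← Nat.prod_factorization_eq_prod_primeFactors (fun p k => p ^ k),
    Nat.prod_factorization_pow_eq_self hn]
  gcongr
  rw [← prod_filter, prod_const]
  refine Nat.pow_le_pow_right (by positivity) ?_
  refine (card_le_card (t := range 64) fun p hp => ?_).trans_eq (card_range 64)
  simp only [Finset.mem_filter] at hp
  exact Finset.mem_range.mpr hp.2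

end DivisorBound

section CountingForms

/-- Reduced forms of a given negative discriminant are few. -/
theorem exists_card_reducedForms_le : ∃ C : ℝ, 0 < C ∧ ∀ (p : ℕ) (t : ℤ), 0 < p →
    ∃ s : Finset (ℤ × ℤ × ℤ), (#s : ℝ) ≤ C * (p : ℝ) ^ ((2 : ℝ) / 3) ∧
      ∀ a b c : ℤ, t ^ 2 < 4 * (p : ℤ) → b ^ 2 - 4 * a * c = t ^ 2 - 4 * p → 0 < a → |b| ≤ a →
        a ≤ c → (a, b, c) ∈ s := by
  obtain ⟨K, hK⟩ := exists_card_divisors_pow_six_le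
  refine ⟨11664 * K + 1, by positivity, fun p t hp => ?_⟩
  set B := Nat.sqrt (2 * p) with hB
  let n : ℤ → ℕ := fun b => ((b ^ 2 + 4 * p - t ^ 2) / 4).toNat
  let s : Finset (ℤ × ℤ × ℤ) := (Icc (-B : ℤ) B).biUnion fun b =>
    (n b).divisors.image fun a : ℕ => ((a : ℤ), b, (n b : ℤ) / a)
  have hBsq : B ^ 2 ≤ 2 * p := Nat.sqrt_le' _
  have hB1 : 1 ≤ B := Nat.le_sqrt.mpr (by omega)
  have hn (b : ℤ) (hb : b ∈ Icc (-B : ℤ) B) : n b ≤ 2 * p := by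
    rw [Finset.mem_Icc, ← abs_le] at hb
    have h1 : b ^ 2 ≤ 2 * p := by
      rw [← sq_abs]
      calc |b| ^ 2 ≤ (B : ℤ) ^ 2 := by gcongr
        _ ≤ (2 * p : ℤ) := by exact_mod_cast hBsq
    have := sq_nonneg t
    simp only [n]
    omega
  have hs : #s ^ 6 ≤ 11664 * K * p ^ 4 := by
    have hdiv (b : ℤ) (hb : b ∈ Icc (-B : ℤ) B) : #(n b).divisors ^ 6 ≤ K * (2 * p) := by
      rcases eq_or_ne (n b) 0 with h0 | h0
      · simp [h0]
      · exact (hK _ h0).trans (Nat.mul_le_mul_left _ (hn b hb))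
    have h1 : #s ≤ ∑ b ∈ Icc (-B : ℤ) B, #(n b).divisors :=
      card_biUnion_le.trans (sum_le_sum fun b _ => card_image_le)
    obtain ⟨b₀, hb₀, hmax⟩ := exists_max_image (Icc (-B : ℤ) B) (fun b => #(n b).divisors)
      ⟨0, by simp⟩
    have h2 : #s ≤ 3 * B * #(n b₀).divisors := by
      refine h1.trans ((sum_le_card_nsmul _ _ _ hmax).trans ?_)
      rw [smul_eq_mul, Int.card_Icc]
      exact Nat.mul_le_mul_right _ (by omega)
    calc #s ^ 6 ≤ (3 * B * #(n b₀).divisors) ^ 6 := Nat.pow_le_pow_left h2 6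
      _ = 729 * (B ^ 2) ^ 3 * #(n b₀).divisors ^ 6 := by ring
      _ ≤ 729 * (2 * p) ^ 3 * (K * (2 * p)) := by
        gcongr
        exact hdiv b₀ hb₀
      _ = _ := by ring
  refine ⟨s, ?_, fun a b c _ hd ha hb hc => ?_⟩
  · have h0 : (0 : ℝ) ≤ p := by positivity
    rw [← pow_le_pow_iff_left₀ (by positivity) (by positivity) (show 6 ≠ 0 by norm_num), mul_pow,
      ← Real.rpow_mul_natCast h0]
    norm_num only [Nat.cast_ofNat]
    calc (#s : ℝ) ^ 6 ≤ 11664 * K * (p : ℝ) ^ 4 := by exact_mod_cast hs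
      _ ≤ (11664 * K + 1) ^ 6 * (p : ℝ) ^ 4 := by
        gcongr
        have h1 : (1 : ℝ) ≤ 11664 * K + 1 := by
          have : (0 : ℝ) ≤ K := by positivity
          linarith
        calc (11664 * K : ℝ) ≤ 11664 * K + 1 := by linarith
          _ ≤ _ := le_self_pow₀ h1 (by norm_num)
      _ = _ := by norm_num
  · have hac : 4 * (a * c) = b ^ 2 + 4 * p - t ^ 2 := by linarith
    have hnb : (n b : ℤ) = a * c := by
      simp only [n]
      rw [← hac, Int.mul_ediv_cancel_left _ (by norm_num), Int.toNat_of_nonneg (by nlinarith)]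
    have hbB : b ∈ Icc (-B : ℤ) B := by
      rw [Finset.mem_Icc, ← abs_le, ← Int.natCast_natAbs]
      rw [Nat.cast_le, Nat.le_sqrt']
      zify
      have := sq_nonneg t
      have h1 : |b| ^ 2 ≤ a * c := by
        calc |b| ^ 2 ≤ a ^ 2 := by gcongr
          _ ≤ a * c := by rw [sq]; gcongr
      have := sq_abs b
      omega
    rw [Finset.mem_biUnion]
    refine ⟨b, hbB, ?_⟩
    rw [Finset.mem_image]
    lift a to ℕ using ha.le
    refine ⟨a, ?_, ?_⟩
    · rw [Nat.mem_divisors]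
      refine ⟨by zify; rw [hnb]; exact dvd_mul_right _ _, ?_⟩
      zify
      rw [hnb]
      exact mul_ne_zero ha.ne' (by omega)
    · rw [hnb, Int.mul_ediv_cancel_left _ ha.ne']

end CountingForms

section CountingTraces

/-- The norm form of an imaginary quadratic field represents `4p` boundedly often. -/
theorem exists_card_traces_le (d : ℤ) (hd : d < 0) (p : ℕ) (hp : p.Prime) :
    ∃ s : Finset ℤ, #s ≤ 81 ∧ ∀ a m : ℤ, a ^ 2 - 4 * (p : ℤ) = d * m ^ 2 → a ∈ s := by
  by_cases hex : ∃ a₁ m₁ : ℤ, a₁ ^ 2 - 4 * (p : ℤ) = d * m₁ ^ 2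
  swap
  · exact ⟨∅, by simp, fun a m h => (hex ⟨a, m, h⟩).elim⟩
  obtain ⟨a₁, m₁, h1⟩ := hex
  have hp' : Prime (p : ℤ) := Nat.prime_iff_prime_int.mp hp
  have hp0 : (p : ℤ) ≠ 0 := hp'.ne_zero
  refine ⟨(Icc (-4 : ℤ) 4 ×ˢ Icc (-4 : ℤ) 4).image fun w => (a₁ * w.1 + d * m₁ * w.2) / 4,
    card_image_le.trans (by rw [card_product]; simp), fun a₂ m₂ h2 => ?_⟩
  have hdvd : (p : ℤ) ∣ (a₁ * m₂ - a₂ * m₁) * (a₁ * m₂ + a₂ * m₁) :=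
    ⟨4 * (m₂ ^ 2 - m₁ ^ 2), by linear_combination m₂ ^ 2 * h1 - m₁ ^ 2 * h2⟩
  have hex : ∃ m : ℤ, a₂ ^ 2 - 4 * (p : ℤ) = d * m ^ 2 ∧ (p : ℤ) ∣ a₁ * m - a₂ * m₁ := by
    rcases hp'.dvd_or_dvd hdvd with h | h
    · exact ⟨m₂, h2, h⟩
    · refine ⟨-m₂, by rw [h2]; ring, ?_⟩
      rw [← dvd_neg]
      convert h using 1
      ring
  obtain ⟨m, hm, Y, hY⟩ := hex
  have hnorm : (a₁ * a₂ - d * m₁ * m) ^ 2 - d * (a₁ * m - a₂ * m₁) ^ 2 = 16 * (p : ℤ) ^ 2 := by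
    linear_combination (a₂ ^ 2 - d * m ^ 2) * h1 + 4 * p * hm
  have hX : (p : ℤ) ∣ a₁ * a₂ - d * m₁ * m := by
    refine hp'.dvd_of_dvd_pow (n := 2) ⟨16 * p + d * p * Y ^ 2, ?_⟩
    rw [hY] at hnorm
    linear_combination hnorm
  obtain ⟨X, hX⟩ := hX
  rw [hX, hY] at hnorm
  have hXY : X ^ 2 - d * Y ^ 2 = 16 := by
    apply mul_left_cancel₀ (pow_ne_zero 2 hp0)
    linear_combination hnorm
  have h4 : 4 * a₂ = a₁ * X + d * m₁ * Y := by
    apply mul_left_cancel₀ hp0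
    linear_combination (-a₂) * h1 + a₁ * hX + d * m₁ * hY
  rw [Finset.mem_image]
  refine ⟨(X, Y), ?_, ?_⟩
  · rw [Finset.mem_product, Finset.mem_Icc, Finset.mem_Icc]
    refine ⟨abs_le.mp (abs_le_of_sq_le_sq (by nlinarith [sq_nonneg Y]) (by norm_num)),
      abs_le.mp (abs_le_of_sq_le_sq (by nlinarith [sq_nonneg Y, sq_nonneg X]) (by norm_num))⟩
  · simp only [← h4]
    omega

end CountingTraces

section CountingInvariants

/-- The residue `w` gives a curve with good reduction whose Frobenius field is `ℚ(√d)`. -/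
def IsFrobField (d : ℤ) (p : ℕ) (α β : ZMod p) : Prop :=
  4 * α ^ 3 + 27 * β ^ 2 ≠ 0 ∧ frobTrace p α β ≠ 0 ∧
    ∃ m : ℤ, 0 < m ∧ frobTrace p α β ^ 2 - 4 * (p : ℤ) = d * m ^ 2

theorem card_pow_twelve_le {κ : Type*} [Field κ] (p : ℕ) [CharP κ p] (h16 : 16 < p) (x : κ) :
    #((Icc (-2 * p : ℤ) (2 * p)).filter fun t => t ^ 2 < 4 * (p : ℤ) ∧ (t : κ) ^ 12 = x) ≤ 12 := by
  rw [← card_image_of_injOn (f := fun t : ℤ => (t : κ))]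
  · refine (card_le_card (t := (nthRoots 12 x).toFinset) ?_).trans
      ((Multiset.toFinset_card_le _).trans (card_nthRoots 12 x))
    intro y hy
    rw [Finset.mem_image] at hy
    obtain ⟨t, ht, rfl⟩ := hy
    rw [Multiset.mem_toFinset, mem_nthRoots (by norm_num)]
    exact (Finset.mem_filter.mp ht).2.2
  · intro t ht t' ht' h
    simp only [Finset.coe_filter, Set.mem_ofPred_eq] at ht ht'
    have h0 : ((t - t' : ℤ) : κ) = 0 := by push_cast; exact sub_eq_zero.mpr h
    rw [CharP.intCast_eq_zero_iff κ p] at h0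
    by_contra hne
    have hle := Int.le_of_dvd (abs_pos.mpr (sub_ne_zero.mpr hne)) ((dvd_abs _ _).mpr h0)
    have h16' : (16 : ℤ) < p := by exact_mod_cast h16
    have h2 : (p : ℤ) ^ 2 ≤ (t - t') ^ 2 := by rw [← sq_abs (t - t')]; gcongr
    nlinarith [sq_nonneg (t + t'), ht.2.1, ht'.2.1]

theorem exists_card_jInv_le (d : ℤ) (hd : d < 0) :
    ∃ C : ℝ, 0 < C ∧ ∀ (p : ℕ) [Fact p.Prime], 16 < p →
    ∃ s : Finset (ZMod p), (#s : ℝ) ≤ C * (p : ℝ) ^ ((2 : ℝ) / 3) ∧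
      ∀ α β : ZMod p, IsFrobField d p α β → jInv α β ∈ s := by
  obtain ⟨C, hC, hforms⟩ := exists_card_reducedForms_le
  refine ⟨973 * C, by positivity, fun p hpf h16 => ?_⟩
  have hp : p.Prime := hpf.out
  obtain ⟨κ, _, _, κ₀, J, hJ⟩ := exists_lift_of_jInv p (by omega)
  obtain ⟨𝒜, h𝒜, hmem⟩ := exists_card_traces_le d hd p hp
  choose F hF hFmem using fun t => hforms p t hp.pos
  let 𝒯 : Finset ℤ := insert 0 (𝒜.biUnion fun a => (Icc (-2 * p : ℤ) (2 * p)).filter fun t =>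
    t ^ 2 < 4 * (p : ℤ) ∧ (t : κ) ^ 12 = κ₀⁻¹ * (a : κ) ^ 12)
  have h𝒯 : #𝒯 ≤ 973 := by
    refine (card_insert_le _ _).trans ?_
    have : #(𝒜.biUnion fun a => (Icc (-2 * p : ℤ) (2 * p)).filter fun t =>
      t ^ 2 < 4 * (p : ℤ) ∧ (t : κ) ^ 12 = κ₀⁻¹ * (a : κ) ^ 12) ≤ #𝒜 * 12 :=
      card_biUnion_le_card_mul _ _ _ fun a _ => card_pow_twelve_le p h16 _
    omega
  let φ : ZMod p →+* κ := ZMod.castHom dvd_rfl κ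
  refine ⟨((𝒯.biUnion F).image J).preimage φ φ.injective.injOn, ?_, ?_⟩
  · have hle : (#(((𝒯.biUnion F).image J).preimage φ φ.injective.injOn) : ℝ) ≤ #(𝒯.biUnion F) := by
      rw [Nat.cast_le, ← card_image_of_injective _ φ.injective]
      exact (card_le_card ((image_subset_iff_subset_preimage φ.injective.injOn).mpr
        subset_rfl)).trans card_image_le
    refine hle.trans ?_
    calc (#(𝒯.biUnion F) : ℝ) ≤ ∑ t ∈ 𝒯, (#(F t) : ℝ) := by exact_mod_cast card_biUnion_le
      _ ≤ ∑ t ∈ 𝒯, C * (p : ℝ) ^ ((2 : ℝ) / 3) := sum_le_sum fun t _ => hF t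
      _ = #𝒯 * (C * (p : ℝ) ^ ((2 : ℝ) / 3)) := by rw [sum_const, nsmul_eq_mul]
      _ ≤ 973 * (C * (p : ℝ) ^ ((2 : ℝ) / 3)) := by
        gcongr
        exact_mod_cast h𝒯
      _ = _ := by ring
  · rintro α β ⟨hΔ, ha0, m, hm, ham⟩
    have hap : (frobTrace p α β : ZMod p) ≠ 0 := by
      rw [Ne, ZMod.intCast_zmod_eq_zero_iff_dvd]
      intro h
      have h1 := Int.le_of_dvd (abs_pos.mpr ha0) ((dvd_abs _ _).mpr h)
      have h2 : (p : ℤ) ^ 2 ≤ frobTrace p α β ^ 2 := by rw [← sq_abs (frobTrace p α β)]; gcongr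
      have h16' : (16 : ℤ) < p := by exact_mod_cast h16
      have : 0 < m ^ 2 := by positivity
      nlinarith
    obtain ⟨t, a, b, c, ht, hdisc, ha, hb, hc, hta, hj⟩ := hJ α β hΔ hap
    rw [Finset.mem_preimage]
    change ZMod.castHom dvd_rfl κ _ ∈ _
    rw [← hj, Finset.mem_image]
    refine ⟨(a, b, c), ?_, rfl⟩
    rw [Finset.mem_biUnion]
    refine ⟨t, ?_, hFmem t a b c ht hdisc ha hb hc⟩
    rcases hta with rfl | ⟨hκ, hta⟩
    · exact mem_insert_self _ _
    · refine mem_insert_of_mem ?_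
      rw [Finset.mem_biUnion]
      refine ⟨frobTrace p α β, hmem _ m ham, ?_⟩
      rw [Finset.mem_filter, Finset.mem_Icc, neg_mul, ← abs_le]
      refine ⟨?_, ht, ?_⟩
      · apply abs_le_of_sq_le_sq _ (by positivity)
        have h16' : (16 : ℤ) < p := by exact_mod_cast h16
        nlinarith
      · rw [← hta, inv_mul_cancel_left₀ hκ]

end CountingInvariants

section CountingResidues

variable {f g : Polynomial ℤ}

/-- Nondegeneracy gives a nonzero `2 × 2` minor in the coefficients of numerator and denominator of
the invariant. -/
theorem Nondeg.exists_minor_ne_zero (hfg : Nondeg f g) : ∃ i k : ℕ,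
    (4 * f ^ 3).coeff i * (4 * f ^ 3 + 27 * g ^ 2).coeff k -
      (4 * f ^ 3).coeff k * (4 * f ^ 3 + 27 * g ^ 2).coeff i ≠ 0 := by
  by_contra! h
  obtain ⟨h1, h2⟩ := hfg
  set u := 4 * f ^ 3 with hu
  set v := 4 * f ^ 3 + 27 * g ^ 2 with hv
  have hD : Dpoly f g = -16 * v := rfl
  have hv0 : v ≠ 0 := fun h0 => h1 (by rw [hD, h0, mul_zero])
  obtain ⟨k, hk⟩ : ∃ k, v.coeff k ≠ 0 := by
    by_contra! h0
    exact hv0 (Polynomial.ext (by simpa using h0))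
  have hkq : (v.coeff k : ℚ) ≠ 0 := by exact_mod_cast hk
  refine h2 ⟨1728 * (u.coeff k / v.coeff k), ?_⟩
  have huv : u.map (Int.castRingHom ℚ) =
      C (u.coeff k / v.coeff k : ℚ) * v.map (Int.castRingHom ℚ) := by
    ext i
    rw [coeff_map, coeff_C_mul, coeff_map, eq_intCast, eq_intCast,
      div_mul_eq_mul_div, eq_div_iff hkq]
    exact_mod_cast sub_eq_zero.mp (h i k)
  have hu' : u.map (Int.castRingHom ℚ) = 4 * f.map (Int.castRingHom ℚ) ^ 3 := by
    rw [hu]; simp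
  rw [hD, Polynomial.map_mul, map_mul, mul_assoc]
  have h16 : (-16 : Polynomial ℤ).map (Int.castRingHom ℚ) = -16 := by simp
  have h1728 : (C 1728 : Polynomial ℚ) = 1728 := map_ofNat C 1728
  rw [h16, h1728]
  rw [hu'] at huv
  linear_combination (-27648) * huv

theorem exists_card_residues_le (hfg : Nondeg f g) (d : ℤ) (hd : d < 0) :
    ∃ (p₀ : ℕ) (M : ℝ), 0 < M ∧ ∀ p : ℕ, p.Prime → p₀ < p →
      ∃ s : Finset (ZMod p), (#s : ℝ) ≤ M * (p : ℝ) ^ ((2 : ℝ) / 3) ∧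
        ∀ w : ZMod p, IsFrobField d p ((f.map (Int.castRingHom (ZMod p))).eval w)
          ((g.map (Int.castRingHom (ZMod p))).eval w) → w ∈ s := by
  obtain ⟨i, k, hik⟩ := hfg.exists_minor_ne_zero
  obtain ⟨M, hM, hj⟩ := exists_card_jInv_le d hd
  set u := 4 * f ^ 3 with hu
  set v := 4 * f ^ 3 + 27 * g ^ 2 with hv
  set δ := u.coeff i * v.coeff k - u.coeff k * v.coeff i with hδ
  set D := max u.natDegree v.natDegree with hD
  refine ⟨max 16 δ.natAbs, (D + 1) * M, by positivity, fun p hp hlt => ?_⟩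
  have : Fact p.Prime := ⟨hp⟩
  obtain ⟨s, hs, hmem⟩ := hj p ((le_max_left _ _).trans_lt hlt)
  have hδp : (δ : ZMod p) ≠ 0 := by
    rw [Ne, ZMod.intCast_zmod_eq_zero_iff_dvd]
    intro h
    have := Nat.le_of_dvd (Int.natAbs_pos.mpr hik) (Int.natCast_dvd.mp h)
    exact absurd ((le_max_right 16 δ.natAbs).trans_lt hlt) (by omega)
  set ι := Int.castRingHom (ZMod p) with hι
  let P : ZMod p → Polynomial (ZMod p) := fun j => u.map ι - C j * v.map ι
  have hP (j : ZMod p) : P j ≠ 0 := by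
    intro h0
    have h (n : ℕ) : (u.coeff n : ZMod p) = j * v.coeff n := by
      have := congrArg (fun q => coeff q n) h0
      simp only [P, coeff_sub, coeff_map, coeff_C_mul, coeff_zero, hι, eq_intCast] at this
      exact sub_eq_zero.mp this
    apply hδp
    rw [hδ]
    push_cast
    rw [h i, h k]
    ring
  have hPd (j : ZMod p) : #(P j).roots.toFinset ≤ D + 1 := by
    refine (Multiset.toFinset_card_le _).trans ((card_roots' _).trans ?_)
    refine (natDegree_sub_le _ _).trans ?_
    have h1 : (u.map ι).natDegree ≤ u.natDegree := natDegree_map_le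
    have h2 : (C j * v.map ι).natDegree ≤ v.natDegree :=
      (natDegree_C_mul_le _ _).trans natDegree_map_le
    omega
  refine ⟨s.biUnion fun j => (P j).roots.toFinset, ?_, fun w hw => ?_⟩
  · calc (#(s.biUnion fun j => (P j).roots.toFinset) : ℝ) ≤ (#s * (D + 1) : ℕ) :=
          Nat.cast_le.mpr (card_biUnion_le_card_mul _ _ _ fun j _ => hPd j)
      _ = (D + 1) * #s := by push_cast; ring
      _ ≤ (D + 1) * (M * (p : ℝ) ^ ((2 : ℝ) / 3)) := by gcongr
      _ = _ := by ring
  · rw [Finset.mem_biUnion]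
    refine ⟨_, hmem _ _ hw, ?_⟩
    rw [Multiset.mem_toFinset, mem_roots (hP _), IsRoot.def]
    simp only [P, hu, hv, eval_sub, eval_mul, eval_C, Polynomial.map_mul, Polynomial.map_add,
      Polynomial.map_pow, Polynomial.map_ofNat, eval_pow, eval_add, eval_ofNat]
    rw [jInv, div_mul_cancel₀ _ hw.1, sub_self]

end CountingResidues

section Fractions

theorem card_le_of_separated {ι : Type*} (s : Finset ι) (x : ι → ℝ) {δ : ℝ} (hδ : 0 < δ)
    (h01 : ∀ i ∈ s, 0 ≤ x i ∧ x i ≤ 1)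
    (hsep : ∀ i ∈ s, ∀ j ∈ s, i ≠ j → δ ≤ |x i - x j|) : (#s : ℝ) ≤ 1 / δ + 1 := by
  have hinj : Set.InjOn (fun i => ⌊x i / δ⌋) (s : Set ι) := by
    intro i hi j hj h
    by_contra hne
    have h1 := Int.abs_sub_lt_one_of_floor_eq_floor h
    rw [← sub_div, abs_div, abs_of_pos hδ, div_lt_one hδ] at h1
    exact absurd (hsep i hi j hj hne) (not_le.mpr h1)
  have hsub : s.image (fun i => ⌊x i / δ⌋) ⊆ Icc 0 ⌊1 / δ⌋ := by
    intro n hn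
    obtain ⟨i, hi, rfl⟩ := Finset.mem_image.mp hn
    obtain ⟨h0, h1⟩ := h01 i hi
    exact Finset.mem_Icc.mpr ⟨Int.floor_nonneg.mpr (by positivity), Int.floor_le_floor (by gcongr)⟩
  have hcard := card_le_card hsub
  rw [card_image_of_injOn hinj, Int.card_Icc, sub_zero] at hcard
  have h0 : 0 ≤ ⌊1 / δ⌋ := Int.floor_nonneg.mpr (by positivity)
  calc (#s : ℝ) ≤ ((⌊1 / δ⌋ + 1).toNat : ℝ) := by exact_mod_cast hcard
    _ = (((⌊1 / δ⌋ + 1).toNat : ℤ) : ℝ) := by norm_cast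
    _ = ⌊1 / δ⌋ + 1 := by rw [Int.toNat_of_nonneg (by omega)]; push_cast; ring
    _ ≤ _ := by gcongr; exact Int.floor_le _

theorem bounds_of_mem_FT {T : ℝ} {t : ℚ} (ht : t ∈ FT T) :
    1 ≤ t.num ∧ (t.num : ℝ) ≤ T ∧ (t.den : ℝ) ≤ T := by
  simp only [FT, Finset.mem_image, Finset.mem_filter, Finset.mem_product, Finset.mem_Icc] at ht
  obtain ⟨⟨u, v⟩, ⟨⟨⟨hu1, huT⟩, hv1, hvT⟩, hg⟩, rfl⟩ := ht
  simp only at hu1 huT hv1 hvT hg ⊢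
  have hnum := Rat.num_div_eq_of_coprime (a := u) (b := v) (by omega) hg
  have hden := Rat.den_div_eq_of_coprime (a := u) (b := v) (by omega) hg
  rw [hnum]
  refine ⟨hu1, Int.le_floor.mp huT, ?_⟩
  have : (((u / v : ℚ).den : ℤ) : ℝ) ≤ T := by rw [hden]; exact Int.le_floor.mp hvT
  exact_mod_cast this

theorem card_FT_le {T : ℝ} (hT : 1 ≤ T) : (#(FT T) : ℝ) ≤ T ^ 2 := by
  have h0 : 0 ≤ ⌊T⌋ := Int.floor_nonneg.mpr (by linarith)
  have h1 : #(FT T) ≤ ⌊T⌋.toNat * ⌊T⌋.toNat := by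
    refine card_image_le.trans ((card_filter_le _ _).trans ?_)
    rw [card_product, Int.card_Icc]
    simp
  have h2 : ((⌊T⌋.toNat : ℕ) : ℝ) ≤ T := by
    calc ((⌊T⌋.toNat : ℕ) : ℝ) = (((⌊T⌋.toNat : ℕ) : ℤ) : ℝ) := by norm_cast
      _ = ⌊T⌋ := by rw [Int.toNat_of_nonneg h0]
      _ ≤ T := Int.floor_le T
  calc (#(FT T) : ℝ) ≤ (⌊T⌋.toNat : ℝ) * (⌊T⌋.toNat : ℝ) := by exact_mod_cast h1
    _ ≤ T * T := by gcongr
    _ = T ^ 2 := by ring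

theorem le_abs_cross_of_redQ_eq {p : ℕ} (hp : p.Prime) {s t : ℚ} (hs : ¬ p ∣ s.den)
    (ht : ¬ p ∣ t.den) (h : redQ p s = redQ p t) (hne : s ≠ t) :
    (p : ℤ) ≤ |s.num * t.den - t.num * s.den| := by
  have : Fact p.Prime := ⟨hp⟩
  have h1 : (s.den : ZMod p) ≠ 0 := by rwa [Ne, CharP.cast_eq_zero_iff (ZMod p) p]
  have h2 : (t.den : ZMod p) ≠ 0 := by rwa [Ne, CharP.cast_eq_zero_iff (ZMod p) p]
  rw [redQ, redQ, ← div_eq_mul_inv, ← div_eq_mul_inv, div_eq_div_iff h1 h2] at h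
  refine Int.le_of_dvd (abs_pos.mpr ?_) ((dvd_abs _ _).mpr ?_)
  · intro h0
    exact hne (Rat.eq_iff_mul_eq_mul.mpr (sub_eq_zero.mp h0))
  · rw [← ZMod.intCast_zmod_eq_zero_iff_dvd]
    push_cast
    exact sub_eq_zero.mpr h

theorem card_FT_filter_redQ_le {T : ℝ} (hT : 1 ≤ T) {p : ℕ} (hp : p.Prime) (w : ZMod p) :
    (#((FT T).filter fun t => ¬ p ∣ t.den ∧ redQ p t = w) : ℝ) ≤ 2 * (T ^ 2 / p + 1) := by
  set s := (FT T).filter fun t => ¬ p ∣ t.den ∧ redQ p t = w with hs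
  have hp0 : (0 : ℝ) < p := by exact_mod_cast hp.pos
  have hδ : 0 < (p : ℝ) / T ^ 2 := by positivity
  have hcross (t : ℚ) (ht : t ∈ s) (t' : ℚ) (ht' : t' ∈ s) (hne : t ≠ t') :
      (p : ℝ) ≤ |(t.num : ℝ) * t'.den - t'.num * t.den| := by
    rw [hs, Finset.mem_filter] at ht ht'
    exact_mod_cast le_abs_cross_of_redQ_eq hp ht.2.1 ht'.2.1 (ht.2.2.trans ht'.2.2.symm) hne
  have hb (t : ℚ) (ht : t ∈ s) : (1 : ℝ) ≤ t.num ∧ (t.num : ℝ) ≤ T ∧ (1 : ℝ) ≤ t.den ∧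
      (t.den : ℝ) ≤ T := by
    obtain ⟨h1, h2, h3⟩ := bounds_of_mem_FT (Finset.mem_filter.mp ht).1
    exact ⟨by exact_mod_cast h1, h2, by exact_mod_cast t.pos, h3⟩
  have hsep (a b c e : ℝ) (hb1 : 1 ≤ b) (hbT : b ≤ T) (he1 : 1 ≤ e) (heT : e ≤ T)
      (h : (p : ℝ) ≤ |a * e - c * b|) : (p : ℝ) / T ^ 2 ≤ |a / b - c / e| := by
    have hb0 : 0 < b := by linarith
    have he0 : 0 < e := by linarith
    rw [div_sub_div _ _ hb0.ne' he0.ne', abs_div, abs_of_pos (mul_pos hb0 he0), mul_comm b c, sq]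
    gcongr
  have key1 : (#(s.filter fun t => t.num ≤ t.den) : ℝ) ≤ 1 / (p / T ^ 2) + 1 := by
    refine card_le_of_separated _ (fun t => (t.num : ℝ) / t.den) hδ (fun t ht => ?_)
      fun t ht t' ht' hne => ?_
    · rw [Finset.mem_filter] at ht
      obtain ⟨h1, h2, h3, h4⟩ := hb t ht.1
      have : (t.num : ℝ) ≤ t.den := by exact_mod_cast ht.2
      exact ⟨by positivity, div_le_one_of_le₀ this (by positivity)⟩
    · rw [Finset.mem_filter] at ht ht'
      obtain ⟨h1, h2, h3, h4⟩ := hb t ht.1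
      obtain ⟨h1', h2', h3', h4'⟩ := hb t' ht'.1
      exact hsep _ _ _ _ h3 h4 h3' h4' (hcross t ht.1 t' ht'.1 hne)
  have key2 : (#(s.filter fun t => ¬ t.num ≤ t.den) : ℝ) ≤ 1 / (p / T ^ 2) + 1 := by
    refine card_le_of_separated _ (fun t => (t.den : ℝ) / t.num) hδ (fun t ht => ?_)
      fun t ht t' ht' hne => ?_
    · rw [Finset.mem_filter] at ht
      obtain ⟨h1, h2, h3, h4⟩ := hb t ht.1
      have : (t.den : ℝ) ≤ t.num := by exact_mod_cast (not_le.mp ht.2).le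
      exact ⟨by positivity, div_le_one_of_le₀ this (by positivity)⟩
    · rw [Finset.mem_filter] at ht ht'
      obtain ⟨h1, h2, h3, h4⟩ := hb t ht.1
      obtain ⟨h1', h2', h3', h4'⟩ := hb t' ht'.1
      refine hsep _ _ _ _ h1 h2 h1' h2' ((hcross t ht.1 t' ht'.1 hne).trans_eq ?_)
      rw [← abs_neg]
      congr 1
      ring
  rw [one_div_div] at key1 key2
  have hsplit := card_filter_add_card_filter_not (s := s) (fun t => t.num ≤ (t.den : ℤ))
  rw [← hsplit]
  push_cast
  linarith

end Fractions

section Summation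

theorem sum_rpow_neg_third_le {x : ℝ} (hx : 1 ≤ x) :
    ∑ n ∈ Icc 1 ⌊x⌋₊, (n : ℝ) ^ (-(1 : ℝ) / 3) ≤ 2 * x ^ ((5 : ℝ) / 6) := by
  have hx0 : 0 < x := by linarith
  have hterm (n : ℕ) (hn : n ∈ Icc 1 ⌊x⌋₊) : (n : ℝ) ^ (-(1 : ℝ) / 3) ≤
      x ^ (-(1 : ℝ) / 6) + if n ∈ Icc 1 ⌊x ^ ((1 : ℝ) / 2)⌋₊ then 1 else 0 := by
    rw [Finset.mem_Icc] at hn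
    have hn1 : (1 : ℝ) ≤ n := by exact_mod_cast hn.1
    split_ifs with h
    · have h1 : (n : ℝ) ^ (-(1 : ℝ) / 3) ≤ 1 :=
        Real.rpow_le_one_of_one_le_of_nonpos hn1 (by norm_num)
      have h2 : 0 ≤ x ^ (-(1 : ℝ) / 6) := by positivity
      linarith
    · rw [Finset.mem_Icc, not_and, not_le, Nat.floor_lt (by positivity)] at h
      have h1 := Real.rpow_le_rpow_of_nonpos (by positivity) (h hn.1).le
        (show -(1 : ℝ) / 3 ≤ 0 by norm_num)
      rw [← Real.rpow_mul hx0.le] at h1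
      norm_num at h1 ⊢
      exact h1
  refine (sum_le_sum hterm).trans ?_
  rw [sum_add_distrib, sum_const, Nat.card_Icc, nsmul_eq_mul, sum_boole]
  have h1 : ((⌊x⌋₊ + 1 - 1 : ℕ) : ℝ) * x ^ (-(1 : ℝ) / 6) ≤ x ^ ((5 : ℝ) / 6) := by
    rw [Nat.add_sub_cancel]
    calc (⌊x⌋₊ : ℝ) * x ^ (-(1 : ℝ) / 6) ≤ x * x ^ (-(1 : ℝ) / 6) := by
          gcongr; exact Nat.floor_le hx0.le
      _ = x ^ ((5 : ℝ) / 6) := by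
          rw [← Real.rpow_one_add' hx0.le (by norm_num)]; norm_num
  have h2 : (#((Icc 1 ⌊x⌋₊).filter fun n => n ∈ Icc 1 ⌊x ^ ((1 : ℝ) / 2)⌋₊) : ℝ) ≤
      x ^ ((5 : ℝ) / 6) := by
    have h3 : #((Icc 1 ⌊x⌋₊).filter fun n => n ∈ Icc 1 ⌊x ^ ((1 : ℝ) / 2)⌋₊) ≤
        ⌊x ^ ((1 : ℝ) / 2)⌋₊ := by
      refine (card_le_card (t := Icc 1 ⌊x ^ ((1 : ℝ) / 2)⌋₊) fun n hn => ?_).trans (by simp)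
      exact (Finset.mem_filter.mp hn).2
    calc (#((Icc 1 ⌊x⌋₊).filter fun n => n ∈ Icc 1 ⌊x ^ ((1 : ℝ) / 2)⌋₊) : ℝ) ≤
          ⌊x ^ ((1 : ℝ) / 2)⌋₊ := by exact_mod_cast h3
      _ ≤ x ^ ((1 : ℝ) / 2) := Nat.floor_le (by positivity)
      _ ≤ _ := Real.rpow_le_rpow_of_exponent_le hx (by norm_num)
  linarith

theorem isFrobField_of_goodRed {f g : Polynomial ℤ} {d : ℤ} {p : ℕ} {t : ℚ}
    (h : goodRed f g p t ∧ apE f g p t ≠ 0 ∧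
      ∃ m : ℤ, 0 < m ∧ (apE f g p t) ^ 2 - 4 * (p : ℤ) = d * m ^ 2) :
    IsFrobField d p ((f.map (Int.castRingHom (ZMod p))).eval (redQ p t))
      ((g.map (Int.castRingHom (ZMod p))).eval (redQ p t)) := by
  refine ⟨fun h0 => h.1.2 ?_, h.2.1, h.2.2⟩
  rw [Dpoly]
  simp only [Polynomial.map_mul, Polynomial.map_add, Polynomial.map_pow, Polynomial.map_ofNat,
    eval_mul, eval_add, eval_pow, eval_ofNat, h0, mul_zero]

end Summation

/-- Theorem 1.4 (Lang–Trotter for Frobenius fields on average over `F(T)`),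
for the imaginary quadratic field `K = ℚ(√d)`, `d < 0` squarefree. -/
theorem LT_fields_average_FT (f g : Polynomial ℤ) (hfg : Nondeg f g)
    (d : ℤ) (hd : d < 0) (hsf : Squarefree d) (ε : ℝ) (hε : 0 < ε) :
    ∃ C : ℝ, 0 < C ∧ ∀ T x : ℝ, 1 ≤ T → 2 ≤ x →
      (∑ t ∈ (FT T).filter fun t => aeval t (Dpoly f g) ≠ 0, (piK f g d t x : ℝ)) ≤
        C * (T * x ^ (4 / 3 + ε) + T ^ 2 * x ^ ((5 : ℝ) / 6)) := by
  obtain ⟨p₀, M, hM, hres⟩ := exists_card_residues_le hfg d hd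
  refine ⟨p₀ + 4 * M + 1, by positivity, fun T x hT hx => ?_⟩
  have hx0 : 0 < x := by linarith
  have hx1 : 1 ≤ x := by linarith
  have hT0 : 0 < T := by linarith
  set U := (FT T).filter fun t => aeval t (Dpoly f g) ≠ 0 with hU
  have hUFT : U ⊆ FT T := filter_subset _ _
  have hUcard : (#U : ℝ) ≤ T ^ 2 := (Nat.cast_le.mpr (card_le_card hUFT)).trans (card_FT_le hT)
  let r : ℚ → ℕ → Prop := fun t p => p.Prime ∧ goodRed f g p t ∧ apE f g p t ≠ 0 ∧
        ∃ m : ℤ, 0 < m ∧ (apE f g p t) ^ 2 - 4 * (p : ℤ) = d * m ^ 2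
  have hswap : (∑ t ∈ U, (piK f g d t x : ℝ)) =
      ∑ p ∈ Icc 1 ⌊x⌋₊, (#(U.filter fun t => r t p) : ℝ) := by
    have h := sum_card_bipartiteAbove_eq_sum_card_bipartiteBelow (s := U) (t := Icc 1 ⌊x⌋₊) r
    exact_mod_cast h
  rw [hswap]
  have hfloor : (#(Icc 1 ⌊x⌋₊) : ℝ) ≤ x := by
    rw [Nat.card_Icc, Nat.add_sub_cancel]; exact Nat.floor_le hx0.le
  have hexp : x ^ ((4 : ℝ) / 3) ≤ x ^ (4 / 3 + ε) :=
    Real.rpow_le_rpow_of_exponent_le hx1 (by linarith)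
  have hpos1 : 0 ≤ T * x ^ (4 / 3 + ε) := by positivity
  have hpos2 : 0 ≤ T ^ 2 * x ^ ((5 : ℝ) / 6) := by positivity
  have hfilter (p : ℕ) : (#(U.filter fun t => r t p) : ℝ) ≤ T ^ 2 :=
    (Nat.cast_le.mpr (card_filter_le _ _)).trans hUcard
  rcases le_total T (x ^ ((1 : ℝ) / 3)) with hTx | hTx
  · calc ∑ p ∈ Icc 1 ⌊x⌋₊, (#(U.filter fun t => r t p) : ℝ) ≤ ∑ p ∈ Icc 1 ⌊x⌋₊, T ^ 2 :=
          sum_le_sum fun p _ => hfilter p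
      _ = #(Icc 1 ⌊x⌋₊) * T ^ 2 := by rw [sum_const, nsmul_eq_mul]
      _ ≤ x * (T * x ^ ((1 : ℝ) / 3)) := by
        rw [sq]; gcongr
      _ = T * x ^ ((4 : ℝ) / 3) := by
        rw [show (4 : ℝ) / 3 = 1 + 1 / 3 by norm_num, Real.rpow_add hx0, Real.rpow_one]; ring
      _ ≤ 1 * (T * x ^ (4 / 3 + ε)) := by rw [one_mul]; gcongr
      _ ≤ (p₀ + 4 * M + 1) * (T * x ^ (4 / 3 + ε) + T ^ 2 * x ^ ((5 : ℝ) / 6)) := by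
        have h0 : (0 : ℝ) ≤ p₀ := by positivity
        gcongr <;> linarith
  · have hterm (p : ℕ) (hp : p ∈ Icc 1 ⌊x⌋₊) : (#(U.filter fun t => r t p) : ℝ) ≤
        (if p ∈ Icc 1 p₀ then T ^ 2 else 0) +
          2 * M * (T ^ 2 * (p : ℝ) ^ (-(1 : ℝ) / 3) + x ^ ((2 : ℝ) / 3)) := by
      rw [Finset.mem_Icc] at hp
      have hp0 : (0 : ℝ) < p := by exact_mod_cast hp.1
      have hnn : 0 ≤ 2 * M * (T ^ 2 * (p : ℝ) ^ (-(1 : ℝ) / 3) + x ^ ((2 : ℝ) / 3)) := by positivity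
      split_ifs with h
      · linarith [hfilter p]
      rw [zero_add]
      by_cases hpp : p.Prime
      swap
      · have : U.filter (fun t => r t p) = ∅ := filter_eq_empty_iff.mpr fun t _ ht => hpp ht.1
        rw [this]
        simpa using hnn
      obtain ⟨s, hs, hmem⟩ := hres p hpp (by rw [Finset.mem_Icc] at h; omega)
      have hsub : U.filter (fun t => r t p) ⊆
          s.biUnion fun w => (FT T).filter fun t => ¬ p ∣ t.den ∧ redQ p t = w := by
        intro t ht
        rw [Finset.mem_filter] at ht
        rw [Finset.mem_biUnion]
        exact ⟨redQ p t, hmem _ (isFrobField_of_goodRed ht.2.2),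
          Finset.mem_filter.mpr ⟨hUFT ht.1, ht.2.2.1.1, rfl⟩⟩
      calc (#(U.filter fun t => r t p) : ℝ) ≤
            #(s.biUnion fun w => (FT T).filter fun t => ¬ p ∣ t.den ∧ redQ p t = w) :=
            Nat.cast_le.mpr (card_le_card hsub)
        _ ≤ ∑ w ∈ s, (#((FT T).filter fun t => ¬ p ∣ t.den ∧ redQ p t = w) : ℝ) := by
            exact_mod_cast card_biUnion_le
        _ ≤ ∑ w ∈ s, 2 * (T ^ 2 / p + 1) :=
            sum_le_sum fun w _ => card_FT_filter_redQ_le hT hpp w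
        _ = #s * (2 * (T ^ 2 / p + 1)) := by rw [sum_const, nsmul_eq_mul]
        _ ≤ M * (p : ℝ) ^ ((2 : ℝ) / 3) * (2 * (T ^ 2 / p + 1)) := by gcongr
        _ = 2 * M * (T ^ 2 * ((p : ℝ) ^ ((2 : ℝ) / 3) / p) + (p : ℝ) ^ ((2 : ℝ) / 3)) := by ring
        _ = 2 * M * (T ^ 2 * (p : ℝ) ^ (-(1 : ℝ) / 3) + (p : ℝ) ^ ((2 : ℝ) / 3)) := by
            rw [← Real.rpow_sub_one hp0.ne']; norm_num
        _ ≤ _ := by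
            gcongr
            exact (Nat.le_floor_iff hx0.le).mp hp.2
    refine (sum_le_sum hterm).trans ?_
    rw [sum_add_distrib, ← mul_sum, sum_add_distrib, ← mul_sum, sum_const, nsmul_eq_mul]
    have h1 : ∑ p ∈ Icc 1 ⌊x⌋₊, (if p ∈ Icc 1 p₀ then T ^ 2 else 0) ≤ p₀ * T ^ 2 := by
      rw [← sum_filter, sum_const, nsmul_eq_mul]
      gcongr
      refine (card_le_card (t := Icc 1 p₀) fun n hn => ?_).trans (by simp)
      exact (Finset.mem_filter.mp hn).2
    have h2 := sum_rpow_neg_third_le hx1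
    have h3 : (#(Icc 1 ⌊x⌋₊) : ℝ) * x ^ ((2 : ℝ) / 3) ≤ T * x ^ (4 / 3 + ε) := by
      calc (#(Icc 1 ⌊x⌋₊) : ℝ) * x ^ ((2 : ℝ) / 3) ≤ x * x ^ ((2 : ℝ) / 3) := by gcongr
        _ = x ^ ((1 : ℝ) / 3) * x ^ ((4 : ℝ) / 3) := by
            rw [← Real.rpow_add hx0, ← Real.rpow_one_add' hx0.le (by norm_num)]; norm_num
        _ ≤ _ := by gcongr
    have h4 : T ^ 2 ≤ T ^ 2 * x ^ ((5 : ℝ) / 6) :=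
      le_mul_of_one_le_right (by positivity) (Real.one_le_rpow hx1 (by norm_num))
    calc _ ≤ p₀ * T ^ 2 + 2 * M * (T ^ 2 * (2 * x ^ ((5 : ℝ) / 6)) + T * x ^ (4 / 3 + ε)) := by
          gcongr
      _ ≤ p₀ * (T ^ 2 * x ^ ((5 : ℝ) / 6)) +
          2 * M * (T ^ 2 * (2 * x ^ ((5 : ℝ) / 6)) + T * x ^ (4 / 3 + ε)) := by gcongr
      _ ≤ _ := by
        have h0 : (0 : ℝ) ≤ p₀ := by positivity
        nlinarith [mul_nonneg h0 hpos1, mul_nonneg hM.le hpos1]
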